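/- Every simple graph G of maximum degree 5 has a 5-edge-colorable subgraph with at least (23/27)·|E(G)| edges. -/

import Mathlib

/-- A proper edge coloring of (the edges of) `G` using colors `< k`. -/
def IsProperEdgeColoring {V : Type*} (G : SimpleGraph V) (k : ℕ) (c : Sym2 V → ℕ) : Prop :=
  (∀ e ∈ G.edgeSet, c e < k) ∧
  ∀ e₁ ∈ G.edgeSet, ∀ e₂ ∈ G.edgeSet, e₁ ≠ e₂ → (∃ v, v ∈ e₁ ∧ v ∈ e₂) → c e₁ ≠ c e₂

set_option linter.unusedSectionVars false

namespace EdgeFive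

open Finset

section

/-- Partial edge colorings with five colors, as functions on ordered pairs. -/
abbrev PCol (V : Type*) := V → V → Option (Fin 5)

structure IsPCol {V : Type*} (G : SimpleGraph V) (c : PCol V) : Prop where
  symm : ∀ u v, c u v = c v u
  adj : ∀ u v α, c u v = some α → G.Adj u v
  inj : ∀ v u w α, c v u = some α → c v w = some α → u = w

/-- `uv` is an edge of `G` left uncolored by `c`. -/
def Unc {V : Type*} (G : SimpleGraph V) (c : PCol V) (u v : V) : Prop :=
  G.Adj u v ∧ c u v = none

section Basic

variable {V : Type*} {G : SimpleGraph V} {c c' : PCol V}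

theorem IsPCol.irrefl (h : IsPCol G c) (u : V) : c u u = none := by
  cases h' : c u u with
  | none => rfl
  | some α => exact absurd (h.adj _ _ _ h') (G.irrefl)

theorem Unc.symm (hc : IsPCol G c) {u v : V} (h : Unc G c u v) : Unc G c v u :=
  ⟨h.1.symm, by rw [hc.symm]; exact h.2⟩

theorem Unc.ne {u v : V} (h : Unc G c u v) : u ≠ v := h.1.ne

variable [Fintype V]

/-- Twice the number of colored edges. -/
def num (c : PCol V) : ℕ := ∑ p : V × V, if c p.1 p.2 = none then 0 else 1

/-- The colors missing at a vertex. -/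
def miss (c : PCol V) (v : V) : Finset (Fin 5) := univ.filter fun α => ∀ u, c v u ≠ some α

theorem mem_miss {v : V} {α : Fin 5} : α ∈ miss c v ↔ ∀ u, c v u ≠ some α := by
  simp [miss]

theorem not_mem_miss {v : V} {α : Fin 5} : α ∉ miss c v ↔ ∃ u, c v u = some α := by
  simp [miss]

/-- A partial coloring with the largest possible number of colored edges. -/
structure MaxCol (G : SimpleGraph V) (c : PCol V) : Prop extends IsPCol G c where
  le : ∀ c', IsPCol G c' → num c' ≤ num c

theorem MaxCol.of_num (h : MaxCol G c) (h' : IsPCol G c') (hn : num c' = num c) : MaxCol G c' :=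
  ⟨h', fun d hd => hn ▸ h.le d hd⟩

variable [DecidableEq V]

/-- Overwrite the value at the edge `uv`. -/
def setEdge (c : PCol V) (u v : V) (o : Option (Fin 5)) : PCol V := fun p q =>
  if (p = u ∧ q = v) ∨ (p = v ∧ q = u) then o else c p q

theorem setEdge_none (h : IsPCol G c) (u v : V) : IsPCol G (setEdge c u v none) := by
  obtain ⟨h1, h2, h3⟩ := h
  constructor
  · intro p q; simp only [setEdge]; grind
  · intro p q α; simp only [setEdge]; grind
  · intro p q r α; simp only [setEdge]; grind

theorem setEdge_some (h : IsPCol G c) {u v : V} {α : Fin 5} (ha : G.Adj u v)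
    (hu : α ∈ miss c u) (hv : α ∈ miss c v) : IsPCol G (setEdge c u v (some α)) := by
  obtain ⟨h1, h2, h3⟩ := h
  have ha' := ha.symm
  rw [mem_miss] at hu hv
  constructor
  · intro p q; simp only [setEdge]; grind
  · intro p q β; simp only [setEdge]; grind
  · intro p q r β; simp only [setEdge]; grind

theorem sum_edge_indicator {u v : V} (h : u ≠ v) :
    (∑ p : V × V, if (p.1 = u ∧ p.2 = v) ∨ (p.1 = v ∧ p.2 = u) then 1 else 0) = 2 := by
  rw [← Finset.sum_filter, Finset.sum_const]
  have : (univ.filter fun p : V × V => (p.1 = u ∧ p.2 = v) ∨ (p.1 = v ∧ p.2 = u))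
      = {(u, v), (v, u)} := by
    ext ⟨a, b⟩; simp
  rw [this, Finset.card_pair (by simp [h])]
  simp

theorem num_setEdge_some (h : IsPCol G c) {u v : V} (ha : u ≠ v) (hn : c u v = none) (α : Fin 5) :
    num (setEdge c u v (some α)) = num c + 2 := by
  rw [num, num, ← sum_edge_indicator ha, ← Finset.sum_add_distrib]
  refine Finset.sum_congr rfl fun p _ => ?_
  have := h.symm
  simp only [setEdge]
  grind

theorem num_setEdge_none (h : IsPCol G c) {u v : V} (ha : u ≠ v) (hn : c u v ≠ none) :
    num (setEdge c u v none) + 2 = num c := by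
  rw [num, num, ← sum_edge_indicator ha, ← Finset.sum_add_distrib]
  refine Finset.sum_congr rfl fun p _ => ?_
  have := h.symm
  simp only [setEdge]
  grind

/-- The two ends of an uncolored edge have no common missing color. -/
theorem MaxCol.disjoint_miss (h : MaxCol G c) {u v : V} (hu : Unc G c u v) ⦃α : Fin 5⦄
    (h1 : α ∈ miss c u) (h2 : α ∈ miss c v) : False := by
  have := h.le _ (setEdge_some h.toIsPCol hu.1 h1 h2)
  rw [num_setEdge_some h.toIsPCol hu.ne hu.2] at this
  omega

/-- Uncolor `vw` and give its color `α` to `uv`. -/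
def slide (c : PCol V) (u v w : V) (α : Fin 5) : PCol V :=
  setEdge (setEdge c v w none) u v (some α)

theorem slide_apply (c : PCol V) (u v w : V) (α : Fin 5) (p q : V) : slide c u v w α p q =
    if (p = u ∧ q = v) ∨ (p = v ∧ q = u) then some α
    else if (p = v ∧ q = w) ∨ (p = w ∧ q = v) then none else c p q := rfl

theorem isPCol_slide (h : IsPCol G c) {u v w : V} {α : Fin 5} (hu : Unc G c u v)
    (hα : α ∈ miss c u) (hw : c v w = some α) : IsPCol G (slide c u v w α) := by
  refine setEdge_some (setEdge_none h _ _) hu.1 ?_ ?_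
  · rw [mem_miss] at *
    intro x; simp only [setEdge]; grind
  · rw [mem_miss] at *
    have := h.inj v
    intro x; simp only [setEdge]; grind

theorem num_slide (h : IsPCol G c) {u v w : V} {α : Fin 5} (hu : Unc G c u v)
    (_hα : α ∈ miss c u) (hw : c v w = some α) : num (slide c u v w α) = num c := by
  have h1 : v ≠ w := (h.adj _ _ _ hw).ne
  rw [slide, num_setEdge_some (setEdge_none h _ _) hu.ne, num_setEdge_none h h1 (by simp [hw])]
  have := hu.2
  simp only [setEdge]; grind

theorem miss_slide (h : IsPCol G c) {u v w : V} {α : Fin 5} (hu : Unc G c u v)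
    (hα : α ∈ miss c u) (hw : c v w = some α) (x : V) :
    miss (slide c u v w α) x =
      if x = u then (miss c u).erase α else if x = w then insert α (miss c w) else miss c x := by
  have h1 : v ≠ w := (h.adj _ _ _ hw).ne
  have h2 := hu.ne
  have h3 : u ≠ w := by rintro rfl; exact absurd (h.symm _ _ ▸ hw) (mem_miss.1 hα v)
  have hs := h.symm
  have hi := h.inj
  obtain ⟨h4, h5⟩ := hu
  have h6 := mem_miss.1 hα
  ext β
  split_ifs with hxu hxw
  · subst hxu
    simp only [mem_erase, mem_miss, slide_apply]
    constructor
    · intro hb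
      exact ⟨by have := hb v; grind, fun y => by have := hb y; grind⟩
    · rintro ⟨hb, hb'⟩ y
      have := hb' y; grind
  · subst hxw
    simp only [mem_insert, mem_miss, slide_apply]
    constructor
    · intro hb
      by_cases hba : β = α
      · exact Or.inl hba
      · right; intro y; have := hb y; grind
    · rintro (hb | hb) y
      · grind
      · have := hb y; grind
  · simp only [mem_miss, slide_apply]
    constructor
    · intro hb y
      have := hb y; have := hb u; grind
    · intro hb y
      have := hb y; have := hb w; grind

theorem MaxCol.slide (h : MaxCol G c) {u v w : V} {α : Fin 5} (hu : Unc G c u v)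
    (hα : α ∈ miss c u) (hw : c v w = some α) : MaxCol G (slide c u v w α) :=
  h.of_num (isPCol_slide h.toIsPCol hu hα hw) (num_slide h.toIsPCol hu hα hw)

theorem unc_slide_iff (h : IsPCol G c) {u v w : V} {α : Fin 5}
    (hw : c v w = some α) (p q : V) :
    Unc G (slide c u v w α) p q ↔
      (¬((p = u ∧ q = v) ∨ (p = v ∧ q = u)) ∧
        ((p = v ∧ q = w) ∨ (p = w ∧ q = v) ∨ Unc G c p q)) := by
  have h1 := h.adj _ _ _ hw
  have h2 := h1.symm
  simp only [Unc, slide_apply]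
  grind

end Basic

end

section

/-- A finite connected graph of maximum degree two has at most two vertices of degree at most one. -/
theorem false_of_three_ends {W : Type*} [Fintype W] [DecidableEq W] {K : SimpleGraph W}
    (hK : K.Connected) (f : W → Finset W) (hf : ∀ v u, K.Adj v u → u ∈ f v)
    (h2 : ∀ v, (f v).card ≤ 2) {a b d : W} (hab : a ≠ b) (had : a ≠ d) (hbd : b ≠ d)
    (ha : (f a).card ≤ 1) (hb : (f b).card ≤ 1) (hd : (f d).card ≤ 1) : False := by
  classical
  have h1 := hK.card_vert_le_card_edgeSet_add_one
  have h3 := K.sum_degrees_eq_twice_card_edges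
  rw [Nat.card_eq_fintype_card, Nat.card_eq_fintype_card, ← SimpleGraph.edgeFinset_card] at h1
  have h4 : ∀ v, K.degree v + (if v ∈ ({a, b, d} : Finset W) then 1 else 0) ≤ 2 := by
    intro v
    have : K.degree v ≤ (f v).card := by
      rw [← SimpleGraph.card_neighborFinset_eq_degree]
      exact card_le_card fun u hu => hf v u (by simpa using hu)
    have := h2 v
    split_ifs with h
    · simp only [mem_insert, mem_singleton] at h
      rcases h with rfl | rfl | rfl <;> omega
    · omega
  have h5 := Finset.sum_le_sum fun v (_ : v ∈ (univ : Finset W)) => h4 v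
  rw [Finset.sum_add_distrib, h3, Finset.sum_ite_mem, univ_inter, sum_const, sum_const] at h5
  have : ({a, b, d} : Finset W).card = 3 := by
    rw [card_insert_of_notMem, card_pair hbd]; simp [hab, had]
  rw [this] at h5
  simp only [smul_eq_mul, card_univ] at h5
  omega

variable {V : Type*} [Fintype V] [DecidableEq V] {G : SimpleGraph V} {c c' : PCol V}

/-- The subgraph formed by the edges of colors `α` and `β`. -/
def kempe (c : PCol V) (α β : Fin 5) : SimpleGraph V :=
  SimpleGraph.fromRel fun u v => c u v = some α ∨ c u v = some β

theorem kempe_adj (hc : IsPCol G c) {α β : Fin 5} {u v : V} :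
    (kempe c α β).Adj u v ↔ c u v = some α ∨ c u v = some β := by
  rw [kempe, SimpleGraph.fromRel_adj, hc.symm v u]
  have := hc.irrefl u
  grind

theorem kempe_three_ends (hc : IsPCol G c) {α β : Fin 5} {a b d : V} (hab : a ≠ b) (had : a ≠ d)
    (hbd : b ≠ d) (ha : α ∈ miss c a ∨ β ∈ miss c a) (hb : α ∈ miss c b ∨ β ∈ miss c b)
    (hd : α ∈ miss c d ∨ β ∈ miss c d) (rab : (kempe c α β).Reachable a b)
    (rad : (kempe c α β).Reachable a d) : False := by
  classical
  have ca : a ∈ ((kempe c α β).connectedComponentMk a).supp := rfl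
  have cb : b ∈ ((kempe c α β).connectedComponentMk a).supp :=
    SimpleGraph.ConnectedComponent.sound rab.symm
  have cd : d ∈ ((kempe c α β).connectedComponentMk a).supp :=
    SimpleGraph.ConnectedComponent.sound rad.symm
  generalize (kempe c α β).connectedComponentMk a = C at ca cb cd
  have one : ∀ (γ : Fin 5) (x : V), (univ.filter fun u : C => c x u = some γ).card ≤ 1 := by
    intro γ x
    rw [card_le_one]
    rintro ⟨u, _⟩ hu ⟨w, _⟩ hw
    simp only [mem_filter, mem_univ, true_and] at hu hw
    exact Subtype.ext (hc.inj x u w γ hu hw)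
  have zero : ∀ (γ : Fin 5) (x : V), γ ∈ miss c x →
      (univ.filter fun u : C => c x u = some γ).card = 0 := by
    intro γ x hx
    rw [card_eq_zero, filter_eq_empty_iff]
    intro u _
    exact mem_miss.1 hx u
  have low : ∀ x, α ∈ miss c x ∨ β ∈ miss c x → (univ.filter fun u : C => c x u = some α).card +
      (univ.filter fun u : C => c x u = some β).card ≤ 1 := by
    rintro x (hx | hx)
    · have := zero α x hx; have := one β x; omega
    · have := zero β x hx; have := one α x; omega
  refine false_of_three_ends C.connected_toSimpleGraph
    (fun x => (univ.filter fun u : C => c x u = some α) ∪ univ.filter fun u : C => c x u = some β)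
    ?_ ?_ (a := ⟨a, ca⟩) (b := ⟨b, cb⟩) (d := ⟨d, cd⟩) (by simpa) (by simpa) (by simpa) ?_ ?_ ?_
  · rintro ⟨v, hv⟩ ⟨u, hu⟩ h
    rw [SimpleGraph.ConnectedComponent.toSimpleGraph_adj, kempe_adj hc] at h
    simpa using h
  · intro v
    exact (card_union_le _ _).trans (by have := one α v; have := one β v; omega)
  · exact (card_union_le _ _).trans (low a ha)
  · exact (card_union_le _ _).trans (low b hb)
  · exact (card_union_le _ _).trans (low d hd)

/-- Exchange the colors `α` and `β` on the edges meeting `X`. -/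
def kempeSwap (c : PCol V) (X : Set V) [DecidablePred (· ∈ X)] (α β : Fin 5) : PCol V :=
  fun u v => if u ∈ X then (c u v).map (Equiv.swap α β) else c u v

section Swap

variable {X : Set V} [DecidablePred (· ∈ X)] {α β : Fin 5}
  (hX : ∀ u v, c u v = some α ∨ c u v = some β → (u ∈ X ↔ v ∈ X))
include hX

theorem kempeSwap_eq_none {u v : V} : kempeSwap c X α β u v = none ↔ c u v = none := by
  unfold kempeSwap; split_ifs <;> simp

theorem isPCol_kempeSwap (hc : IsPCol G c) : IsPCol G (kempeSwap c X α β) := by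
  obtain ⟨h1, h2, h3⟩ := hc
  have key : ∀ u v, kempeSwap c X α β u v =
      if u ∈ X ∧ v ∈ X then (c u v).map (Equiv.swap α β) else c u v := by
    intro u v
    have := hX u v
    unfold kempeSwap
    by_cases hu : u ∈ X <;> by_cases hv : v ∈ X <;> simp only [hu, hv, if_true, if_false,
      and_self, and_true, and_false]
    cases h : c u v with
    | none => rfl
    | some γ => simp only [Option.map_some, Option.some.injEq]
                exact Equiv.swap_apply_of_ne_of_ne (by grind) (by grind)
  constructor
  · intro u v; rw [key, key, h1 u v]; simp only [and_comm]
  · intro u v γ h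
    cases h' : c u v with
    | none => rw [(kempeSwap_eq_none hX).2 h'] at h; cases h
    | some δ => exact h2 _ _ _ h'
  · intro u v w γ
    unfold kempeSwap
    have := h3 u v w
    split_ifs
    · simp only [Option.map_eq_some_iff]
      rintro ⟨δ, h, hδ⟩ ⟨ε, h', hε⟩
      have : δ = ε := (Equiv.swap α β).injective (hδ.trans hε.symm)
      subst this
      exact h3 _ _ _ _ h h'
    · exact h3 _ _ _ _

theorem num_kempeSwap : num (kempeSwap c X α β) = num c := by
  unfold num
  simp only [kempeSwap_eq_none hX]

theorem unc_kempeSwap {u v : V} : Unc G (kempeSwap c X α β) u v ↔ Unc G c u v := by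
  unfold Unc; rw [kempeSwap_eq_none hX]

omit hX in
theorem miss_kempeSwap_of_notMem {v : V} (hv : v ∉ X) :
    miss (kempeSwap c X α β) v = miss c v := by
  ext γ; simp [mem_miss, kempeSwap, hv]

omit hX in
theorem mem_miss_kempeSwap_of_mem {v : V} (hv : v ∈ X) (hα : α ∈ miss c v) :
    β ∈ miss (kempeSwap c X α β) v := by
  rw [mem_miss] at *
  intro u hu
  simp only [kempeSwap, hv, if_true, Option.map_eq_some_iff] at hu
  obtain ⟨γ, h1, h2⟩ := hu
  rw [Equiv.swap_apply_eq_iff, Equiv.swap_apply_right] at h2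
  exact hα u (h2 ▸ h1)

end Swap

theorem exists_kempeSwap (h : MaxCol G c) {α β : Fin 5} {v : V} (hα : α ∈ miss c v) :
    ∃ c', MaxCol G c' ∧ (∀ u w, Unc G c' u w ↔ Unc G c u w) ∧ β ∈ miss c' v ∧
      ∀ u, ¬ (kempe c α β).Reachable u v → miss c' u = miss c u := by
  classical
  let X : Set V := {u | (kempe c α β).Reachable u v}
  have hX : ∀ u w, c u w = some α ∨ c u w = some β → (u ∈ X ↔ w ∈ X) := by
    intro u w huw
    have := ((kempe_adj h.toIsPCol).2 huw).reachable
    exact ⟨fun h => this.symm.trans h, fun h => this.trans h⟩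
  exact ⟨kempeSwap c X α β, h.of_num (isPCol_kempeSwap hX h.toIsPCol) (num_kempeSwap hX),
    fun u w => unc_kempeSwap hX, mem_miss_kempeSwap_of_mem (show v ∈ X from .refl _) hα,
    fun u hu => miss_kempeSwap_of_notMem hu⟩

theorem MaxCol.reachable (h : MaxCol G c) {u v : V} (hu : Unc G c u v) {α β : Fin 5}
    (hα : α ∈ miss c u) (hβ : β ∈ miss c v) : (kempe c α β).Reachable u v := by
  by_contra hr
  obtain ⟨c', h1, h2, h3, h4⟩ := exists_kempeSwap h (β := β) hα
  rw [← h4 v fun h => hr h.symm] at hβ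
  exact h1.disjoint_miss ((h2 _ _).2 hu) h3 hβ

variable (hdeg : ∀ v, (G.neighborSet v).ncard ≤ 5)
include hdeg

theorem card_le_card_miss (hc : IsPCol G c) {v : V} {S : Finset V} (hS : ∀ u ∈ S, Unc G c v u) :
    S.card ≤ (miss c v).card := by
  classical
  have h1 : ∀ α ∈ (miss c v)ᶜ, ∃ u, c v u = some α := by
    intro α hα
    rw [mem_compl] at hα
    exact not_mem_miss.1 hα
  have : Nonempty V := ⟨v⟩
  choose! f hf using h1
  have h2 : ((miss c v)ᶜ).card = ((miss c v)ᶜ.image f).card := by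
    rw [card_image_of_injOn]
    intro a ha b hb hab
    have h3 := hf a ha
    have h4 := hf b hb
    rw [hab, h4] at h3
    exact (Option.some.inj h3).symm
  have h3 : Disjoint S ((miss c v)ᶜ.image f) := by
    rw [disjoint_left]
    intro u hu hu'
    obtain ⟨α, hα, rfl⟩ := mem_image.1 hu'
    have := hf α hα
    rw [(hS _ hu).2] at this
    cases this
  have h4 : (S ∪ (miss c v)ᶜ.image f : Finset V).card ≤ 5 := by
    refine le_trans ?_ (hdeg v)
    rw [← Set.ncard_coe_finset]
    refine Set.ncard_le_ncard ?_ (Set.toFinite _)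
    intro u hu
    rw [mem_coe, mem_union] at hu
    rcases hu with hu | hu
    · exact (hS u hu).1
    · obtain ⟨α, hα, rfl⟩ := mem_image.1 hu
      exact hc.adj _ _ _ (hf α hα)
  rw [card_union_of_disjoint h3, ← h2, card_compl, Fintype.card_fin] at h4
  have := card_le_univ (miss c v)
  rw [Fintype.card_fin] at this
  omega

theorem one_le_card_miss (hc : IsPCol G c) {v u : V} (h : Unc G c v u) :
    1 ≤ (miss c v).card := by
  simpa using card_le_card_miss hdeg hc (v := v) (S := {u}) (by simpa using h)

theorem two_le_card_miss (hc : IsPCol G c) {v u w : V} (h : Unc G c v u) (h' : Unc G c v w)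
    (hne : u ≠ w) : 2 ≤ (miss c v).card := by
  simpa [card_pair hne] using card_le_card_miss hdeg hc (v := v) (S := {u, w})
    (by intro x hx; simp at hx; rcases hx with rfl | rfl <;> assumption)

theorem miss_nonempty (hc : IsPCol G c) {v u : V} (h : Unc G c v u) : ∃ α, α ∈ miss c v := by
  have := one_le_card_miss hdeg hc h
  exact card_pos.1 this

/-- Two uncolored edges at `v`: their other ends have no common missing color. -/
theorem MaxCol.disjoint_miss_two (h : MaxCol G c) {u v w : V} (hu : Unc G c v u)
    (hw : Unc G c v w) (hne : u ≠ w) ⦃α : Fin 5⦄ (h1 : α ∈ miss c u) (h2 : α ∈ miss c w) :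
    False := by
  obtain ⟨β, hβ⟩ := miss_nonempty hdeg h.toIsPCol hu
  exact kempe_three_ends h.toIsPCol hu.ne hw.ne hne (Or.inr hβ) (Or.inl h1) (Or.inl h2)
    (h.reachable (hu.symm h.toIsPCol) h1 hβ).symm (h.reachable (hw.symm h.toIsPCol) h2 hβ).symm

theorem MaxCol.disjoint_miss_three (h : MaxCol G c) {u v w t : V} (huv : Unc G c u v)
    (hvw : Unc G c v w) (hwt : Unc G c w t) (hvt : v ≠ t) (hut : u ≠ t) ⦃α : Fin 5⦄
    (h1 : α ∈ miss c u) (h2 : α ∈ miss c t) : False := by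
  obtain ⟨β, hβ⟩ := miss_nonempty hdeg h.toIsPCol hvw
  have hr := h.reachable huv h1 hβ
  by_cases hvr : (kempe c α β).Reachable v t
  · exact kempe_three_ends h.toIsPCol huv.ne hut hvt (Or.inl h1) (Or.inr hβ) (Or.inl h2) hr
      (hr.trans hvr)
  · obtain ⟨c', h3, h4, h5, h6⟩ := exists_kempeSwap h (β := β) h2
    rw [← h6 v hvr] at hβ
    exact h3.disjoint_miss_two hdeg (((h4 _ _).2 hvw).symm h3.toIsPCol) ((h4 _ _).2 hwt) hvt hβ h5

theorem sum_card_le_five {ι : Type*} (s : Finset ι) (f : ι → Finset (Fin 5))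
    (h : ∀ i ∈ s, ∀ j ∈ s, i ≠ j → ∀ α, α ∈ f i → α ∈ f j → False) :
    ∑ i ∈ s, (f i).card ≤ 5 := by
  classical
  rw [← card_biUnion]
  · exact (card_le_univ _).trans (by simp)
  · intro i hi j hj hij
    rw [Function.onFun, disjoint_left]
    exact fun α h1 h2 => h i hi j hj hij α h1 h2

/-- No vertex is on three uncolored edges. -/
theorem MaxCol.no_star (h : MaxCol G c) {v a b d : V} (ha : Unc G c v a) (hb : Unc G c v b)
    (hd : Unc G c v d) (hab : a ≠ b) (had : a ≠ d) (hbd : b ≠ d) : False := by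
  have hc := h.toIsPCol
  have e1 := h.disjoint_miss_two hdeg ha hb hab
  have e2 := h.disjoint_miss_two hdeg ha hd had
  have e3 := h.disjoint_miss_two hdeg hb hd hbd
  have f1 := h.disjoint_miss ha
  have f2 := h.disjoint_miss hb
  have f3 := h.disjoint_miss hd
  have := sum_card_le_five hdeg {v, a, b, d} (miss c) (by
    simp only [mem_insert, mem_singleton]; grind)
  have n1 := ha.ne
  have n2 := hb.ne
  have n3 := hd.ne
  rw [sum_insert (by simp [*]), sum_insert (by simp [*]), sum_insert (by simp [*]),
    sum_singleton] at this
  have g1 := one_le_card_miss hdeg hc (ha.symm hc)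
  have g2 := one_le_card_miss hdeg hc (hb.symm hc)
  have g3 := one_le_card_miss hdeg hc (hd.symm hc)
  have g4 : 3 ≤ (miss c v).card := by
    have := card_le_card_miss hdeg hc (v := v) (S := {a, b, d}) (by
      intro x hx; simp at hx; rcases hx with rfl | rfl | rfl <;> assumption)
    rwa [card_insert_of_notMem (by simp [*]), card_pair hbd] at this
  omega

/-- There is no path or triangle formed by three uncolored edges. -/
theorem MaxCol.no_path (h : MaxCol G c) {u v w t : V} (huv : Unc G c u v)
    (hvw : Unc G c v w) (hwt : Unc G c w t) (huw : u ≠ w) (hvt : v ≠ t) : False := by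
  have hc := h.toIsPCol
  have f1 := h.disjoint_miss huv
  have f2 := h.disjoint_miss hvw
  have f3 := h.disjoint_miss hwt
  have n1 := huv.ne
  have n2 := hvw.ne
  have n3 := hwt.ne
  have g2 := two_le_card_miss hdeg hc (huv.symm hc) hvw huw
  have g3 := two_le_card_miss hdeg hc (hvw.symm hc) hwt hvt
  by_cases hut : u = t
  · subst hut
    have g1 := two_le_card_miss hdeg hc huv (hwt.symm hc) n2
    have := sum_card_le_five hdeg {u, v, w} (miss c) (by
      simp only [mem_insert, mem_singleton]; grind)
    rw [sum_insert (by simp [*]), sum_insert (by simp [*]), sum_singleton] at this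
    omega
  · have e1 := h.disjoint_miss_two hdeg (huv.symm hc) hvw huw
    have e2 := h.disjoint_miss_two hdeg (hvw.symm hc) hwt hvt
    have e3 := h.disjoint_miss_three hdeg huv hvw hwt hvt hut
    have g1 := one_le_card_miss hdeg hc huv
    have g4 := one_le_card_miss hdeg hc (hwt.symm hc)
    have := sum_card_le_five hdeg {u, v, w, t} (miss c) (by
      simp only [mem_insert, mem_singleton]; grind)
    rw [sum_insert (by simp [*]), sum_insert (by simp [*]), sum_insert (by simp [*]),
      sum_singleton] at this
    omega

end

section

variable {V : Type*} [Fintype V] [DecidableEq V] {G : SimpleGraph V} {c c' c₁ c₂ : PCol V}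

/-- `c'` is another coloring with as many colored edges as `c`; only edges meeting `D` are
recolored, and the edges leaving `D` are unchanged apart from those at `q`, which may lose
their color. -/
structure Var (G : SimpleGraph V) (c c' : PCol V) (D : Finset V) (q : V) : Prop where
  pcol : IsPCol G c'
  num_eq : num c' = num c
  loc : ∀ u ∉ D, ∀ v, c' u v = c u v ∨ (u = q ∧ c' u v = none)

theorem Var.maxCol {D : Finset V} {q : V} (h : Var G c c' D q) (hc : MaxCol G c) : MaxCol G c' :=
  hc.of_num h.pcol h.num_eq

theorem Var.refl (h : IsPCol G c) (D : Finset V) (q : V) : Var G c c D q :=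
  ⟨h, rfl, fun _ _ _ => Or.inl rfl⟩

theorem Var.eq_of_ne {D : Finset V} {q : V} (h : Var G c c' D q) {u : V} (hu : u ∉ D) (hq : u ≠ q)
    (v : V) : c' u v = c u v := (h.loc u hu v).resolve_right fun h' => hq h'.1

theorem Var.trans {D D' : Finset V} {q q' : V} (h : Var G c c' D q') (h' : Var G c' c₁ D' q)
    (hq : q' ∈ D') (hD : D ⊆ D') : Var G c c₁ D' q := by
  refine ⟨h'.pcol, h'.num_eq.trans h.num_eq, fun u hu v => ?_⟩
  rw [← h.eq_of_ne (fun hu' => hu (hD hu')) (by rintro rfl; exact hu hq) v]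
  exact h'.loc u hu v

theorem var_slide (h : IsPCol G c) {u v w : V} {α : Fin 5} (hu : Unc G c u v)
    (hα : α ∈ miss c u) (hw : c v w = some α) {D : Finset V} (huD : u ∈ D) (hvD : v ∈ D) :
    Var G c (slide c u v w α) D w := by
  refine ⟨isPCol_slide h hu hα hw, num_slide h hu hα hw, fun p hp q => ?_⟩
  simp only [slide_apply]
  grind

/-- Two recolorings with disjoint supports can be performed simultaneously. -/
def combine (c₁ c₂ : PCol V) (D : Finset V) : PCol V := fun u v =>
  if u ∈ D ∨ v ∈ D then c₁ u v else c₂ u v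

section Combine

variable {D₁ D₂ : Finset V} {q : V} (h₁ : Var G c c₁ D₁ q) (h₂ : Var G c c₂ D₂ q)
  (hD : Disjoint D₁ D₂) (hq : q ∉ D₁)
include h₁ h₂ hD hq

theorem combine_of_mem {u : V} (hu : u ∈ D₁) (v : V) :
    combine c₁ c₂ D₁ u v = c₁ u v := by
  simp [combine, hu]

theorem eq_of_mem_left (hc : IsPCol G c) {u v : V} (hu : u ∈ D₁) : c₂ v u = c v u := by
  rw [h₂.pcol.symm, hc.symm]
  exact h₂.eq_of_ne (disjoint_left.1 hD hu) (by rintro rfl; exact hq hu) v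

theorem combine_of_notMem (hc : IsPCol G c) {u : V} (hu : u ∉ D₁) (v : V) :
    combine c₁ c₂ D₁ u v = c₂ u v ∨ (u = q ∧ v ∈ D₁ ∧ combine c₁ c₂ D₁ u v = none) := by
  unfold combine
  by_cases hv : v ∈ D₁
  · have := eq_of_mem_left h₁ h₂ hD hq hc (v := u) hv
    have := h₁.loc u hu v
    grind
  · simp [hu, hv]

theorem var_combine (hc : IsPCol G c) : Var G c (combine c₁ c₂ D₁) (D₁ ∪ D₂) q := by
  have hs₁ := h₁.pcol.symm
  have hs₂ := h₂.pcol.symm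
  have hm := @combine_of_mem _ _ _ _ _ _ _ _ _ _ h₁ h₂ hD hq
  have hn := @combine_of_notMem _ _ _ _ _ _ _ _ _ _ h₁ h₂ hD hq hc
  refine ⟨⟨?_, ?_, ?_⟩, ?_, ?_⟩
  · intro u v; unfold combine; grind
  · intro u v α h
    by_cases hu : u ∈ D₁
    · rw [hm hu] at h; exact h₁.pcol.adj _ _ _ h
    · rcases hn hu v with h' | h'
      · rw [h'] at h; exact h₂.pcol.adj _ _ _ h
      · rw [h'.2.2] at h; cases h
  · intro v u w α h h'
    by_cases hv : v ∈ D₁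
    · rw [hm hv] at h h'; exact h₁.pcol.inj _ _ _ _ h h'
    · have := h₂.pcol.inj v u w α
      have := hn hv u
      have := hn hv w
      grind
  · have : num (combine c₁ c₂ D₁) + num c = num c₁ + num c₂ := by
      simp only [num, ← sum_add_distrib]
      refine sum_congr rfl fun p _ => ?_
      unfold combine
      by_cases hp : p.1 ∈ D₁ ∨ p.2 ∈ D₁
      · have : c₂ p.1 p.2 = c p.1 p.2 := by
          rcases hp with hp | hp
          · rw [hs₂, hc.symm]; exact eq_of_mem_left h₁ h₂ hD hq hc hp
          · exact eq_of_mem_left h₁ h₂ hD hq hc hp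
        rw [if_pos hp, this]
      · have : c₁ p.1 p.2 = c p.1 p.2 := by
          have i1 := h₁.pcol.irrefl
          have i2 := hc.irrefl
          have s2 := hc.symm
          have l1 := h₁.loc p.1 (by tauto) p.2
          have l2 := h₁.loc p.2 (by tauto) p.1
          grind
        rw [if_neg hp, this, add_comm]
    have := h₁.num_eq
    have := h₂.num_eq
    omega
  · intro u hu v
    rw [mem_union, not_or] at hu
    rcases hn hu.1 v with h | h
    · rw [h]; exact h₂.loc u hu.2 v
    · exact Or.inr ⟨h.1, h.2.2⟩

end Combine

end

section

variable {V : Type*} [Fintype V] [DecidableEq V] {G : SimpleGraph V} {c c' c₁ c₂ : PCol V}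

theorem Unc.combine_left {D₁ : Finset V} {u v : V} (hu : u ∈ D₁)
    (h : Unc G c₁ u v) : Unc G (combine c₁ c₂ D₁) u v :=
  ⟨h.1, by simpa [combine, hu] using h.2⟩

theorem Unc.combine_right {D₁ D₂ : Finset V} (hD : Disjoint D₁ D₂) {u v : V} (hv : v ∉ D₁) (hu : u ∈ D₂)
    (h : Unc G c₂ u v) : Unc G (combine c₁ c₂ D₁) u v :=
  ⟨h.1, by simpa [combine, hv, disjoint_right.1 hD hu] using h.2⟩

/-- Some recoloring inside `Q` makes an edge from `q` to `Q` uncolored. -/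
def ReachS (G : SimpleGraph V) (c : PCol V) (Q : Finset V) (q : V) : Prop :=
  ∃ c' r, Var G c c' Q q ∧ r ∈ Q ∧ Unc G c' q r

/-- Some recoloring inside `Q` makes an edge `qr` from `q` to `Q` uncolored, with a second
uncolored edge next to it. -/
def ReachP (G : SimpleGraph V) (c : PCol V) (Q : Finset V) (q : V) : Prop :=
  ∃ c' r, Var G c c' Q q ∧ r ∈ Q ∧ Unc G c' q r ∧
    ∃ t ∈ Q, (t ≠ r ∧ Unc G c' q t) ∨ (t ≠ q ∧ Unc G c' r t)

theorem ReachP.reachS {Q : Finset V} {q : V} (h : ReachP G c Q q) : ReachS G c Q q := by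
  obtain ⟨c', r, h1, h2, h3, -⟩ := h
  exact ⟨c', r, h1, h2, h3⟩

theorem ReachP.of_eq {Q : Finset V} {q : V} (h : ReachP G c' Q q) (hn : num c' = num c)
    (hl : ∀ u ∉ Q, ∀ v, c' u v = c u v) : ReachP G c Q q := by
  obtain ⟨c₁, r, h1, h2, h3, h4⟩ := h
  refine ⟨c₁, r, ⟨h1.pcol, h1.num_eq.trans hn, fun u hu v => ?_⟩, h2, h3, h4⟩
  rw [← hl u hu v]
  exact h1.loc u hu v

variable (hdeg : ∀ v, (G.neighborSet v).ncard ≤ 5)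
include hdeg

theorem MaxCol.false_of_unc_of_reachP (h : MaxCol G c) {D Q : Finset V} {q v : V}
    (h₁ : Var G c c₁ D q) (hq : q ∉ D) (hv : v ∈ D) (hu : Unc G c₁ q v)
    (hQ : ReachP G c Q q) (hD : Disjoint D Q) : False := by
  obtain ⟨c₂, r, h₂, hr, hur, t, ht, hlink⟩ := hQ
  have h3 := (var_combine h₁ h₂ hD hq h.toIsPCol).maxCol h
  have s1 : Unc G (combine c₁ c₂ D) v q := Unc.combine_left hv (hu.symm h₁.pcol)
  have s2 : Unc G (combine c₁ c₂ D) r q :=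
    Unc.combine_right hD hq hr (hur.symm h₂.pcol)
  have hvr : v ≠ r := by rintro rfl; exact disjoint_left.1 hD hv hr
  have hvt : v ≠ t := by rintro rfl; exact disjoint_left.1 hD hv ht
  have hs := h3.toIsPCol
  rcases hlink with ⟨htr, hl⟩ | ⟨htq, hl⟩
  · have s3 : Unc G (combine c₁ c₂ D) t q :=
      Unc.combine_right hD hq ht (hl.symm h₂.pcol)
    exact h3.no_star hdeg (s1.symm hs) (s2.symm hs) (s3.symm hs) hvr hvt htr.symm
  · have s3 : Unc G (combine c₁ c₂ D) r t :=
      Unc.combine_right hD (disjoint_right.1 hD ht) hr hl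
    exact h3.no_path hdeg s1 (s2.symm hs) s3 hvr htq.symm

theorem MaxCol.reachP_disjoint (h : MaxCol G c) {Q Q' : Finset V} {q : V}
    (hQ : ReachP G c Q q) (hQ' : ReachS G c Q' q) (hD : Disjoint Q Q') : False := by
  by_cases hq : q ∈ Q'
  · have hq' := disjoint_right.1 hD hq
    obtain ⟨c₁, r, h₁, hr, hur, t, ht, hlink⟩ := hQ
    obtain ⟨c₂, v, h₂, hv, hu⟩ := hQ'
    have h3 := (var_combine h₁ h₂ hD hq' h.toIsPCol).maxCol h
    have hs := h3.toIsPCol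
    have s1 : Unc G (combine c₁ c₂ Q) v q :=
      Unc.combine_right hD hq' hv (hu.symm h₂.pcol)
    have s2 : Unc G (combine c₁ c₂ Q) r q := Unc.combine_left hr (hur.symm h₁.pcol)
    have hvr : v ≠ r := by rintro rfl; exact disjoint_left.1 hD hr hv
    have hvt : v ≠ t := by rintro rfl; exact disjoint_left.1 hD ht hv
    rcases hlink with ⟨htr, hl⟩ | ⟨htq, hl⟩
    · have s3 : Unc G (combine c₁ c₂ Q) t q := Unc.combine_left ht (hl.symm h₁.pcol)
      exact h3.no_star hdeg (s1.symm hs) (s2.symm hs) (s3.symm hs) hvr hvt htr.symm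
    · have s3 : Unc G (combine c₁ c₂ Q) r t := Unc.combine_left hr hl
      exact h3.no_path hdeg s1 (s2.symm hs) s3 hvr htq.symm
  · obtain ⟨c₂, v, h₂, hv, hu⟩ := hQ'
    exact h.false_of_unc_of_reachP hdeg h₂ hq hv hu hQ hD.symm

/-- Colors excluded at the ends of an uncolored edge next to `q`, when another recoloring frees an
edge of color `γ` at `q`. -/
theorem MaxCol.notMem_miss_of_unc (h : MaxCol G c) {D Q : Finset V} {q v r : V} {a γ : Fin 5}
    (h₁ : Var G c c₁ D q) (hq : q ∉ D) (hv : v ∈ D) (hu : Unc G c₁ q v) (hγ : c v q = some γ)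
    (ha : a ∈ miss c₁ v) (h₂ : Var G c c₂ Q q) (hr : r ∈ Q) (hur : Unc G c₂ q r)
    (hD : Disjoint D Q) :
    a ∉ miss c₂ q ∧ a ∉ miss c₂ r ∧ γ ∉ miss c₂ q ∧ γ ∉ miss c₂ r := by
  have hc := h.toIsPCol
  have h3 := (var_combine h₁ h₂ hD hq hc).maxCol h
  have hs := h3.toIsPCol
  have s1 : Unc G (combine c₁ c₂ D) v q := Unc.combine_left hv (hu.symm h₁.pcol)
  have s2 : Unc G (combine c₁ c₂ D) r q :=
    Unc.combine_right hD hq hr (hur.symm h₂.pcol)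
  have hrD := disjoint_right.1 hD hr
  have hvr : v ≠ r := by rintro rfl; exact hrD hv
  have hm : ∀ {u}, u ∉ D → ∀ α ∈ miss c₂ u, α ∈ miss (combine c₁ c₂ D) u := by
    intro u hu α hα
    rw [mem_miss] at hα ⊢
    intro x hx
    have h1 := combine_of_notMem h₁ h₂ hD hq hc hu x
    have h2 := hα x
    grind
  have ha' : a ∈ miss (combine c₁ c₂ D) v := by
    rw [mem_miss] at ha ⊢
    intro x
    rw [combine_of_mem h₁ h₂ hD hq hv]
    exact ha x
  have hγ' : c₂ q v = some γ := by
    rw [h₂.pcol.symm, h₂.eq_of_ne (disjoint_left.1 hD hv) (by rintro rfl; exact hq hv), hγ]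
  have hγq : γ ∈ miss (combine c₁ c₂ D) q := by
    rw [mem_miss]
    intro x hx
    have h1 := combine_of_notMem h₁ h₂ hD hq hc hq x
    have h2 : c₂ q x = some γ := by grind
    have h4 := h₂.pcol.inj _ _ _ _ hγ' h2
    subst h4
    have h5 := (s1.symm hs).2
    rw [h5] at hx; cases hx
  refine ⟨fun hx => ?_, fun hx => ?_, fun hx => ?_, fun hx => ?_⟩
  · exact h3.disjoint_miss s1 ha' (hm hq _ hx)
  · exact h3.disjoint_miss_two hdeg (s1.symm hs) (s2.symm hs) hvr ha' (hm hrD _ hx)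
  · exact mem_miss.1 hx _ hγ'
  · exact h3.disjoint_miss s2 (hm hrD _ hx) hγq

end

section

variable {V : Type*} [Fintype V] [DecidableEq V] {G : SimpleGraph V} {c c' c₁ c₂ : PCol V}

/-- Two uncolored edges `yx` and `yz`. -/
structure IsPair (G : SimpleGraph V) (c : PCol V) (y x z : V) : Prop where
  left : Unc G c y x
  right : Unc G c y z
  ne : x ≠ z

theorem IsPair.swap {x y z : V} (h : IsPair G c y x z) : IsPair G c y z x :=
  ⟨h.right, h.left, h.ne.symm⟩

/-- Recolorings moving the uncolored edge `yx` to an edge `vq` outside, where `v` is `x` or the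
neighbor `w` of `y` along a color missing at `x`. -/
theorem IsPair.exists_move (hc : IsPCol G c) {x y z w v q : V} {a γ : Fin 5}
    (h : IsPair G c y x z) (ha : a ∈ miss c x) (hw : c y w = some a) (hv : v = x ∨ v = w)
    (hγ : γ ∈ miss c y) (hq : c v q = some γ) (hqx : q ≠ x) (hqw : q ≠ w) :
    ∃ c₁, Var G c c₁ {y, x, w} q ∧ Unc G c₁ q v ∧ Unc G c₁ y z ∧ a ∈ miss c₁ v ∧
      ∀ u, u ≠ x → u ≠ w → c₁ y u = c y u := by
  have hz := h.right
  have hxz := h.ne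
  have hyx := h.left.ne
  have hyz := h.right.ne
  have hs := hc.symm
  have hyw := (hc.adj _ _ _ hw).ne
  have hqy : q ≠ y := by
    rintro rfl
    rw [hs] at hq
    exact mem_miss.1 hγ _ hq
  have hwz : w ≠ z := by rintro rfl; rw [h.right.2] at hw; cases hw
  have hwx : w ≠ x := by rintro rfl; rw [h.left.2] at hw; cases hw
  rcases hv with rfl | rfl
  · have h2 := isPCol_slide hc h.left hγ hq
    refine ⟨slide c y v q γ, var_slide hc h.left hγ hq (by simp) (by simp), ?_, ?_, ?_, ?_⟩
    · refine ⟨(hc.adj _ _ _ hq).symm, ?_⟩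
      rw [slide_apply]; grind
    · refine ⟨hz.1, ?_⟩
      have := hz.2
      rw [slide_apply]; grind
    · rw [miss_slide hc h.left hγ hq]; grind
    · intro u hu1 hu2
      rw [slide_apply]; grind
  · have hu := h.left.symm hc
    have h1 := isPCol_slide hc hu ha hw
    have u1 : Unc G (slide c x y v a) y v := (unc_slide_iff hc hw _ _).2 (by grind)
    have hγ' : γ ∈ miss (slide c x y v a) y := by
      rw [miss_slide hc hu ha hw]; grind
    have hq' : slide c x y v a v q = some γ := by
      rw [slide_apply]; grind
    have v1 : Var G c (slide c x y v a) {y, x, v} v :=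
      var_slide hc hu ha hw (by simp) (by simp)
    have v2 : Var G (slide c x y v a) (slide (slide c x y v a) y v q γ) {y, x, v} q :=
      var_slide h1 u1 hγ' hq' (by simp) (by simp)
    refine ⟨slide (slide c x y v a) y v q γ, v1.trans v2 (by simp) subset_rfl, ?_, ?_, ?_, ?_⟩
    · refine ⟨(hc.adj _ _ _ hq).symm, ?_⟩
      rw [slide_apply]; grind
    · refine ⟨hz.1, ?_⟩
      have := hz.2
      rw [slide_apply, slide_apply]; grind
    · rw [miss_slide h1 u1 hγ' hq', if_neg hyw.symm, if_neg hqw.symm, miss_slide hc hu ha hw,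
        if_neg hwx, if_pos rfl]
      exact mem_insert_self _ _
    · intro u hu1 hu2
      rw [slide_apply, slide_apply]; grind

/-- The vertex `v` is on a pair of adjacent uncolored edges. -/
def OnPair (G : SimpleGraph V) (c : PCol V) (v : V) : Prop :=
  ∃ y x z, IsPair G c y x z ∧ (v = y ∨ v = x ∨ v = z)

/-- The vertex `y` is the center of a pair whose two leaves are joined by an edge of a color
missing at `y`. -/
def TriAt (G : SimpleGraph V) (c : PCol V) (y : V) : Prop :=
  ∃ x z γ, IsPair G c y x z ∧ γ ∈ miss c y ∧ c x z = some γ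

open Classical in
/-- The contribution of a vertex to the secondary objective. -/
noncomputable def wt (G : SimpleGraph V) (c : PCol V) (v : V) : ℕ :=
  (if OnPair G c v then 100 * (miss c v).card
    else if ∃ u, Unc G c v u then (miss c v).card else 0) + if TriAt G c v then 10 else 0

/-- A coloring maximizing first the number of colored edges, then the total weight. -/
structure Opt (G : SimpleGraph V) (c : PCol V) : Prop extends MaxCol G c where
  wt_le : ∀ c', MaxCol G c' → ∑ v, wt G c' v ≤ ∑ v, wt G c v

theorem wt_mono_of_eq (hc : IsPCol G c) {D : Finset V}
    (hD : ∀ u ∈ D, ∀ v, Unc G c u v → v ∈ D) (he : ∀ u ∉ D, ∀ v, c' u v = c u v)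
    {v : V} (hv : v ∉ D) : wt G c v ≤ wt G c' v := by
  have hout : ∀ {u w}, Unc G c u w → (u ∉ D ↔ w ∉ D) := fun {u w} h =>
    ⟨fun hu hw => hu (hD _ hw _ (h.symm hc)), fun hw hu => hw (hD _ hu _ h)⟩
  have htr : ∀ {u w}, u ∉ D → Unc G c u w → Unc G c' u w := fun {u w} hu h =>
    ⟨h.1, by rw [he u hu]; exact h.2⟩
  have htr' : ∀ {u w}, u ∉ D → Unc G c' u w → Unc G c u w := fun {u w} hu h =>
    ⟨h.1, by rw [← he u hu]; exact h.2⟩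
  have hpair : ∀ {y x z}, y ∉ D → IsPair G c y x z → IsPair G c' y x z := fun hy h =>
    ⟨htr hy h.left, htr hy h.right, h.ne⟩
  have hm : ∀ {u}, u ∉ D → miss c' u = miss c u := by
    intro u hu
    ext α
    simp [mem_miss, he u hu]
  have h1 : OnPair G c v → OnPair G c' v := by
    rintro ⟨y, x, z, h, h'⟩
    refine ⟨y, x, z, hpair ?_ h, h'⟩
    rcases h' with rfl | rfl | rfl
    · exact hv
    · exact (hout h.left).2 hv
    · exact (hout h.right).2 hv
  have h2 : TriAt G c v → TriAt G c' v := by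
    rintro ⟨x, z, γ, h, h', h''⟩
    refine ⟨x, z, γ, hpair hv h, by rwa [hm hv], ?_⟩
    rw [he _ ((hout h.left).1 hv)]
    exact h''
  have h3 : (∃ u, Unc G c v u) → ∃ u, Unc G c' v u := fun ⟨u, hu⟩ => ⟨u, htr hv hu⟩
  unfold wt
  rw [hm hv]
  split_ifs <;> first | omega | (exfalso; tauto)

/-- Recolorings inside a set closed under uncolored edges do not increase the weight of the set. -/
theorem Opt.sum_wt_le (h : Opt G c) (h' : MaxCol G c') {D : Finset V}
    (hD : ∀ u ∈ D, ∀ v, Unc G c u v → v ∈ D) (he : ∀ u ∉ D, ∀ v, c' u v = c u v) :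
    ∑ v ∈ D, wt G c' v ≤ ∑ v ∈ D, wt G c v := by
  have h1 := h.wt_le c' h'
  rw [← sum_add_sum_compl D, ← sum_add_sum_compl D (wt G c)] at h1
  have := sum_le_sum fun v (hv : v ∈ Dᶜ) =>
    wt_mono_of_eq h.toIsPCol hD he (mem_compl.1 hv)
  omega

theorem Opt.of_sum_wt_le (h : Opt G c) (h' : MaxCol G c') {D : Finset V}
    (hD : ∀ u ∈ D, ∀ v, Unc G c u v → v ∈ D) (he : ∀ u ∉ D, ∀ v, c' u v = c u v)
    (hle : ∑ v ∈ D, wt G c v ≤ ∑ v ∈ D, wt G c' v) : Opt G c' := by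
  refine ⟨h', fun d hd => (h.wt_le d hd).trans ?_⟩
  rw [← sum_add_sum_compl D, ← sum_add_sum_compl D (wt G c')]
  have := sum_le_sum fun v (hv : v ∈ Dᶜ) =>
    wt_mono_of_eq h.toIsPCol hD he (mem_compl.1 hv)
  omega

theorem exists_opt (G : SimpleGraph V) : ∃ c, Opt G c := by
  classical
  have h1 : ({c | IsPCol G c} : Set (PCol V)).Nonempty :=
    ⟨fun _ _ => none, fun _ _ => rfl, by simp, by simp⟩
  obtain ⟨c, hc, hmax⟩ := Set.exists_max_image _ num (Set.toFinite _) h1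
  have h2 : ({c | MaxCol G c} : Set (PCol V)).Nonempty := ⟨c, hc, hmax⟩
  obtain ⟨d, hd, hmax'⟩ := Set.exists_max_image _ (fun c => ∑ v, wt G c v) (Set.toFinite _) h2
  exact ⟨d, hd, hmax'⟩

theorem wt_of_onPair_le {v : V} (h : OnPair G c v) : 100 * (miss c v).card ≤ wt G c v := by
  unfold wt; rw [if_pos h]; omega

theorem card_miss_le_wt {v u : V} (h : Unc G c v u) : (miss c v).card ≤ wt G c v := by
  have : ∃ u, Unc G c v u := ⟨u, h⟩
  unfold wt; split_ifs <;> omega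

theorem wt_eq_zero {v : V} (hc : IsPCol G c) (h : ∀ u, ¬ Unc G c v u) : wt G c v = 0 := by
  have h1 : ¬ OnPair G c v := by
    rintro ⟨y, x, z, h', rfl | rfl | rfl⟩
    · exact h _ h'.left
    · exact h _ (h'.left.symm hc)
    · exact h _ (h'.right.symm hc)
  have h2 : ¬ TriAt G c v := fun ⟨x, z, γ, h', _⟩ => h _ h'.left
  unfold wt
  simp [h1, h2, h]

end

section

variable {V : Type*} [Fintype V] [DecidableEq V] {G : SimpleGraph V} {c c' c₁ c₂ : PCol V}

/-- An uncolored edge `xy` not adjacent to any other uncolored edge. -/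
structure IsSing (G : SimpleGraph V) (c : PCol V) (x y : V) : Prop where
  unc : Unc G c x y
  left : ∀ u, Unc G c x u → u = y
  right : ∀ u, Unc G c y u → u = x

theorem IsSing.swap {x y : V} (hc : IsPCol G c) (h : IsSing G c x y) : IsSing G c y x :=
  ⟨h.unc.symm hc, h.right, h.left⟩

theorem IsSing.not_onPair {x y : V} (hc : IsPCol G c) (h : IsSing G c x y) : ¬ OnPair G c x := by
  rintro ⟨v, a, b, h', rfl | rfl | rfl⟩
  · exact h'.ne ((h.left _ h'.left).trans (h.left _ h'.right).symm)
  · have := h.left _ (h'.left.symm hc)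
    subst this
    exact h'.ne (h.right _ h'.right).symm
  · have := h.left _ (h'.right.symm hc)
    subst this
    exact h'.ne (h.right _ h'.left)

theorem IsSing.wt_le {x y : V} (hc : IsPCol G c) (h : IsSing G c x y) :
    wt G c x ≤ (miss c x).card := by
  have h1 := h.not_onPair hc
  have h2 : ¬ TriAt G c x := fun ⟨a, b, γ, h', _⟩ => h1 ⟨x, a, b, h', Or.inl rfl⟩
  unfold wt
  rw [if_neg h1, if_neg h2]
  split_ifs <;> omega

theorem Opt.sing_weight_le (h : Opt G c) {x y w x' y' : V} (hs : IsSing G c x y)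
    (hw : ∀ u, ¬ Unc G c w u) (h' : MaxCol G c')
    (he : ∀ u ∉ ({x, y, w} : Finset V), ∀ v, c' u v = c u v) (hu : Unc G c' x' y')
    (hx : x' ∈ ({x, y, w} : Finset V)) (hy : y' ∈ ({x, y, w} : Finset V)) :
    (miss c' x').card + (miss c' y').card ≤ (miss c x).card + (miss c y).card := by
  have hc := h.toIsPCol
  have h1 := h.sum_wt_le h' (D := {x, y, w}) (by
    intro u hu v huv
    simp only [mem_insert, mem_singleton] at hu ⊢
    rcases hu with rfl | rfl | rfl
    · exact Or.inr (Or.inl (hs.left _ huv))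
    · exact Or.inl (hs.right _ huv)
    · exact absurd huv (hw _)) he
  have h2 : ∑ v ∈ {x, y, w}, wt G c v ≤ (miss c x).card + (miss c y).card := by
    have hxw : x ≠ w := by rintro rfl; exact hw _ hs.unc
    have hyw : y ≠ w := by rintro rfl; exact hw _ (hs.unc.symm hc)
    rw [sum_insert (by simp [hs.unc.ne, hxw]), sum_pair hyw, wt_eq_zero hc hw]
    have := hs.wt_le hc
    have := (hs.swap hc).wt_le hc
    omega
  have h3 : ∑ v ∈ ({x', y'} : Finset V), wt G c' v ≤ ∑ v ∈ {x, y, w}, wt G c' v :=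
    sum_le_sum_of_subset (by simp [insert_subset_iff, hx, hy] )
  rw [sum_pair hu.ne] at h3
  have := card_miss_le_wt hu
  have := card_miss_le_wt (hu.symm h'.toIsPCol)
  omega

variable (hdeg : ∀ v, (G.neighborSet v).ncard ≤ 5)
include hdeg

theorem MaxCol.eq_or_eq_of_unc_center (h : MaxCol G c) {y x z u : V} (hp : IsPair G c y x z)
    (hu : Unc G c y u) : u = x ∨ u = z := by
  by_contra! hne
  exact h.no_star hdeg hu hp.left hp.right hne.1 hne.2 hp.ne

theorem MaxCol.eq_of_unc_leaf (h : MaxCol G c) {y x z u : V} (hp : IsPair G c y x z)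
    (hu : Unc G c x u) : u = y := by
  by_contra hne
  exact h.no_path hdeg (hu.symm h.toIsPCol) (hp.left.symm h.toIsPCol) hp.right hne hp.ne

theorem Opt.pair_weight (h : Opt G c) {y x z w y' x' z' : V} (hp : IsPair G c y x z)
    (hw : ∀ u, ¬ Unc G c w u) (h' : MaxCol G c')
    (he : ∀ u ∉ ({y, x, z, w} : Finset V), ∀ v, c' u v = c u v) (hp' : IsPair G c' y' x' z')
    (hy : y' ∈ ({y, x, z, w} : Finset V)) (hx : x' ∈ ({y, x, z, w} : Finset V))
    (hz : z' ∈ ({y, x, z, w} : Finset V)) :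
    (miss c' y').card + (miss c' x').card + (miss c' z').card
      ≤ (miss c y).card + (miss c x).card + (miss c z).card ∧
    ((miss c y).card + (miss c x).card + (miss c z).card
      ≤ (miss c' y').card + (miss c' x').card + (miss c' z').card →
      (TriAt G c' y' → TriAt G c y) ∧ ((TriAt G c y → TriAt G c' y') → Opt G c')) := by
  classical
  have hc := h.toIsPCol
  have hc' := h'.toIsPCol
  have hcl : ∀ u ∈ ({y, x, z, w} : Finset V), ∀ v, Unc G c u v →
      v ∈ ({y, x, z, w} : Finset V) := by
    intro u hu v huv
    simp only [mem_insert, mem_singleton] at hu ⊢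
    rcases hu with rfl | rfl | rfl | rfl
    · have := h.eq_or_eq_of_unc_center hdeg hp huv; tauto
    · have := h.eq_of_unc_leaf hdeg hp huv; tauto
    · have := h.eq_of_unc_leaf hdeg hp.swap huv; tauto
    · exact absurd huv (hw _)
  have h1 := h.sum_wt_le h' hcl he
  have h2 : ∑ v ∈ {y, x, z, w}, wt G c v =
      100 * ((miss c y).card + (miss c x).card + (miss c z).card) +
        if TriAt G c y then 10 else 0 := by
    have hyw : y ≠ w := by rintro rfl; exact hw _ hp.left
    have hxw : x ≠ w := by rintro rfl; exact hw _ (hp.left.symm hc)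
    have hzw : z ≠ w := by rintro rfl; exact hw _ (hp.right.symm hc)
    rw [sum_insert (by simp [hp.left.ne, hp.right.ne, hyw]), sum_insert (by simp [hp.ne, hxw]),
      sum_pair hzw, wt_eq_zero hc hw]
    have tx : ∀ {a b}, IsPair G c y a b → ¬ TriAt G c a := by
      rintro a b hab ⟨s, t, γ, hst, -⟩
      exact hst.ne ((h.eq_of_unc_leaf hdeg hab hst.left).trans
        (h.eq_of_unc_leaf hdeg hab hst.right).symm)
    have ex : wt G c x = 100 * (miss c x).card := by
      unfold wt; rw [if_pos ⟨y, x, z, hp, by tauto⟩, if_neg (tx hp), add_zero]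
    have ez : wt G c z = 100 * (miss c z).card := by
      unfold wt; rw [if_pos ⟨y, x, z, hp, by tauto⟩, if_neg (tx hp.swap), add_zero]
    have ey : wt G c y = 100 * (miss c y).card + if TriAt G c y then 10 else 0 := by
      unfold wt; rw [if_pos ⟨y, x, z, hp, by tauto⟩]
    rw [ex, ez, ey]
    ring
  have h3 : 100 * ((miss c' y').card + (miss c' x').card + (miss c' z').card) +
      (if TriAt G c' y' then 10 else 0) ≤ ∑ v ∈ {y, x, z, w}, wt G c' v := by
    have hsub : ({y', x', z'} : Finset V) ⊆ {y, x, z, w} := by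
      intro u hu
      rw [mem_insert, mem_insert, mem_singleton] at hu
      rcases hu with rfl | rfl | rfl <;> assumption
    refine le_trans ?_ (sum_le_sum_of_subset hsub)
    rw [sum_insert (by simp [hp'.left.ne, hp'.right.ne]), sum_pair hp'.ne]
    have ex := wt_of_onPair_le (G := G) (c := c') (v := x') ⟨y', x', z', hp', by tauto⟩
    have ez := wt_of_onPair_le (G := G) (c := c') (v := z') ⟨y', x', z', hp', by tauto⟩
    have ey : wt G c' y' = 100 * (miss c' y').card + if TriAt G c' y' then 10 else 0 := by
      unfold wt; rw [if_pos ⟨y', x', z', hp', by tauto⟩]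
    omega
  refine ⟨?_, fun hle => ⟨fun ht => ?_, fun ht => ?_⟩⟩
  · split_ifs at h2 h3 <;> omega
  · by_contra ht'
    rw [if_neg ht'] at h2
    rw [if_pos ht] at h3
    omega
  · refine h.of_sum_wt_le h' hcl he ?_
    rw [h2]
    refine le_trans ?_ h3
    by_cases hT : TriAt G c y
    · rw [if_pos hT, if_pos (ht hT)]; omega
    · rw [if_neg hT]; omega

/-- Two isolated uncolored edges cannot be brought together. -/
theorem Opt.sing_disjoint (h : Opt G c) {x y x' y' q : V} (hs : IsSing G c x y)
    (hs' : IsSing G c x' y') (hD : Disjoint ({x, y} : Finset V) {x', y'})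
    (hq : ReachS G c {x, y} q) (hq' : ReachS G c {x', y'} q) : False := by
  have hc := h.toIsPCol
  wlog hn : q ∉ ({x, y} : Finset V) generalizing x y x' y' with H
  · exact H hs' hs hD.symm hq' hq (disjoint_left.1 hD (not_not.1 hn))
  obtain ⟨c₁, r, h₁, hr, hur⟩ := hq
  obtain ⟨c₂, r', h₂, hr', hur'⟩ := hq'
  have hv := var_combine h₁ h₂ hD hn hc
  have h3 := hv.maxCol h.toMaxCol
  have hs3 := h3.toIsPCol
  have s1 : Unc G (combine c₁ c₂ {x, y}) r q := Unc.combine_left hr (hur.symm h₁.pcol)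
  have s2 : Unc G (combine c₁ c₂ {x, y}) r' q := Unc.combine_right hD hn hr' (hur'.symm h₂.pcol)
  have hrr : r ≠ r' := by rintro rfl; exact disjoint_left.1 hD hr hr'
  generalize combine c₁ c₂ {x, y} = c₃ at *
  set D₀ : Finset V := {x, y} ∪ {x', y'} with hD₀
  have hcl₀ : ∀ u ∈ D₀, ∀ v, Unc G c u v → v ∈ D₀ := by
    intro u hu v huv
    simp only [hD₀, mem_union, mem_insert, mem_singleton] at hu ⊢
    rcases hu with (rfl | rfl) | (rfl | rfl)
    · exact Or.inl (Or.inr (hs.left _ huv))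
    · exact Or.inl (Or.inl (hs.right _ huv))
    · exact Or.inr (Or.inr (hs'.left _ huv))
    · exact Or.inr (Or.inl (hs'.right _ huv))
  have hqu : q ∉ D₀ → ∀ u, ¬ Unc G c q u := by
    intro hq u hu
    have huD : u ∉ D₀ := fun hu' => hq (hcl₀ u hu' q (hu.symm hc))
    have hu3 : Unc G c₃ q u := by
      refine ⟨hu.1, ?_⟩
      rcases hv.loc q hq u with h' | h'
      · rw [h']; exact hu.2
      · exact h'.2
    refine h3.no_star hdeg hu3 (s1.symm hs3) (s2.symm hs3) ?_ ?_ hrr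
    · rintro rfl; exact huD (mem_union_left _ hr)
    · rintro rfl; exact huD (mem_union_right _ hr')
  have hcl : ∀ u ∈ insert q D₀, ∀ v, Unc G c u v → v ∈ insert q D₀ := by
    intro u hu v huv
    by_cases huD : u ∈ D₀
    · exact mem_insert_of_mem (hcl₀ u huD v huv)
    · have : u = q := (mem_insert.1 hu).resolve_right huD
      subst this
      exact absurd huv (hqu huD _)
  have h5 := h.sum_wt_le h3 hcl (by
    intro u hu v
    rw [mem_insert, not_or] at hu
    exact hv.eq_of_ne hu.2 hu.1 v)
  have h6 : 200 ≤ ∑ v ∈ insert q D₀, wt G c₃ v := by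
    refine le_trans ?_ (single_le_sum (fun _ _ => Nat.zero_le _) (mem_insert_self q D₀))
    have := wt_of_onPair_le (G := G) (c := c₃) (v := q)
      ⟨q, r, r', ⟨s1.symm hs3, s2.symm hs3, hrr⟩, by tauto⟩
    have := two_le_card_miss hdeg hs3 (s1.symm hs3) (s2.symm hs3) hrr
    omega
  have h7 : ∑ v ∈ insert q D₀, wt G c v = ∑ v ∈ D₀, wt G c v := by
    by_cases hq : q ∈ D₀
    · rw [insert_eq_of_mem hq]
    · rw [sum_insert hq, wt_eq_zero hc (hqu hq), zero_add]
  have h8 : ∑ v ∈ D₀, wt G c v ≤ 20 := by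
    rw [hD₀, sum_union hD, sum_pair hs.unc.ne, sum_pair hs'.unc.ne]
    have := hs.wt_le hc
    have := (hs.swap hc).wt_le hc
    have := hs'.wt_le hc
    have := (hs'.swap hc).wt_le hc
    have hb : ∀ v, (miss c v).card ≤ 5 := fun v => (card_le_univ _).trans (by simp)
    have := hb x
    have := hb y
    have := hb x'
    have := hb y'
    omega
  omega

end

section

variable {V : Type*} [Fintype V] [DecidableEq V] {G : SimpleGraph V} {c c' c₁ c₂ : PCol V}

theorem Unc.reachS_left (hc : IsPCol G c) {Q : Finset V} {u v : V} (h : Unc G c u v)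
    (hv : v ∈ Q) : ReachS G c Q u :=
  ⟨c, v, Var.refl hc _ _, hv, h⟩

theorem IsPair.reachP_of_mem (hc : IsPCol G c) {y x z q : V} (h : IsPair G c y x z)
    (hq : q ∈ ({y, x, z} : Finset V)) : ReachP G c {y, x, z} q := by
  have hl : ∀ {x z}, IsPair G c y x z → ∀ {Q : Finset V}, y ∈ Q → z ∈ Q → ReachP G c Q x :=
    fun h' Q hyQ hzQ => ⟨c, y, Var.refl hc _ _, hyQ, h'.left.symm hc, _, hzQ,
      Or.inr ⟨h'.ne.symm, h'.right⟩⟩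
  simp only [mem_insert, mem_singleton] at hq
  rcases hq with rfl | rfl | rfl
  · exact ⟨c, x, Var.refl hc _ _, by simp, h.left, z, by simp, Or.inl ⟨h.ne.symm, h.right⟩⟩
  · exact hl h (by simp) (by simp)
  · exact hl h.swap (by simp) (by simp)

theorem IsSing.mem_of_unc {x y u v : V} (h : IsSing G c x y) (hu : u ∈ ({x, y} : Finset V))
    (huv : Unc G c u v) : v ∈ ({x, y} : Finset V) := by
  simp only [mem_insert, mem_singleton] at hu ⊢
  rcases hu with rfl | rfl
  · exact Or.inr (h.left _ huv)
  · exact Or.inl (h.right _ huv)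

/-- An uncolored edge is isolated or on a pair. -/
theorem Unc.isPair_or_isSing (hc : IsPCol G c) {u v : V} (h : Unc G c u v) :
    (∃ y x z, IsPair G c y x z ∧ u ∈ ({y, x, z} : Finset V) ∧ v ∈ ({y, x, z} : Finset V)) ∨
      IsSing G c u v := by
  by_cases h1 : ∃ t, t ≠ v ∧ Unc G c u t
  · obtain ⟨t, ht, hu⟩ := h1
    exact Or.inl ⟨u, v, t, ⟨h, hu, ht.symm⟩, by simp, by simp⟩
  by_cases h2 : ∃ t, t ≠ u ∧ Unc G c v t
  · obtain ⟨t, ht, hu⟩ := h2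
    exact Or.inl ⟨v, u, t, ⟨h.symm hc, hu, ht.symm⟩, by simp, by simp⟩
  refine Or.inr ⟨h, fun t ht => ?_, fun t ht => ?_⟩
  · by_contra hne; exact h1 ⟨t, hne, ht⟩
  · by_contra hne; exact h2 ⟨t, hne, ht⟩

theorem slide_eq_of_notMem {D : Finset V} {u v w p : V} {α : Fin 5} (hu : u ∈ D) (hv : v ∈ D)
    (hw : w ∈ D) (hp : p ∉ D) (q : V) : slide c u v w α p q = c p q := by
  have h1 : p ≠ u := by rintro rfl; exact hp hu
  have h2 : p ≠ v := by rintro rfl; exact hp hv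
  have h3 : p ≠ w := by rintro rfl; exact hp hw
  rw [slide_apply]; grind

variable (hdeg : ∀ v, (G.neighborSet v).ncard ≤ 5)
include hdeg

theorem MaxCol.mem_of_unc_pair (h : MaxCol G c) {y x z u v : V} (hp : IsPair G c y x z)
    (hu : u ∈ ({y, x, z} : Finset V)) (huv : Unc G c u v) : v ∈ ({y, x, z} : Finset V) := by
  simp only [mem_insert, mem_singleton] at hu ⊢
  rcases hu with rfl | rfl | rfl
  · have := h.eq_or_eq_of_unc_center hdeg hp huv; tauto
  · have := h.eq_of_unc_leaf hdeg hp huv; tauto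
  · have := h.eq_of_unc_leaf hdeg hp.swap huv; tauto

theorem MaxCol.not_unc_of_reachP (h : MaxCol G c) {y x z w : V} (hp : IsPair G c y x z)
    (hw : w ∉ ({y, x, z} : Finset V)) (hr : ReachP G c {y, x, z} w) (u : V) :
    ¬ Unc G c w u := by
  intro hu
  have hc := h.toIsPCol
  have hu' : u ∉ ({y, x, z} : Finset V) := fun hu' =>
    hw (h.mem_of_unc_pair hdeg hp hu' (hu.symm hc))
  refine h.reachP_disjoint hdeg hr (Q' := {w, u}) (hu.reachS_left hc (by simp)) ?_
  rw [disjoint_comm, disjoint_insert_left, disjoint_singleton_left]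
  exact ⟨hw, hu'⟩

theorem Opt.not_unc_of_reachS (h : Opt G c) {x y w : V} (hs : IsSing G c x y)
    (hw : w ∉ ({x, y} : Finset V)) (hr : ReachS G c {x, y} w) (u : V) : ¬ Unc G c w u := by
  intro hu
  have hc := h.toIsPCol
  have key : ∀ {Q : Finset V}, w ∈ Q → (∀ p ∈ Q, ∀ q, Unc G c p q → q ∈ Q) →
      (∀ p ∈ Q, p = w ∨ Unc G c w p ∨ ∃ t, Unc G c w t ∧ Unc G c t p) → Disjoint Q {x, y} := by
    intro Q hwQ _ hcon
    rw [disjoint_left]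
    intro p hp hp'
    rcases hcon p hp with rfl | h1 | ⟨t, h1, h2⟩
    · exact hw hp'
    · exact hw (hs.mem_of_unc hp' (h1.symm hc))
    · exact hw (hs.mem_of_unc (hs.mem_of_unc hp' (h2.symm hc)) (h1.symm hc))
  rcases hu.isPair_or_isSing hc with ⟨y', x', z', hp, hwQ, -⟩ | hs'
  · refine h.reachP_disjoint hdeg (hp.reachP_of_mem hc hwQ) hr
      (key hwQ (fun p hp' q => h.mem_of_unc_pair hdeg hp hp') fun p hp' => ?_)
    have a1 := hp.left
    have a2 := hp.right
    have a3 := a1.symm hc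
    have a4 := a2.symm hc
    simp only [mem_insert, mem_singleton] at hp' hwQ
    rcases hwQ with rfl | rfl | rfl <;> rcases hp' with rfl | rfl | rfl <;> grind
  · exact h.sing_disjoint hdeg hs' hs (by
      rw [disjoint_insert_left, disjoint_singleton_left]
      exact ⟨hw, fun hu' => hw (hs.mem_of_unc hu' (hu.symm hc))⟩)
      (hu.reachS_left hc (by simp)) hr

theorem Opt.pair_fan (h : Opt G c) {y x z w : V} {a : Fin 5} (hp : IsPair G c y x z)
    (ha : a ∈ miss c x) (hw : c y w = some a) :
    w ∉ ({y, x, z} : Finset V) ∧ (∀ u, ¬ Unc G c w u) ∧ ReachP G c {y, x, z} w ∧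
      (miss c w).card + 1 ≤ (miss c x).card ∧
      ((miss c w).card + 1 = (miss c x).card →
        (TriAt G (slide c x y w a) y → TriAt G c y) ∧
          (¬ TriAt G c y → Opt G (slide c x y w a))) := by
  have hc := h.toIsPCol
  have hu := hp.left.symm hc
  have hwy : w ≠ y := by rintro rfl; rw [hc.irrefl] at hw; cases hw
  have hwx : w ≠ x := by rintro rfl; rw [hp.left.2] at hw; cases hw
  have hwz : w ≠ z := by rintro rfl; rw [hp.right.2] at hw; cases hw
  have hxy := hu.ne
  have hyz := hp.right.ne
  have hxz := hp.ne
  have hwQ : w ∉ ({y, x, z} : Finset V) := by simp [hwy, hwx, hwz]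
  have h' := h.toMaxCol.slide hu ha hw
  have hp' : IsPair G (slide c x y w a) y w z := by
    refine ⟨((unc_slide_iff hc hw _ _).2 (by grind)), (unc_slide_iff hc hw _ _).2 ?_, hwz⟩
    have := hp.right
    grind
  have hr : ReachP G c {y, x, z} w :=
    ⟨slide c x y w a, y, var_slide hc hu ha hw (by simp) (by simp), by simp,
      hp'.left.symm h'.toIsPCol, z, by simp, Or.inr ⟨hwz.symm, hp'.right⟩⟩
  have hn := h.not_unc_of_reachP hdeg hp hwQ hr
  have hm := miss_slide hc hu ha hw
  have haw : a ∉ miss c w := fun h1 => mem_miss.1 h1 y (by rw [hc.symm]; exact hw)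
  have e1 : (miss (slide c x y w a) w).card = (miss c w).card + 1 := by
    rw [hm, if_neg hwx, if_pos rfl, card_insert_of_notMem haw]
  have e2 : miss (slide c x y w a) y = miss c y := by
    rw [hm, if_neg hxy.symm, if_neg hwy.symm]
  have e3 : miss (slide c x y w a) z = miss c z := by
    rw [hm, if_neg hxz.symm, if_neg hwz.symm]
  have he : ∀ u ∉ ({y, x, z, w} : Finset V), ∀ v, slide c x y w a u v = c u v := fun u hu v =>
    slide_eq_of_notMem (by simp) (by simp) (by simp) hu v
  obtain ⟨k1, k2⟩ := h.pair_weight hdeg hp hn h' he hp' (by simp) (by simp) (by simp)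
  rw [e1, e2, e3] at k1 k2
  refine ⟨hwQ, hn, hr, by omega, fun heq => ?_⟩
  obtain ⟨k3, k4⟩ := k2 (by omega)
  exact ⟨k3, fun hT => k4 fun h1 => absurd h1 hT⟩

/-- Rotating a pair inside a triangle. -/
theorem Opt.tri_shift (h : Opt G c) {y x z : V} {γ : Fin 5} (hp : IsPair G c y x z)
    (hγ : γ ∈ miss c y) (hz : c x z = some γ) :
    Opt G (slide c y x z γ) ∧ IsPair G (slide c y x z γ) z y x ∧ TriAt G (slide c y x z γ) z ∧
      miss (slide c y x z γ) y = (miss c y).erase γ ∧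
      miss (slide c y x z γ) z = insert γ (miss c z) ∧
      miss (slide c y x z γ) x = miss c x := by
  have hc := h.toIsPCol
  have hxy := hp.left.ne
  have hyz := hp.right.ne
  have hxz := hp.ne
  have hu := hp.left
  have h' := h.toMaxCol.slide hu hγ hz
  have hm := miss_slide hc hu hγ hz
  have hp' : IsPair G (slide c y x z γ) z y x := by
    refine ⟨(unc_slide_iff hc hz _ _).2 ?_, (unc_slide_iff hc hz _ _).2 ?_, hxy⟩
    · have := hp.right.symm hc
      grind
    · grind
  have e1 : miss (slide c y x z γ) y = (miss c y).erase γ := by rw [hm, if_pos rfl]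
  have e2 : miss (slide c y x z γ) z = insert γ (miss c z) := by
    rw [hm, if_neg hyz.symm, if_pos rfl]
  have e3 : miss (slide c y x z γ) x = miss c x := by rw [hm, if_neg hxy.symm, if_neg hxz]
  have hT : TriAt G (slide c y x z γ) z := by
    refine ⟨y, x, γ, hp', by rw [e2]; simp, ?_⟩
    rw [slide_apply]; grind
  have hγz : γ ∉ miss c z := fun h1 => mem_miss.1 h1 x (by rw [hc.symm]; exact hz)
  obtain ⟨a, ha⟩ := miss_nonempty hdeg hc (hp.left.symm hc)
  obtain ⟨w, hw⟩ := not_mem_miss.1 fun h1 => h.disjoint_miss hp.left h1 ha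
  have hn := (h.pair_fan hdeg hp ha hw).2.1
  obtain ⟨-, k⟩ := h.pair_weight hdeg hp hn h'
    (fun u hu v => slide_eq_of_notMem (by simp) (by simp) (by simp) hu v) hp'
    (by simp) (by simp) (by simp)
  have k1 := card_erase_add_one hγ
  have k2 := card_insert_of_notMem hγz
  rw [e1, e2, e3] at k
  exact ⟨(k (by omega)).2 fun _ => hT, hp', hT, e1, e2, e3⟩

theorem Opt.sing_fan (h : Opt G c) {x y w : V} {b : Fin 5} (hs : IsSing G c x y)
    (hb : b ∈ miss c y) (hw : c x w = some b) :
    w ∉ ({x, y} : Finset V) ∧ (∀ u, ¬ Unc G c w u) ∧ ReachS G c {x, y} w ∧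
      Var G c (slide c y x w b) {x, y} w ∧ Unc G (slide c y x w b) x w ∧
      (miss c w).card + 1 ≤ (miss c y).card ∧
      miss (slide c y x w b) w = insert b (miss c w) ∧
      miss (slide c y x w b) x = miss c x := by
  have hc := h.toIsPCol
  have hu := hs.unc.symm hc
  have hwx : w ≠ x := by rintro rfl; rw [hc.irrefl] at hw; cases hw
  have hwy : w ≠ y := by rintro rfl; rw [hs.unc.2] at hw; cases hw
  have hxy := hs.unc.ne
  have hwQ : w ∉ ({x, y} : Finset V) := by simp [hwy, hwx]
  have h' := h.toMaxCol.slide hu hb hw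
  have hv : Var G c (slide c y x w b) {x, y} w := var_slide hc hu hb hw (by simp) (by simp)
  have hu' : Unc G (slide c y x w b) x w := (unc_slide_iff hc hw _ _).2 (by grind)
  have hr : ReachS G c {x, y} w := ⟨_, x, hv, by simp, hu'.symm h'.toIsPCol⟩
  have hn := h.not_unc_of_reachS hdeg hs hwQ hr
  have hm := miss_slide hc hu hb hw
  have hbw : b ∉ miss c w := fun h1 => mem_miss.1 h1 x (by rw [hc.symm]; exact hw)
  have e1 : miss (slide c y x w b) w = insert b (miss c w) := by
    rw [hm, if_neg hwy, if_pos rfl]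
  have e2 : miss (slide c y x w b) x = miss c x := by
    rw [hm, if_neg hxy, if_neg hwx.symm]
  have k := h.sing_weight_le hs hn h' (fun u hu v =>
    slide_eq_of_notMem (by simp) (by simp) (by simp) hu v) hu' (by simp) (by simp)
  rw [e1, e2, card_insert_of_notMem hbw] at k
  exact ⟨hwQ, hn, hr, hv, hu', by omega, e1, e2⟩

end

section

variable {V : Type*} [Fintype V] [DecidableEq V] {G : SimpleGraph V} {c c' c₁ c₂ : PCol V}

theorem Var.mono {D D' : Finset V} {q : V} (h : Var G c c' D q) (hD : D ⊆ D') :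
    Var G c c' D' q :=
  ⟨h.pcol, h.num_eq, fun u hu v => h.loc u (fun h' => hu (hD h')) v⟩

/-- The set `m` consists of the colors missing at an end of an uncolored edge from `q` to `Q`
produced by some recoloring inside `Q`. -/
def Guard (G : SimpleGraph V) (c : PCol V) (Q : Finset V) (q : V) (m : Finset (Fin 5)) : Prop :=
  ∃ c' r, Var G c c' Q q ∧ r ∈ Q ∧ Unc G c' q r ∧ m = miss c' q ∪ miss c' r

theorem Guard.reachS {Q : Finset V} {q : V} {m : Finset (Fin 5)} (h : Guard G c Q q m) :
    ReachS G c Q q := by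
  obtain ⟨c', r, h1, h2, h3, -⟩ := h
  exact ⟨c', r, h1, h2, h3⟩

/-- The configuration around an uncolored pair `yx`, `yz` that sends weight out. -/
structure Source (G : SimpleGraph V) (c : PCol V) (y x z w w' : V) (a b : Fin 5) : Prop where
  pair : IsPair G c y x z
  miss_x : miss c x = {a}
  miss_z : miss c z = {b}
  yw : c y w = some a
  yw' : c y w' = some b
  miss_w : miss c w = ∅
  miss_w' : miss c w' = ∅
  xz : ∀ α ∈ miss c y, c x z ≠ some α
  xw' : ∀ α ∈ miss c y, c x w' ≠ some α
  zw : ∀ α ∈ miss c y, c z w ≠ some α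
  ww' : ∀ α ∈ miss c y, c w w' ≠ some α

theorem Source.swap (hc : IsPCol G c) {y x z w w' : V} {a b : Fin 5}
    (h : Source G c y x z w w' a b) : Source G c y z x w' w b a :=
  ⟨h.pair.swap, h.miss_z, h.miss_x, h.yw', h.yw, h.miss_w', h.miss_w,
    fun α hα => by rw [hc.symm]; exact h.xz α hα, h.zw, h.xw',
    fun α hα => by rw [hc.symm]; exact h.ww' α hα⟩

/-- Every `K₅` in `G` has a vertex without neighbors outside. -/
def CliqueClosed (G : SimpleGraph V) : Prop :=
  ∀ S : Finset V, S.card = 5 → (∀ u ∈ S, ∀ v ∈ S, u ≠ v → G.Adj u v) →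
    ∃ v ∈ S, ∀ o, G.Adj v o → o ∈ S

/-- A cluster of five vertices with two edges to vertices unreachable from elsewhere. -/
def Tight (G : SimpleGraph V) (c : PCol V) (Q K : Finset V) : Prop :=
  K.card = 5 ∧ ∑ v ∈ K, (miss c v).card ≤ 4 ∧ ∃ v₁ ∈ K, ∃ v₂ ∈ K, v₁ ≠ v₂ ∧ ∃ q₁ q₂,
    c v₁ q₁ ≠ none ∧ c v₂ q₂ ≠ none ∧ q₁ ∉ K ∧ q₂ ∉ K ∧
    ∀ Q', Disjoint Q Q' → (∀ p ∈ Q', ∃ t, Unc G c p t) →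
      ¬ ReachS G c Q' q₁ ∧ ¬ ReachS G c Q' q₂

theorem card_sum_of_nodup {l : List V} (hl : l.Nodup) (f : V → ℕ) :
    l.toFinset.card = l.length ∧ ∑ v ∈ l.toFinset, f v = (l.map f).sum :=
  ⟨List.toFinset_card_of_nodup hl, List.sum_toFinset f hl⟩

variable (hdeg : ∀ v, (G.neighborSet v).ncard ≤ 5)
include hdeg

theorem Opt.exists_sing_cluster (h : Opt G c) {x y : V} (hs : IsSing G c x y) :
    ∃ (K : Finset V) (m : V → Finset (Fin 5)), {x, y} ⊆ K ∧
      (∀ q ∈ K, Guard G c {x, y} q (m q)) ∧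
      ((K.card = 4 ∧ 3 + 2 * ∑ q ∈ K, (miss c q).card ≤ ∑ q ∈ K, (m q).card) ∨
        (K.card = 3 ∧ ∑ q ∈ K, (miss c q).card ≤ 2 ∧
          ∀ q ∈ K, 2 ≤ (m q).card ∧ miss c q ⊆ m q ∧ ∀ p ∈ K, ∀ α, c q p = some α → α ∈ m q)) := by
  have hc := h.toIsPCol
  have hxy := hs.unc.ne
  have hdj := h.disjoint_miss hs.unc
  have hcd : (miss c x ∪ miss c y).card = (miss c x).card + (miss c y).card :=
    card_union_of_disjoint (disjoint_left.2 fun _ => @hdj _)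
  have gx : Guard G c {x, y} x (miss c x ∪ miss c y) :=
    ⟨c, y, Var.refl hc _ _, by simp, hs.unc, rfl⟩
  have gy : Guard G c {x, y} y (miss c x ∪ miss c y) :=
    ⟨c, x, Var.refl hc _ _, by simp, hs.unc.symm hc, union_comm _ _⟩
  have key : ∀ {x y w : V} {b : Fin 5}, IsSing G c x y → b ∈ miss c y → c x w = some b →
      w ∉ ({x, y} : Finset V) ∧ (miss c w).card + 1 ≤ (miss c y).card ∧
      Guard G c {x, y} w (insert b (miss c w) ∪ miss c x) ∧
      (insert b (miss c w) ∪ miss c x).card = (miss c w).card + 1 + (miss c x).card := by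
    intro x y w b hs hb hw
    obtain ⟨k1, -, -, k4, k5, k6, k7, k8⟩ := h.sing_fan hdeg hs hb hw
    have hbw : b ∉ miss c w := fun h1 => mem_miss.1 h1 x (by rw [hc.symm]; exact hw)
    refine ⟨k1, k6, ⟨_, x, k4, by simp, k5.symm k4.pcol, by rw [k7, k8]⟩, ?_⟩
    rw [card_union_of_disjoint, card_insert_of_notMem hbw]
    rw [← k7, ← k8]
    exact disjoint_left.2 fun α h1 h2 => (k4.maxCol h.toMaxCol).disjoint_miss k5 h2 h1
  have px := one_le_card_miss hdeg hc hs.unc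
  have py := one_le_card_miss hdeg hc (hs.unc.symm hc)
  by_cases h4 : ∃ a ∈ miss c x, ∃ b ∈ miss c y, ∃ w₁ w₂, c x w₁ = some b ∧ c y w₂ = some a ∧
      w₁ ≠ w₂
  · obtain ⟨a, ha, b, hb, w₁, w₂, h1, h2, hne⟩ := h4
    obtain ⟨i1, i2, i3, i4⟩ := key hs hb h1
    obtain ⟨j1, j2, j3, j4⟩ := key (hs.swap hc) ha h2
    rw [pair_comm] at j3
    simp only [mem_insert, mem_singleton, not_or] at i1 j1
    have hnd : [x, y, w₁, w₂].Nodup := by simp; grind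
    let m : V → Finset (Fin 5) := fun q => if q = w₁ then insert b (miss c w₁) ∪ miss c x else
      if q = w₂ then insert a (miss c w₂) ∪ miss c y else miss c x ∪ miss c y
    have mx : m x = miss c x ∪ miss c y := by simp only [m]; rw [if_neg, if_neg] <;> grind
    have my : m y = miss c x ∪ miss c y := by simp only [m]; rw [if_neg, if_neg] <;> grind
    have m1 : m w₁ = insert b (miss c w₁) ∪ miss c x := by simp only [m, if_true]
    have m2 : m w₂ = insert a (miss c w₂) ∪ miss c y := by
      simp only [m, if_true]; rw [if_neg hne.symm]
    refine ⟨[x, y, w₁, w₂].toFinset, m, by simp [insert_subset_iff], ?_, Or.inl ⟨?_, ?_⟩⟩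
    · intro q hq
      simp only [List.mem_toFinset, List.mem_cons, List.not_mem_nil, or_false] at hq
      rcases hq with rfl | rfl | rfl | rfl
      · rwa [mx]
      · rwa [my]
      · rwa [m1]
      · rwa [m2]
    · exact (card_sum_of_nodup hnd fun _ => 0).1
    · rw [(card_sum_of_nodup hnd _).2, (card_sum_of_nodup hnd _).2]
      simp only [List.map_cons, List.map_nil, List.sum_cons, List.sum_nil, mx, my, m1, m2, hcd,
        i4, j4]
      omega
  · push Not at h4
    obtain ⟨a, ha⟩ := miss_nonempty hdeg hc hs.unc
    obtain ⟨b, hb⟩ := miss_nonempty hdeg hc (hs.unc.symm hc)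
    obtain ⟨w, hw⟩ := not_mem_miss.1 fun h1 => hdj h1 hb
    have hX : ∀ a' ∈ miss c x, c y w = some a' := by
      intro a' ha'
      obtain ⟨w₂, hw₂⟩ := not_mem_miss.1 fun h1 => hdj ha' h1
      rwa [← h4 a' ha' b hb w w₂ hw hw₂] at hw₂
    have hY : ∀ b' ∈ miss c y, c x w = some b' := by
      intro b' hb'
      obtain ⟨w₂, hw₂⟩ := not_mem_miss.1 fun h1 => hdj h1 hb'
      rwa [h4 a ha b' hb' w₂ w hw₂ (hX a ha)] at hw₂
    have eX : miss c x = {a} := eq_singleton_iff_unique_mem.2 ⟨ha, fun a' ha' => by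
      have := hX a ha; have := hX a' ha'; grind⟩
    have eY : miss c y = {b} := eq_singleton_iff_unique_mem.2 ⟨hb, fun a' ha' => by
      have := hY b hb; have := hY a' ha'; grind⟩
    obtain ⟨i1, i2, i3, i4⟩ := key hs hb hw
    simp only [mem_insert, mem_singleton, not_or] at i1
    have eW : miss c w = ∅ := by rw [← card_eq_zero]; rw [eY, card_singleton] at i2; omega
    have hnd : [x, y, w].Nodup := by simp; grind
    rw [eW, eX] at i3
    rw [eX, eY] at gx gy hcd
    have hyw := hX a ha
    refine ⟨[x, y, w].toFinset, fun _ => {a} ∪ {b}, by simp [insert_subset_iff], ?_,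
      Or.inr ⟨?_, ?_, ?_⟩⟩
    · intro q hq
      simp only [List.mem_toFinset, List.mem_cons, List.not_mem_nil, or_false] at hq
      rcases hq with rfl | rfl | rfl
      · exact gx
      · exact gy
      · rw [union_comm]; exact i3
    · exact (card_sum_of_nodup hnd fun _ => 0).1
    · rw [(card_sum_of_nodup hnd _).2]
      simp [eX, eY, eW]
    · intro q hq
      refine ⟨by rw [hcd]; simp, ?_, fun p hp α hα => ?_⟩
      · simp only [List.mem_toFinset, List.mem_cons, List.not_mem_nil, or_false] at hq
        rcases hq with rfl | rfl | rfl <;> simp [eX, eY, eW]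
      have e1 := hs.unc.2
      have e2 := (hs.unc.symm hc).2
      have e3 := hc.symm w x
      have e4 := hc.symm w y
      have e5 := hc.irrefl
      simp only [List.mem_toFinset, List.mem_cons, List.not_mem_nil, or_false] at hq hp
      rcases hq with rfl | rfl | rfl <;> rcases hp with rfl | rfl | rfl <;> grind

end

section

variable {V : Type*} [Fintype V] [DecidableEq V] {G : SimpleGraph V} {c c' c₁ c₂ : PCol V}

variable (hdeg : ∀ v, (G.neighborSet v).ncard ≤ 5)
include hdeg

/-- A pair whose leaves miss at least three colors. -/
theorem Opt.exists_heavy (h : Opt G c) {y x z : V} (hp : IsPair G c y x z)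
    (h3 : 3 ≤ (miss c x).card + (miss c z).card) :
    ∃ K : Finset V, {y, x, z} ⊆ K ∧ (∀ q ∈ K, ReachP G c {y, x, z} q) ∧ K.card = 6 ∧
      ∑ v ∈ K, (miss c v).card ≤ 7 := by
  have hc := h.toIsPCol
  wlog hle : (miss c x).card ≤ (miss c z).card generalizing x z with H
  · have := H hp.swap (by omega) (by omega)
    rwa [pair_comm z x] at this
  have d1 := h.disjoint_miss hp.left
  have d2 := h.disjoint_miss hp.right
  have d3 := h.disjoint_miss_two hdeg hp.left hp.right hp.ne
  have hsum : (miss c y).card + (miss c x).card + (miss c z).card ≤ 5 := by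
    rw [← card_union_of_disjoint (disjoint_left.2 fun _ => @d1 _), ← card_union_of_disjoint]
    · exact (card_le_univ _).trans (by simp)
    · rw [disjoint_union_left]
      exact ⟨disjoint_left.2 fun _ => @d2 _, disjoint_left.2 fun _ => @d3 _⟩
  have py := two_le_card_miss hdeg hc hp.left hp.right hp.ne
  have px := one_le_card_miss hdeg hc (hp.left.symm hc)
  obtain ⟨a, ha⟩ := miss_nonempty hdeg hc (hp.left.symm hc)
  obtain ⟨b₁, b₂, hb, hz⟩ := card_eq_two.1 (show (miss c z).card = 2 by omega)
  have hb₁ : b₁ ∈ miss c z := by rw [hz]; simp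
  have hb₂ : b₂ ∈ miss c z := by rw [hz]; simp
  obtain ⟨w, hw⟩ := not_mem_miss.1 fun h1 => d1 h1 ha
  obtain ⟨w₁, hw₁⟩ := not_mem_miss.1 fun h1 => d2 h1 hb₁
  obtain ⟨w₂, hw₂⟩ := not_mem_miss.1 fun h1 => d2 h1 hb₂
  obtain ⟨i1, -, i3, i4, -⟩ := h.pair_fan hdeg hp ha hw
  obtain ⟨j1, -, j3, j4, -⟩ := h.pair_fan hdeg hp.swap hb₁ hw₁
  obtain ⟨k1, -, k3, k4, -⟩ := h.pair_fan hdeg hp.swap hb₂ hw₂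
  rw [pair_comm] at j1 j3 k1 k3
  have hab₁ : a ≠ b₁ := by rintro rfl; exact d3 ha hb₁
  have hab₂ : a ≠ b₂ := by rintro rfl; exact d3 ha hb₂
  have hyx := hp.left.ne
  have hyz := hp.right.ne
  have hxz := hp.ne
  have hnd : [y, x, z, w, w₁, w₂].Nodup := by
    simp only [mem_insert, mem_singleton] at i1 j1 k1
    simp; grind
  refine ⟨[y, x, z, w, w₁, w₂].toFinset, by simp [insert_subset_iff], fun q hq => ?_,
    (card_sum_of_nodup hnd fun _ => 0).1, ?_⟩
  · simp only [List.mem_toFinset, List.mem_cons, List.not_mem_nil, or_false] at hq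
    rcases hq with rfl | rfl | rfl | rfl | rfl | rfl
    · exact hp.reachP_of_mem hc (by simp)
    · exact hp.reachP_of_mem hc (by simp)
    · exact hp.reachP_of_mem hc (by simp)
    · exact i3
    · exact j3
    · exact k3
  · rw [(card_sum_of_nodup hnd _).2]
    simp only [List.map_cons, List.map_nil, List.sum_cons, List.sum_nil]
    omega

theorem Opt.exists_source (h : Opt G c) {y x z w w' : V} {a b : Fin 5} (hp : IsPair G c y x z)
    (hT : ¬ TriAt G c y) (hx : miss c x = {a}) (hz : miss c z = {b}) (hw : c y w = some a)
    (hw' : c y w' = some b) : Source G c y x z w w' a b := by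
  have hc := h.toIsPCol
  have key : ∀ {c : PCol V} {x z w : V} {a : Fin 5}, Opt G c → IsPair G c y x z →
      ¬ TriAt G c y → miss c x = {a} → c y w = some a →
      miss c w = ∅ ∧ w ∉ ({y, x, z} : Finset V) ∧ Opt G (slide c x y w a) ∧
        ¬ TriAt G (slide c x y w a) y ∧ IsPair G (slide c x y w a) y w z ∧
        (∀ α ∈ miss c y, c w z ≠ some α) := by
    intro c x z w a h hp hT hx hw
    have hc := h.toIsPCol
    have ha : a ∈ miss c x := by rw [hx]; simp
    obtain ⟨k1, k2, k3, k4, k5⟩ := h.pair_fan hdeg hp ha hw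
    rw [hx, card_singleton] at k4 k5
    have hm : miss c w = ∅ := by rw [← card_eq_zero]; omega
    obtain ⟨k6, k7⟩ := k5 (by rw [hm]; rfl)
    have hu := hp.left.symm hc
    have hxz := hp.ne
    simp only [mem_insert, mem_singleton, not_or] at k1
    have hp' : IsPair G (slide c x y w a) y w z := by
      refine ⟨((unc_slide_iff hc hw _ _).2 (by grind)), (unc_slide_iff hc hw _ _).2 ?_, k1.2.2⟩
      have := hp.right
      grind
    refine ⟨hm, by simp [k1], k7 hT, fun h1 => hT (k6 h1), hp', fun α hα h1 => hT (k6 ?_)⟩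
    refine ⟨w, z, α, hp', ?_, ?_⟩
    · rw [miss_slide hc hu ha hw, if_neg hu.ne.symm, if_neg (Ne.symm k1.1)]; exact hα
    · have := hp.right.ne
      rw [slide_apply]; grind
  obtain ⟨i1, i2, i3, i4, i5, i6⟩ := key h hp hT hx hw
  obtain ⟨j1, j2, -, -, -, j6⟩ := key h hp.swap hT hz hw'
  have d3 := h.disjoint_miss_two hdeg hp.left hp.right hp.ne
  have ha : a ∈ miss c x := by rw [hx]; simp
  have hab : a ≠ b := by
    rintro rfl; exact d3 ha (by rw [hz]; simp)
  have hyx := hp.left.ne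
  have hyz := hp.right.ne
  have hxz := hp.ne
  simp only [mem_insert, mem_singleton, not_or] at i2 j2
  have hu := hp.left.symm hc
  obtain ⟨-, -, -, -, -, l6⟩ := key (z := w) i3 i5.swap i4 (w := w') (a := b)
    (by rw [miss_slide hc hu ha hw, if_neg hxz.symm, if_neg (Ne.symm i2.2.2), hz])
    (by rw [slide_apply]; grind)
  refine ⟨hp, hx, hz, hw, hw', i1, j1, fun α hα h1 => hT ⟨x, z, α, hp, hα, h1⟩,
    fun α hα => by rw [hc.symm]; exact j6 α hα, fun α hα => by rw [hc.symm]; exact i6 α hα,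
    fun α hα => ?_⟩
  have := l6 α (by rw [miss_slide hc hu ha hw, if_neg hyx, if_neg (Ne.symm i2.1)]; exact hα)
  intro h1
  rw [hc.symm] at h1
  have hww : w' ≠ w := by rintro rfl; rw [hw] at hw'; grind
  apply this
  rw [slide_apply]
  grind

/-- In a tight configuration the neighbor of `w` along `γ` is not reachable from elsewhere. -/
theorem Opt.not_reachS_of_tight (h : Opt G c) {y x z w q : V} {γ a b d : Fin 5}
    (hp : IsPair G c y x z) (hγ : γ ∈ miss c y) (hd : d ∈ miss c y) (hγd : γ ≠ d)
    (ha : a ∈ miss c x) (hb : b ∈ miss c z) (hxz : c x z = some γ) (hyw : c y w = some a)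
    (hxw : c x w = some b) (hzw : c z w = some d) (hq : c w q = some γ) {Q : Finset V}
    (hD : Disjoint ({y, x, z, w} : Finset V) Q) : ¬ ReachS G c Q q := by
  rintro ⟨c₂, r, h₂, hr, hur⟩
  have hc := h.toIsPCol
  have hyx := hp.left.ne
  have hyz := hp.right.ne
  have hne := hp.ne
  have dyx := h.disjoint_miss hp.left
  have dyz := h.disjoint_miss hp.right
  have dxz := h.disjoint_miss_two hdeg hp.left hp.right hp.ne
  have hs := hc.symm
  have hin := hc.inj
  have hir := hc.irrefl
  have hqw : q ≠ w := by rintro rfl; rw [hir] at hq; cases hq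
  have hab : a ≠ b := by rintro rfl; exact dxz ha hb
  have hγa : γ ≠ a := by rintro rfl; exact dyx hγ ha
  have hγb : γ ≠ b := by rintro rfl; exact dyz hγ hb
  have hda : d ≠ a := by rintro rfl; exact dyx hd ha
  have hdb : d ≠ b := by rintro rfl; exact dyz hd hb
  have hwy : w ≠ y := by rintro rfl; rw [hir] at hyw; cases hyw
  have hwx : w ≠ x := by rintro rfl; rw [hir] at hxw; cases hxw
  have hwz : w ≠ z := by rintro rfl; rw [hir] at hzw; cases hzw
  have hqy : q ≠ y := by
    rintro rfl; rw [hs] at hq; exact mem_miss.1 hγ _ hq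
  have hqx : q ≠ x := by
    rintro rfl; rw [hs] at hq; grind
  have hqz : q ≠ z := by
    rintro rfl; rw [hs] at hq; grind
  have hzx : c z x = some γ := by rw [hs]; exact hxz
  obtain ⟨o1, p1, -, m1, n1, l1⟩ := h.tri_shift hdeg hp.swap hγ hzx
  obtain ⟨o2, p2, -, m2, n2, l2⟩ := h.tri_shift hdeg hp hγ hxz
  have v1 : Var G c (slide c y z x γ) {y, x, z, w} x :=
    var_slide hc hp.right hγ hzx (by simp) (by simp)
  have v2 : Var G c (slide c y x z γ) {y, x, z, w} z :=
    var_slide hc hp.left hγ hxz (by simp) (by simp)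
  have key : ∀ {c₁ : PCol V} {e : Fin 5}, Var G c c₁ {y, x, z, w} q → Unc G c₁ q w →
      e ∈ miss c₁ w → e ∉ miss c₂ q ∧ e ∉ miss c₂ r ∧ γ ∉ miss c₂ q ∧ γ ∉ miss c₂ r :=
    fun h₁ hu he => h.notMem_miss_of_unc hdeg h₁ (by simp [hqy, hqx, hqz, hqw]) (by simp) hu hq he
      h₂ hr hur hD
  obtain ⟨e0, f0, g0, -, k0, -⟩ := hp.exists_move hc ha hyw (Or.inr rfl) hγ hq hqx hqw
  have r0 := key (f0.mono (by grind)) g0 k0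
  obtain ⟨e1, f1, g1, -, k1, -⟩ := p1.swap.exists_move o1.toIsPCol (w := w) (v := w) (a := b)
    (γ := γ) (q := q) (by rwa [l1]) (by rw [slide_apply]; grind) (Or.inr rfl) (by rw [n1]; simp)
    (by rw [slide_apply]; grind) hqz hqw
  have r1 := key (v1.trans (f1.mono (by grind)) (by simp) subset_rfl) g1 k1
  obtain ⟨e2, f2, g2, -, k2, -⟩ := p2.exists_move o2.toIsPCol (w := w) (v := w) (a := d)
    (γ := γ) (q := q) (by rw [m2]; grind) (by rw [slide_apply]; grind) (Or.inr rfl)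
    (by rw [n2]; simp) (by rw [slide_apply]; grind) hqy hqw
  have r2 := key (v2.trans (f2.mono (by grind)) (by simp) subset_rfl) g2 k2
  have h2 := (h₂.maxCol h.toMaxCol)
  obtain ⟨α, hα⟩ := miss_nonempty hdeg h₂.pcol hur
  obtain ⟨β, hβ⟩ := miss_nonempty hdeg h₂.pcol (hur.symm h₂.pcol)
  have hαβ : α ≠ β := by rintro rfl; exact h2.disjoint_miss hur hα hβ
  have n1 : α ≠ a ∧ α ≠ b ∧ α ≠ d ∧ α ≠ γ := by grind
  have n2 : β ≠ a ∧ β ≠ b ∧ β ≠ d ∧ β ≠ γ := by grind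
  omega

end

section

variable {V : Type*} [Fintype V] [DecidableEq V] {G : SimpleGraph V} {c c' c₁ c₂ : PCol V}

variable (hdeg : ∀ v, (G.neighborSet v).ncard ≤ 5)
include hdeg

theorem Opt.tri_fan (h : Opt G c) {y x z u : V} {γ e : Fin 5} (hp : IsPair G c y x z)
    (hγ : γ ∈ miss c y) (hxz : c x z = some γ)
    (he : miss c z = {e} ∨ e ≠ γ ∧ miss c y = {γ, e}) (hu : c x u = some e) :
    u ∉ ({y, x, z} : Finset V) ∧ miss c u = ∅ ∧ ReachP G c {y, x, z} u := by
  have hc := h.toIsPCol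
  have hzx : c z x = some γ := by rw [hc.symm]; exact hxz
  obtain ⟨o, p, -, m, n, l⟩ := h.tri_shift hdeg hp.swap hγ hzx
  have hyx := hp.left.ne
  have hyz := hp.right.ne
  have hne := hp.ne
  have hcu := (hp.left.symm hc).2
  have heγ : e ≠ γ := by
    rcases he with he | he
    · rintro rfl; exact h.disjoint_miss hp.right hγ (by rw [he]; simp)
    · exact he.1
  have huz : u ≠ z := by rintro rfl; grind
  have huy : u ≠ y := by rintro rfl; grind
  have hux : u ≠ x := by rintro rfl; rw [hc.irrefl] at hu; cases hu
  have hu' : slide c y z x γ x u = some e := by rw [slide_apply]; grind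
  have e1 : ({x, z, y} : Finset V) = {y, x, z} := by grind
  have e2 : ({x, y, z} : Finset V) = {y, x, z} := by grind
  have hmu : miss (slide c y z x γ) u = miss c u := by
    rw [miss_slide hc hp.right hγ hzx, if_neg huy, if_neg hux]
  have hn := num_slide hc hp.right hγ hzx
  have hl : ∀ v ∉ ({y, x, z} : Finset V), ∀ t, slide c y z x γ v t = c v t := fun v hv t =>
    slide_eq_of_notMem (by simp) (by simp) (by simp) hv t
  refine ⟨by simp [huy, hux, huz], ?_⟩
  rcases he with he | ⟨-, he⟩
  · obtain ⟨-, -, k3, k4, -⟩ := o.pair_fan hdeg p.swap (a := e) (by rw [l, he]; simp) hu'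
    rw [l, he, card_singleton, hmu] at k4
    rw [e1] at k3
    exact ⟨by rw [← card_eq_zero]; omega, k3.of_eq hn hl⟩
  · have hm : miss (slide c y z x γ) y = {e} := by rw [m, he]; grind
    obtain ⟨-, -, k3, k4, -⟩ := o.pair_fan hdeg p (a := e) (by rw [hm]; simp) hu'
    rw [hm, card_singleton, hmu] at k4
    rw [e2] at k3
    exact ⟨by rw [← card_eq_zero]; omega, k3.of_eq hn hl⟩

theorem Opt.exists_heavy_of_tri (h : Opt G c) {y x z : V} {γ : Fin 5} (hp : IsPair G c y x z)
    (hγ : γ ∈ miss c y) (hxz : c x z = some γ) (h3 : 3 ≤ (miss c y).card) :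
    ∃ K : Finset V, {y, x, z} ⊆ K ∧ (∀ q ∈ K, ReachP G c {y, x, z} q) ∧ K.card = 6 ∧
      ∑ v ∈ K, (miss c v).card ≤ 7 := by
  have hc := h.toIsPCol
  have hzx : c z x = some γ := by rw [hc.symm]; exact hxz
  obtain ⟨o, p, -, m, n, l⟩ := h.tri_shift hdeg hp.swap hγ hzx
  have hyx := hp.left.ne
  have hyz := hp.right.ne
  have hne := hp.ne
  have e2 : ({x, y, z} : Finset V) = {y, x, z} := by grind
  have c1 := card_erase_add_one hγ
  have pz := one_le_card_miss hdeg hc (hp.right.symm hc)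
  obtain ⟨K, k1, k2, k3, k4⟩ := o.exists_heavy hdeg p (by rw [m, l]; omega)
  rw [e2] at k1 k2
  refine ⟨K, k1, fun q hq => (k2 q hq).of_eq (num_slide hc hp.right hγ hzx) fun v hv t =>
    slide_eq_of_notMem (by simp) (by simp) (by simp) hv t, k3, ?_⟩
  have hγx : γ ∉ miss c x := fun h1 => mem_miss.1 h1 z hxz
  have c2 := card_insert_of_notMem hγx
  rw [← sum_sdiff k1] at k4 ⊢
  have s1 : ∀ v ∈ K \ {y, x, z}, (miss (slide c y z x γ) v).card = (miss c v).card := by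
    intro v hv
    simp only [mem_sdiff, mem_insert, mem_singleton, not_or] at hv
    rw [miss_slide hc hp.right hγ hzx, if_neg hv.2.1, if_neg hv.2.2.1]
  rw [sum_congr rfl s1] at k4
  rw [sum_insert (by simp [hyx, hyz]), sum_pair hne] at k4 ⊢
  rw [m, n, l] at k4
  omega

theorem Opt.exists_pair_cluster (h : Opt G c) (hG : CliqueClosed G) {y x z : V}
    (hp : IsPair G c y x z) :
    ∃ K : Finset V, {y, x, z} ⊆ K ∧ (∀ q ∈ K, ReachP G c {y, x, z} q) ∧
      ((K.card = 6 ∧ ∑ v ∈ K, (miss c v).card ≤ 7) ∨ Tight G c {y, x, z} K ∨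
        ∃ w w' a b, Source G c y x z w w' a b ∧ K = {y, x, z, w, w'}) := by
  have hc := h.toIsPCol
  by_cases h3 : 3 ≤ (miss c x).card + (miss c z).card
  · obtain ⟨K, k1, k2, k3, k4⟩ := h.exists_heavy hdeg hp h3
    exact ⟨K, k1, k2, Or.inl ⟨k3, k4⟩⟩
  have dyx := h.disjoint_miss hp.left
  have dyz := h.disjoint_miss hp.right
  have dxz := h.disjoint_miss_two hdeg hp.left hp.right hp.ne
  have py := two_le_card_miss hdeg hc hp.left hp.right hp.ne
  have px := one_le_card_miss hdeg hc (hp.left.symm hc)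
  have pz := one_le_card_miss hdeg hc (hp.right.symm hc)
  obtain ⟨a, hx⟩ := card_eq_one.1 (show (miss c x).card = 1 by omega)
  obtain ⟨b, hz⟩ := card_eq_one.1 (show (miss c z).card = 1 by omega)
  have ha : a ∈ miss c x := by rw [hx]; simp
  have hb : b ∈ miss c z := by rw [hz]; simp
  obtain ⟨w, hw⟩ := not_mem_miss.1 fun h1 => dyx h1 ha
  obtain ⟨w', hw'⟩ := not_mem_miss.1 fun h1 => dyz h1 hb
  obtain ⟨i1, i2, i3, i4, -⟩ := h.pair_fan hdeg hp ha hw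
  obtain ⟨j1, j2, j3, j4, -⟩ := h.pair_fan hdeg hp.swap hb hw'
  rw [pair_comm] at j1 j3
  have mw : miss c w = ∅ := by rw [← card_eq_zero]; omega
  have mw' : miss c w' = ∅ := by rw [← card_eq_zero]; omega
  have hab : a ≠ b := by rintro rfl; exact dxz ha hb
  have hyx := hp.left.ne
  have hyz := hp.right.ne
  have hne := hp.ne
  have hs := hc.symm
  have hin := hc.inj
  have hir := hc.irrefl
  simp only [mem_insert, mem_singleton, not_or] at i1 j1
  have hww : w ≠ w' := by rintro rfl; grind
  have hreach : ∀ q ∈ [y, x, z, w, w'].toFinset, ReachP G c {y, x, z} q := by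
    intro q hq
    simp only [List.mem_toFinset, List.mem_cons, List.not_mem_nil, or_false] at hq
    rcases hq with rfl | rfl | rfl | rfl | rfl
    · exact hp.reachP_of_mem hc (by simp)
    · exact hp.reachP_of_mem hc (by simp)
    · exact hp.reachP_of_mem hc (by simp)
    · exact i3
    · exact j3
  by_cases hT : TriAt G c y
  swap
  · exact ⟨[y, x, z, w, w'].toFinset, by simp [insert_subset_iff], hreach, Or.inr (Or.inr
      ⟨w, w', a, b, h.exists_source hdeg hp hT hx hz hw hw', by simp⟩)⟩
  obtain ⟨γ, hγ, hxz⟩ : ∃ γ ∈ miss c y, c x z = some γ := by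
    obtain ⟨x', z', γ, hp', hγ, hc'⟩ := hT
    refine ⟨γ, hγ, ?_⟩
    have := h.eq_or_eq_of_unc_center hdeg hp hp'.left
    have := h.eq_or_eq_of_unc_center hdeg hp hp'.right
    have := hp'.ne
    have := hs x z
    grind
  have hzx : c z x = some γ := by rw [hs]; exact hxz
  by_cases hy3 : 3 ≤ (miss c y).card
  · obtain ⟨K, k1, k2, k3, k4⟩ := h.exists_heavy_of_tri hdeg hp hγ hxz hy3
    exact ⟨K, k1, k2, Or.inl ⟨k3, k4⟩⟩
  obtain ⟨d, hd, hdγ⟩ : ∃ d ∈ miss c y, d ≠ γ :=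
    exists_mem_ne (by omega) γ
  have hy : miss c y = {γ, d} := by
    symm
    refine eq_of_subset_of_card_le (by simp [insert_subset_iff, hγ, hd]) ?_
    rw [card_pair hdγ.symm]; omega
  have hγa : γ ≠ a := by rintro rfl; exact dyx hγ ha
  have hγb : γ ≠ b := by rintro rfl; exact dyz hγ hb
  have hda : d ≠ a := by rintro rfl; exact dyx hd ha
  have hdb : d ≠ b := by rintro rfl; exact dyz hd hb
  by_cases hu : ∃ u, u ∉ ({y, x, z} : Finset V) ∧ miss c u = ∅ ∧ ReachP G c {y, x, z} u ∧
      u ≠ w ∧ u ≠ w'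
  · obtain ⟨u, u1, u2, u3, u4, u5⟩ := hu
    simp only [mem_insert, mem_singleton, not_or] at u1
    have hnd : [u, y, x, z, w, w'].Nodup := by simp; grind
    refine ⟨[u, y, x, z, w, w'].toFinset, by simp [insert_subset_iff], fun q hq => ?_,
      Or.inl ⟨(card_sum_of_nodup hnd fun _ => 0).1, ?_⟩⟩
    · rw [List.mem_toFinset, List.mem_cons] at hq
      rcases hq with rfl | hq
      · exact u3
      · exact hreach q (List.mem_toFinset.2 hq)
    · rw [(card_sum_of_nodup hnd _).2]
      simp [hy, hx, hz, mw, mw', u2, card_pair hdγ.symm]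
  push Not at hu
  have hW : ∀ u, u ∉ ({y, x, z} : Finset V) ∧ miss c u = ∅ ∧ ReachP G c {y, x, z} u →
      u = w ∨ u = w' := fun u ⟨h1, h2, h3⟩ => or_iff_not_imp_left.2 (hu u h1 h2 h3)
  have hxe : ∀ e, e ≠ a → ∃ u, c x u = some e := fun e he =>
    not_mem_miss.1 (by rw [hx]; simpa using he)
  have hze : ∀ e, e ≠ b → ∃ u, c z u = some e := fun e he =>
    not_mem_miss.1 (by rw [hz]; simpa using he)
  obtain ⟨u₁, hu₁⟩ := hxe b hab.symm
  obtain ⟨u₂, hu₂⟩ := hxe d hda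
  obtain ⟨u₃, hu₃⟩ := hze a hab
  obtain ⟨u₄, hu₄⟩ := hze d hdb
  have k1 := hW _ (h.tri_fan hdeg hp hγ hxz (Or.inl hz) hu₁)
  have k2 := hW _ (h.tri_fan hdeg hp hγ hxz (Or.inr ⟨hdγ, hy⟩) hu₂)
  have k3 := hW u₃ (by
    have := h.tri_fan hdeg hp.swap hγ hzx (Or.inl hx) hu₃
    rwa [pair_comm z x] at this)
  have k4 := hW u₄ (by
    have := h.tri_fan hdeg hp.swap hγ hzx (Or.inr ⟨hdγ, hy⟩) hu₄
    rwa [pair_comm z x] at this)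
  have hxw : c x w = some b := by
    rcases k1 with h1 | h1 <;> rw [h1] at hu₁
    · exact hu₁
    · exact absurd (hin w' x y b (by rw [hs]; exact hu₁) (by rw [hs]; exact hw')) hyx.symm
  have hzw' : c z w' = some a := by
    rcases k3 with h1 | h1 <;> rw [h1] at hu₃
    · exact absurd (hin w z y a (by rw [hs]; exact hu₃) (by rw [hs]; exact hw)) hyz.symm
    · exact hu₃
  have hxw' : c x w' = some d := by grind
  have hzw : c z w = some d := by grind
  have hnd : [y, x, z, w, w'].Nodup := by simp; grind
  have hcard := (card_sum_of_nodup hnd fun _ => 0).1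
  have hwe : ∀ e, ∃ u, c w u = some e := fun e => not_mem_miss.1 (by rw [mw]; simp)
  have hwe' : ∀ e, ∃ u, c w' u = some e := fun e => not_mem_miss.1 (by rw [mw']; simp)
  have hww' : ¬ G.Adj w w' := by
    intro hadj
    have hA := hc.adj
    obtain ⟨v, hv, ho⟩ := hG _ hcard (by
      have e1 := hp.left.1
      have e2 := hp.right.1
      have e3 := hA _ _ _ hxz
      have e4 := hA _ _ _ hw
      have e5 := hA _ _ _ hw'
      have e6 := hA _ _ _ hxw
      have e7 := hA _ _ _ hxw'
      have e8 := hA _ _ _ hzw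
      have e9 := hA _ _ _ hzw'
      intro u hu v hv huv
      simp only [List.mem_toFinset, List.mem_cons, List.not_mem_nil, or_false] at hu hv
      rcases hu with rfl | rfl | rfl | rfl | rfl <;>
        rcases hv with rfl | rfl | rfl | rfl | rfl <;>
        first | exact absurd rfl huv | assumption | (apply SimpleGraph.Adj.symm; assumption))
    have ho' : ∀ o e, c v o = some e → o = y ∨ o = x ∨ o = z ∨ o = w ∨ o = w' := fun o e h1 => by
      simpa using ho o (hA _ _ _ h1)
    have hfin : ∀ a b d γ : Fin 5, ∃ e, e ≠ a ∧ e ≠ b ∧ e ≠ d ∧ e ≠ γ := by decide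
    obtain ⟨e, ea, eb, ed, eγ⟩ := hfin a b d γ
    have ny := hp.left.2
    have nz := hp.right.2
    have ny' := (hp.left.symm hc).2
    have nz' := (hp.right.symm hc).2
    have ewy : c w y = some a := by rw [hs]; exact hw
    have ewy' : c w' y = some b := by rw [hs]; exact hw'
    have ewx : c w x = some b := by rw [hs]; exact hxw
    have ewx' : c w' x = some d := by rw [hs]; exact hxw'
    have ewz : c w z = some d := by rw [hs]; exact hzw
    have ewz' : c w' z = some a := by rw [hs]; exact hzw'
    simp only [List.mem_toFinset, List.mem_cons, List.not_mem_nil, or_false] at hv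
    rcases hv with rfl | rfl | rfl | rfl | rfl
    · obtain ⟨o, h1⟩ := not_mem_miss.1 (show e ∉ miss c v by rw [hy]; simp [eγ, ed])
      rcases ho' o e h1 with rfl | rfl | rfl | rfl | rfl <;> grind
    · obtain ⟨o, h1⟩ := hxe e ea
      rcases ho' o e h1 with rfl | rfl | rfl | rfl | rfl <;> grind
    · obtain ⟨o, h1⟩ := hze e eb
      rcases ho' o e h1 with rfl | rfl | rfl | rfl | rfl <;> grind
    · obtain ⟨o, h1⟩ := hwe e
      obtain ⟨o', h1'⟩ := hwe γ
      have := ho' o e h1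
      have := ho' o' γ h1'
      have := hir v
      grind
    · obtain ⟨o, h1⟩ := hwe' e
      obtain ⟨o', h1'⟩ := hwe' γ
      have := ho' o e h1
      have := ho' o' γ h1'
      have := hir v
      grind
  obtain ⟨q₁, hq₁⟩ := hwe γ
  obtain ⟨q₂, hq₂⟩ := hwe' γ
  have hD : ∀ {w : V} {Q' : Finset V}, (∀ u, ¬ Unc G c w u) → Disjoint {y, x, z} Q' →
      (∀ p ∈ Q', ∃ t, Unc G c p t) → Disjoint {y, x, z, w} Q' := by
    intro w Q' hw hQ hQ'
    have e : ({y, x, z, w} : Finset V) = insert w {y, x, z} := by grind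
    rw [e, disjoint_insert_left]
    exact ⟨fun h1 => (hQ' w h1).elim hw, hQ⟩
  have a1 := hc.adj w q₁ _ hq₁
  have a2 := hc.adj w' q₂ _ hq₂
  have hγy := fun u => mem_miss.1 hγ u
  refine ⟨[y, x, z, w, w'].toFinset, by simp [insert_subset_iff], hreach, Or.inr (Or.inl
    ⟨hcard, ?_, w, by simp, w', by simp, hww, q₁, q₂, by simp [hq₁], by simp [hq₂], ?_, ?_, ?_⟩)⟩
  · rw [(card_sum_of_nodup hnd _).2]
    simp [hy, hx, hz, mw, mw', card_pair hdγ.symm]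
  · simp only [List.mem_toFinset, List.mem_cons, List.not_mem_nil, or_false]
    rintro (rfl | rfl | rfl | rfl | rfl)
    · exact hγy w (by rw [hs]; exact hq₁)
    all_goals grind
  · simp only [List.mem_toFinset, List.mem_cons, List.not_mem_nil, or_false]
    have := fun h1 : G.Adj w' w => hww' h1.symm
    rintro (rfl | rfl | rfl | rfl | rfl)
    · exact hγy w' (by rw [hs]; exact hq₂)
    all_goals grind
  · intro Q' hQ hQ'
    refine ⟨h.not_reachS_of_tight hdeg hp hγ hd hdγ.symm ha hb hxz hw hxw hzw hq₁ (hD i2 hQ hQ'),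
      h.not_reachS_of_tight hdeg hp.swap hγ hd hdγ.symm hb ha hzx hw' hzw' hxw' hq₂ ?_⟩
    have e : ({y, z, x, w'} : Finset V) = {y, x, z, w'} := by grind
    rw [e]
    exact hD j2 hQ hQ'

end

section

variable {V : Type*} [Fintype V] [DecidableEq V] {G : SimpleGraph V} {c c' c₁ c₂ : PCol V}

variable (hdeg : ∀ v, (G.neighborSet v).ncard ≤ 5)
include hdeg

set_option maxHeartbeats 1000000 in
theorem source_edge (h : MaxCol G c) {y x z w w' v q : V} {a b γ : Fin 5}
    (hS : Source G c y x z w w' a b) (hv : v = x ∨ v = w) (hγ : γ ∈ miss c y)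
    (hq : c v q = some γ) (hqK : q ∉ ({y, x, z, w, w'} : Finset V)) {Q : Finset V}
    {m : Finset (Fin 5)} (hm : Guard G c Q q m)
    (hQ : Disjoint ({y, x, z, w, w'} : Finset V) Q) :
    γ ∉ m ∧ a ∉ m ∧ ∀ p, p ∉ Q → c q p = some a → p ∉ ({y, x, z, w, w'} : Finset V) ∧
      ∀ Q', Disjoint ({y, x, z, w, w'} : Finset V) Q' → Disjoint Q Q' → q ∉ Q' →
        ¬ ReachS G c Q' p := by
  obtain ⟨c₂, r, h₂, hr, hur, rfl⟩ := hm
  have hc := h.toIsPCol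
  have hp := hS.pair
  have ha : a ∈ miss c x := by rw [hS.miss_x]; simp
  have hb : b ∈ miss c z := by rw [hS.miss_z]; simp
  simp only [mem_insert, mem_singleton, not_or] at hqK
  obtain ⟨hqy, hqx, hqz, hqw, hqw'⟩ := hqK
  obtain ⟨c₁, h₁, u1, u2, ha₁, hrow⟩ := hp.exists_move hc ha hS.yw hv hγ hq hqx hqw
  have hDK : ({y, x, w} : Finset V) ⊆ {y, x, z, w, w'} := by grind
  have hD : Disjoint ({y, x, w} : Finset V) Q := disjoint_of_subset_left hDK hQ
  have hqD : q ∉ ({y, x, w} : Finset V) := by simp [hqy, hqx, hqw]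
  have hvD : v ∈ ({y, x, w} : Finset V) := by rcases hv with rfl | rfl <;> simp
  obtain ⟨n1, n2, n3, n4⟩ := h.notMem_miss_of_unc hdeg h₁ hqD hvD u1 hq ha₁ h₂ hr hur hD
  refine ⟨by simp [n3, n4], by simp [n1, n2], fun p hpQ hpa => ?_⟩
  have h3 := var_combine h₁ h₂ hD hqD hc
  have m3 := h3.maxCol h
  have hrD := disjoint_right.1 hD hr
  have t1 : Unc G (combine c₁ c₂ {y, x, w}) v q := Unc.combine_left hvD (u1.symm h₁.pcol)
  have t2 : Unc G (combine c₁ c₂ {y, x, w}) q r :=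
    (Unc.combine_right hD hqD hr (hur.symm h₂.pcol)).symm m3.toIsPCol
  have t3 : Unc G (combine c₁ c₂ {y, x, w}) y z := Unc.combine_left (by simp) u2
  have hs := hc.symm
  have hin := hc.inj
  have hir := hc.irrefl
  have hyw := hS.yw
  have hyw' := hS.yw'
  have hww' : w' ≠ w := by
    rintro rfl
    have : a = b := by grind
    subst this
    exact h.disjoint_miss_two hdeg hp.left hp.right hp.ne ha hb
  have hwy : w ≠ y := by rintro rfl; rw [hir] at hyw; cases hyw
  have hwy' : w' ≠ y := by rintro rfl; rw [hir] at hyw'; cases hyw'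
  have hwx' : w' ≠ x := by rintro rfl; have := hp.left.2; grind
  have hwz' : w' ≠ z := by rintro rfl; have := hp.right.2; grind
  have hzw : z ≠ w := by rintro rfl; have := hp.right.2; grind
  have hyx := hp.left.ne
  have hyz := hp.right.ne
  have hne := hp.ne
  have hpq : p ≠ q := by rintro rfl; rw [hir] at hpa; cases hpa
  have hpy : p ≠ y := by rintro rfl; grind
  have hpx : p ≠ x := by
    rintro rfl; exact mem_miss.1 ha q (by rw [hs]; exact hpa)
  have hpw : p ≠ w := by rintro rfl; grind
  have hpD : p ∉ ({y, x, w} : Finset V) := by simp [hpy, hpx, hpw]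
  have hvy : v ≠ y := by rcases hv with rfl | rfl; exacts [hyx.symm, hwy]
  have hvz : v ≠ z := by rcases hv with rfl | rfl; exacts [hne, hzw.symm]
  have hvp : v ≠ p := by rcases hv with rfl | rfl; exacts [hpx.symm, hpw.symm]
  have hvw' : v ≠ w' := by rcases hv with rfl | rfl; exacts [hwx'.symm, hww'.symm]
  have ha3 : a ∈ miss (combine c₁ c₂ {y, x, w}) v := by
    rw [mem_miss] at ha₁ ⊢
    intro t
    rw [combine_of_mem h₁ h₂ hD hqD hvD]
    exact ha₁ t
  have hp3 : combine c₁ c₂ {y, x, w} q p = some a := by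
    have : c₂ q p = c q p := by
      rw [h₂.pcol.symm, hs q p]
      exact h₂.eq_of_ne hpQ hpq q
    rw [combine, if_neg (by tauto), this, hpa]
  have hrow3 : ∀ t, t ≠ x → t ≠ w → combine c₁ c₂ {y, x, w} y t = c y t := fun t ht ht' => by
    rw [combine_of_mem h₁ h₂ hD hqD (by simp), hrow t ht ht']
  have hz3 : b ∈ miss (combine c₁ c₂ {y, x, w}) z := by
    rw [mem_miss] at hb ⊢
    intro t
    have hzQ := disjoint_left.1 hQ (show z ∈ ({y, x, z, w, w'} : Finset V) by simp)
    rw [h3.eq_of_ne (by simp [hyz.symm, hne.symm, hzw, hzQ]) (Ne.symm hqz)]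
    exact hb t
  generalize combine c₁ c₂ {y, x, w} = c₃ at *
  have m4 := m3.slide t1 ha3 hp3
  have hrv : r ≠ v := by rintro rfl; exact hrD hvD
  have hrp : r ≠ p := by rintro rfl; exact hpQ hr
  have hrz : r ≠ z := by
    rintro rfl; exact disjoint_left.1 hQ (show r ∈ ({y, x, r, w, w'} : Finset V) by simp) hr
  have hrw' : r ≠ w' := by
    rintro rfl; exact disjoint_left.1 hQ (show r ∈ ({y, x, z, w, r} : Finset V) by simp) hr
  have s1 : Unc G (slide c₃ v q p a) q p := (unc_slide_iff m3.toIsPCol hp3 _ _).2 (by grind)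
  have s2 : Unc G (slide c₃ v q p a) q r := (unc_slide_iff m3.toIsPCol hp3 _ _).2 (by grind)
  have s3 : Unc G (slide c₃ v q p a) y z := (unc_slide_iff m3.toIsPCol hp3 _ _).2 (by grind)
  have v4 : Var G c (slide c₃ v q p a) (insert q ({y, x, w} ∪ Q)) p :=
    (h3.mono (subset_insert _ _)).trans
      (var_slide m3.toIsPCol t1 ha3 hp3 (mem_insert_of_mem (mem_union_left _ hvD)) (by simp))
      (by simp) subset_rfl
  have hpz : p ≠ z := by
    rintro rfl
    exact m4.no_path hdeg (s2.symm m4.toIsPCol) s1 (s3.symm m4.toIsPCol) hrp hqy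
  have hpw' : p ≠ w' := by
    rintro rfl
    have hb4 : b ∈ miss (slide c₃ v q p a) z := by
      rw [miss_slide m3.toIsPCol t1 ha3 hp3, if_neg hvz.symm, if_neg hpz.symm]
      exact hz3
    have hy4 : slide c₃ v q p a y p = some b := by
      have := hrow3 p hpx hpw
      rw [slide_apply]
      grind
    have m5 := m4.slide (s3.symm m4.toIsPCol) hb4 hy4
    have r1 : Unc G (slide (slide c₃ v q p a) z y p b) q p :=
      (unc_slide_iff m4.toIsPCol hy4 _ _).2 (by grind)
    have r2 : Unc G (slide (slide c₃ v q p a) z y p b) q r :=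
      (unc_slide_iff m4.toIsPCol hy4 _ _).2 (by grind)
    have r3 : Unc G (slide (slide c₃ v q p a) z y p b) p y :=
      (unc_slide_iff m4.toIsPCol hy4 _ _).2 (by grind)
    exact m5.no_path hdeg (r2.symm m5.toIsPCol) r1 r3 hrp hqy
  refine ⟨by simp [hpy, hpx, hpz, hpw, hpw'], fun Q' hQ' hQQ' hqQ' hre => ?_⟩
  obtain ⟨c₆, r₆, h₆, hr₆, u₆⟩ := hre
  have hD6 : Disjoint (insert q ({y, x, w} ∪ Q)) Q' := by
    rw [disjoint_insert_left, disjoint_union_left]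
    exact ⟨hqQ', disjoint_of_subset_left hDK hQ', hQQ'⟩
  have hp6 : p ∉ insert q ({y, x, w} ∪ Q) := by
    rw [mem_insert, mem_union]; tauto
  have m7 := (var_combine v4 h₆ hD6 hp6 hc).maxCol h
  have z1 : Unc G (combine (slide c₃ v q p a) c₆ (insert q ({y, x, w} ∪ Q))) q p :=
    Unc.combine_left (by simp) s1
  have z2 : Unc G (combine (slide c₃ v q p a) c₆ (insert q ({y, x, w} ∪ Q))) q r :=
    Unc.combine_left (by simp) s2
  have z3 : Unc G (combine (slide c₃ v q p a) c₆ (insert q ({y, x, w} ∪ Q))) r₆ p :=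
    Unc.combine_right hD6 hp6 hr₆ (u₆.symm h₆.pcol)
  exact m7.no_path hdeg (z2.symm m7.toIsPCol) z1 (z3.symm m7.toIsPCol) hrp
    (by rintro rfl; exact hqQ' hr₆)

end

section

variable {V : Type*} [Fintype V] [DecidableEq V] {G : SimpleGraph V} {c c' c₁ c₂ : PCol V}

/-- The vertex sets of the components of the uncolored graph. -/
def IsComp (G : SimpleGraph V) (c : PCol V) (Q : Finset V) : Prop :=
  (∃ y x z, IsPair G c y x z ∧ Q = {y, x, z}) ∨ ∃ x y, IsSing G c x y ∧ Q = {x, y}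

/-- `K` is a cluster for the component `Q` consisting of a single edge. -/
def SingCluster (G : SimpleGraph V) (c : PCol V) (Q K : Finset V) : Prop :=
  ∃ x y, IsSing G c x y ∧ Q = {x, y} ∧ Q ⊆ K ∧ ∃ m : V → Finset (Fin 5),
    (∀ q ∈ K, Guard G c Q q (m q)) ∧
      ((K.card = 4 ∧ 3 + 2 * ∑ q ∈ K, (miss c q).card ≤ ∑ q ∈ K, (m q).card) ∨
        (K.card = 3 ∧ ∑ q ∈ K, (miss c q).card ≤ 2 ∧
          ∀ q ∈ K, 2 ≤ (m q).card ∧ miss c q ⊆ m q ∧ ∀ p ∈ K, ∀ α, c q p = some α → α ∈ m q))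

/-- `K` is a cluster for the component `Q` consisting of two edges. -/
def PairCluster (G : SimpleGraph V) (c : PCol V) (Q K : Finset V) : Prop :=
  ∃ y x z, IsPair G c y x z ∧ Q = {y, x, z} ∧ Q ⊆ K ∧ (∀ q ∈ K, ReachP G c Q q) ∧
    ((K.card = 6 ∧ ∑ v ∈ K, (miss c v).card ≤ 7) ∨ Tight G c Q K ∨
      ∃ w w' a b, Source G c y x z w w' a b ∧ K = {y, x, z, w, w'})

theorem IsComp.exists_unc (hc : IsPCol G c) {Q : Finset V} (hQ : IsComp G c Q) {p : V}
    (hp : p ∈ Q) : ∃ t, Unc G c p t := by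
  rcases hQ with ⟨y, x, z, h, rfl⟩ | ⟨x, y, h, rfl⟩
  · simp only [mem_insert, mem_singleton] at hp
    rcases hp with rfl | rfl | rfl
    exacts [⟨x, h.left⟩, ⟨y, h.left.symm hc⟩, ⟨y, h.right.symm hc⟩]
  · simp only [mem_insert, mem_singleton] at hp
    rcases hp with rfl | rfl
    exacts [⟨y, h.unc⟩, ⟨x, h.unc.symm hc⟩]

theorem IsComp.subset_of_closed (hc : IsPCol G c) {Q S : Finset V} (hQ : IsComp G c Q)
    (hS : ∀ p ∈ S, ∀ t, Unc G c p t → t ∈ S) {p : V} (hp : p ∈ Q) (hpS : p ∈ S) : Q ⊆ S := by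
  rcases hQ with ⟨y, x, z, h, rfl⟩ | ⟨x, y, h, rfl⟩
  · have hy : y ∈ S := by
      simp only [mem_insert, mem_singleton] at hp
      rcases hp with rfl | rfl | rfl
      exacts [hpS, hS _ hpS _ (h.left.symm hc), hS _ hpS _ (h.right.symm hc)]
    have hx := hS _ hy _ h.left
    have hz := hS _ hy _ h.right
    intro t ht
    simp only [mem_insert, mem_singleton] at ht
    rcases ht with rfl | rfl | rfl <;> assumption
  · have hy : y ∈ S := by
      simp only [mem_insert, mem_singleton] at hp
      rcases hp with rfl | rfl
      exacts [hS _ hpS _ h.unc, hpS]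
    have hx := hS _ hy _ (h.unc.symm hc)
    intro t ht
    simp only [mem_insert, mem_singleton] at ht
    rcases ht with rfl | rfl <;> assumption

theorem SingCluster.subset {Q K : Finset V} (h : SingCluster G c Q K) : Q ⊆ K := by
  obtain ⟨_, _, _, _, h, _⟩ := h; exact h

theorem PairCluster.subset {Q K : Finset V} (h : PairCluster G c Q K) : Q ⊆ K := by
  obtain ⟨_, _, _, _, _, h, _⟩ := h; exact h

theorem PairCluster.reachP {Q K : Finset V} (h : PairCluster G c Q K) {q : V} (hq : q ∈ K) :
    ReachP G c Q q := by
  obtain ⟨_, _, _, _, _, _, h, _⟩ := h; exact h q hq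

theorem SingCluster.reachS {Q K : Finset V} (h : SingCluster G c Q K) {q : V} (hq : q ∈ K) :
    ReachS G c Q q := by
  obtain ⟨_, _, _, _, _, m, h, _⟩ := h; exact (h q hq).reachS

variable (hdeg : ∀ v, (G.neighborSet v).ncard ≤ 5)

section
include hdeg

theorem MaxCol.mem_of_unc_comp (h : MaxCol G c) {Q : Finset V} (hQ : IsComp G c Q) {p t : V}
    (hp : p ∈ Q) (ht : Unc G c p t) : t ∈ Q := by
  rcases hQ with ⟨y, x, z, h', rfl⟩ | ⟨x, y, h', rfl⟩
  · exact h.mem_of_unc_pair hdeg h' hp ht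
  · exact h'.mem_of_unc hp ht

theorem MaxCol.comp_disjoint (h : MaxCol G c) {Q Q' : Finset V} (hQ : IsComp G c Q)
    (hQ' : IsComp G c Q') (hne : Q ≠ Q') : Disjoint Q Q' := by
  rw [disjoint_left]
  intro p hp hp'
  exact hne (subset_antisymm
    (hQ.subset_of_closed h.toIsPCol (fun _ hp _ => h.mem_of_unc_comp hdeg hQ' hp) hp hp')
    (hQ'.subset_of_closed h.toIsPCol (fun _ hp _ => h.mem_of_unc_comp hdeg hQ hp) hp' hp))

theorem Opt.exists_cluster (h : Opt G c) (hG : CliqueClosed G) {Q : Finset V}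
    (hQ : IsComp G c Q) : ∃ K, SingCluster G c Q K ∨ PairCluster G c Q K := by
  rcases hQ with ⟨y, x, z, h', rfl⟩ | ⟨x, y, h', rfl⟩
  · obtain ⟨K, k1, k2, k3⟩ := h.exists_pair_cluster hdeg hG h'
    exact ⟨K, Or.inr ⟨y, x, z, h', rfl, k1, k2, k3⟩⟩
  · obtain ⟨K, m, k1, k2, k3⟩ := h.exists_sing_cluster hdeg h'
    exact ⟨K, Or.inl ⟨x, y, h', rfl, k1, m, k2, k3⟩⟩

theorem Opt.cluster_disjoint (h : Opt G c) {Q Q' K K' : Finset V} (hQ : Disjoint Q Q')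
    (hK : SingCluster G c Q K ∨ PairCluster G c Q K)
    (hK' : SingCluster G c Q' K' ∨ PairCluster G c Q' K') : Disjoint K K' := by
  rw [disjoint_left]
  intro q hq hq'
  rcases hK with hK | hK
  · rcases hK' with hK' | hK'
    · have r := hK.reachS hq
      have r' := hK'.reachS hq'
      obtain ⟨x, y, hs, rfl, -⟩ := hK
      obtain ⟨x', y', hs', rfl, -⟩ := hK'
      exact h.sing_disjoint hdeg hs hs' hQ r r'
    · exact h.toMaxCol.reachP_disjoint hdeg (hK'.reachP hq') (hK.reachS hq) hQ.symm
  · refine h.toMaxCol.reachP_disjoint hdeg (hK.reachP hq) ?_ hQ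
    rcases hK' with hK' | hK'
    exacts [hK'.reachS hq', (hK'.reachP hq').reachS]

end

/-- A choice of a cluster for every component. -/
def Clustering (G : SimpleGraph V) (c : PCol V) (K : Finset V → Finset V) : Prop :=
  ∀ Q, IsComp G c Q → SingCluster G c Q (K Q) ∨ PairCluster G c Q (K Q)

/-- The edge `vq` carries weight from a source cluster to another cluster. -/
def Hit (G : SimpleGraph V) (c : PCol V) (K : Finset V → Finset V) (v q : V) : Prop :=
  ∃ y x z w w' a b, Source G c y x z w w' a b ∧ K {y, x, z} = {y, x, z, w, w'} ∧
    (v = x ∨ v = w) ∧ q ∉ ({y, x, z, w, w'} : Finset V) ∧ (∃ γ ∈ miss c y, c v q = some γ) ∧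
    ∃ Q, IsComp G c Q ∧ q ∈ K Q

open Classical in
/-- The vertices in some cluster. -/
noncomputable def cover (G : SimpleGraph V) (c : PCol V) (K : Finset V → Finset V) : Finset V :=
  univ.filter fun v => ∃ Q, IsComp G c Q ∧ v ∈ K Q

theorem mem_cover {K : Finset V → Finset V} {v : V} :
    v ∈ cover G c K ↔ ∃ Q, IsComp G c Q ∧ v ∈ K Q := by
  simp [cover]

theorem Clustering.reachS {K : Finset V → Finset V} (hK : Clustering G c K) {Q : Finset V}
    (hQ : IsComp G c Q) {q : V} (hq : q ∈ K Q) : ReachS G c Q q := by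
  rcases hK Q hQ with h | h
  exacts [h.reachS hq, (h.reachP hq).reachS]

theorem Clustering.subset {K : Finset V → Finset V} (hK : Clustering G c K) {Q : Finset V}
    (hQ : IsComp G c Q) : Q ⊆ K Q := by
  rcases hK Q hQ with h | h
  exacts [h.subset, h.subset]

include hdeg

theorem Opt.clustering_disjoint (h : Opt G c) {K : Finset V → Finset V} (hK : Clustering G c K)
    {Q Q' : Finset V} (hQ : IsComp G c Q) (hQ' : IsComp G c Q') (hne : Q ≠ Q') :
    Disjoint (K Q) (K Q') :=
  h.cluster_disjoint hdeg (h.toMaxCol.comp_disjoint hdeg hQ hQ' hne) (hK Q hQ) (hK Q' hQ')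

theorem Opt.exists_clustering (h : Opt G c) (hG : CliqueClosed G) : ∃ K, Clustering G c K := by
  choose! K hK using fun Q (hQ : IsComp G c Q) => h.exists_cluster hdeg hG hQ
  exact ⟨K, hK⟩

/-- An edge carrying weight does not end in the cluster of a pair. -/
theorem Opt.not_hit_of_pairCluster (h : Opt G c) {K : Finset V → Finset V}
    (hK : Clustering G c K) {Q : Finset V} (hQ : IsComp G c Q) (hP : PairCluster G c Q (K Q))
    {v q : V} (hq : q ∈ K Q) : ¬ Hit G c K v q := by
  rintro ⟨y, x, z, w, w', a, b, hS, hKS, hv, hqK, ⟨γ, hγ, hvq⟩, -⟩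
  have hc := h.toIsPCol
  have hQS : IsComp G c {y, x, z} := Or.inl ⟨y, x, z, hS.pair, rfl⟩
  have hne : ({y, x, z} : Finset V) ≠ Q := by
    rintro rfl; rw [hKS] at hq; exact hqK hq
  have hd := h.clustering_disjoint hdeg hK hQS hQ hne
  rw [hKS] at hd
  have ha : a ∈ miss c x := by rw [hS.miss_x]; simp
  have hDK : ({y, x, w} : Finset V) ⊆ {y, x, z, w, w'} := by grind
  have hqD : q ∉ ({y, x, w} : Finset V) := fun h' => hqK (hDK h')
  have hqx : q ≠ x := by rintro rfl; simp at hqD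
  have hqw : q ≠ w := by rintro rfl; simp at hqD
  obtain ⟨c₁, h₁, u1, -⟩ := hS.pair.exists_move hc ha hS.yw hv hγ hvq hqx hqw
  refine h.toMaxCol.false_of_unc_of_reachP hdeg h₁ hqD ?_ u1 (hP.reachP hq)
    (disjoint_of_subset_left hDK (disjoint_of_subset_right (hK.subset hQ) hd))
  rcases hv with rfl | rfl <;> simp

/-- At a vertex of a single-edge cluster, edges bringing weight avoid the guard and force an edge
to a vertex outside all clusters. -/
theorem Opt.hit_of_singCluster (h : Opt G c) {K : Finset V → Finset V}
    (hK : Clustering G c K) {Q : Finset V} (hQ : IsComp G c Q) {v q : V} (hq : q ∈ K Q)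
    {m : Finset (Fin 5)} (hm : Guard G c Q q m) (hh : Hit G c K v q) :
    (∃ γ, γ ∉ m ∧ c q v = some γ) ∧
      ∃ a, a ∉ m ∧ ∀ p, p ∉ K Q → c q p = some a → p ∉ cover G c K := by
  obtain ⟨y, x, z, w, w', a, b, hS, hKS, hv, hqK, ⟨γ, hγ, hvq⟩, -⟩ := hh
  have hc := h.toIsPCol
  have hQS : IsComp G c {y, x, z} := Or.inl ⟨y, x, z, hS.pair, rfl⟩
  have hne : ({y, x, z} : Finset V) ≠ Q := by
    rintro rfl; rw [hKS] at hq; exact hqK hq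
  have hd := h.clustering_disjoint hdeg hK hQS hQ hne
  rw [hKS] at hd
  obtain ⟨e1, e2, e3⟩ := source_edge hdeg h.toMaxCol hS hv hγ hvq hqK hm
    (disjoint_of_subset_right (hK.subset hQ) hd)
  refine ⟨⟨γ, e1, by rw [hc.symm]; exact hvq⟩, a, e2, fun p hp hpa hpC => ?_⟩
  obtain ⟨f1, f2⟩ := e3 p (fun h' => hp (hK.subset hQ h')) hpa
  obtain ⟨Q', hQ', hpQ'⟩ := mem_cover.1 hpC
  have n1 : Q ≠ Q' := by rintro rfl; exact hp hpQ'
  have n2 : ({y, x, z} : Finset V) ≠ Q' := by rintro rfl; rw [hKS] at hpQ'; exact f1 hpQ'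
  have d1 := h.clustering_disjoint hdeg hK hQ hQ' n1
  have d2 := h.clustering_disjoint hdeg hK hQS hQ' n2
  rw [hKS] at d2
  have hs := hK.subset hQ'
  exact f2 Q' (disjoint_of_subset_right hs d2)
    (disjoint_of_subset_left (hK.subset hQ) (disjoint_of_subset_right hs d1))
    (fun h' => disjoint_left.1 d1 hq (hs h')) (hK.reachS hQ' hpQ')

end

section

variable {V : Type*} [Fintype V] [DecidableEq V] {G : SimpleGraph V} {c c' c₁ c₂ : PCol V}

/-- The neighbors of `v` along colored edges. -/
def colNbr (c : PCol V) (v : V) : Finset V := univ.filter fun u => c v u ≠ none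

theorem mem_colNbr {u v : V} : u ∈ colNbr c v ↔ c v u ≠ none := by simp [colNbr]

theorem mem_colNbr_of_eq {u v : V} {α : Fin 5} (h : c v u = some α) : u ∈ colNbr c v := by
  rw [mem_colNbr, h]; simp

theorem card_colors (hc : IsPCol G c) (v : V) (E : Finset (Fin 5)) (hE : Disjoint E (miss c v)) :
    (univ.filter fun u => ∃ γ ∈ E, c v u = some γ).card = E.card := by
  have h1 : ∀ γ ∈ E, ∃ u, c v u = some γ := fun γ hγ => not_mem_miss.1 (disjoint_left.1 hE hγ)
  have : Nonempty V := ⟨v⟩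
  choose! f hf using h1
  symm
  refine card_bij (fun γ _ => f γ) (fun γ hγ => ?_) (fun γ hγ γ' hγ' he => ?_) (fun u hu => ?_)
  · simp only [mem_filter, mem_univ, true_and]; exact ⟨γ, hγ, hf γ hγ⟩
  · have h1 := hf γ hγ
    have h2 := hf γ' hγ'
    rw [he, h2] at h1
    exact (Option.some.inj h1).symm
  · simp only [mem_filter, mem_univ, true_and] at hu
    obtain ⟨γ, hγ, hu⟩ := hu
    exact ⟨γ, hγ, hc.inj v _ _ γ (hf γ hγ) hu⟩

theorem card_colNbr (hc : IsPCol G c) (v : V) : (colNbr c v).card + (miss c v).card = 5 := by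
  have h1 := card_colors hc v (miss c v)ᶜ disjoint_compl_left
  have h2 : (univ.filter fun u => ∃ γ ∈ (miss c v)ᶜ, c v u = some γ) = colNbr c v := by
    ext u
    simp only [mem_filter, mem_univ, true_and, mem_colNbr, mem_compl]
    constructor
    · rintro ⟨γ, -, h⟩; rw [h]; simp
    · intro h
      obtain ⟨γ, h⟩ := Option.ne_none_iff_exists'.1 h
      exact ⟨γ, not_mem_miss.2 ⟨u, h⟩, h⟩
  rw [h2, card_compl, Fintype.card_fin] at h1
  have := card_le_univ (miss c v)
  rw [Fintype.card_fin] at this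
  omega

theorem num_eq_sum (c : PCol V) : num c = ∑ v, (colNbr c v).card := by
  rw [num, Fintype.sum_prod_type]
  refine sum_congr rfl fun v _ => ?_
  rw [colNbr, card_filter]
  exact sum_congr rfl fun u _ => by by_cases h : c v u = none <;> simp [h]

open Classical in
/-- Weight of the edge `vu` at `v`. -/
noncomputable def share (G : SimpleGraph V) (c : PCol V) (K : Finset V → Finset V) (v u : V) : ℤ :=
  2 + (if u ∈ cover G c K then 0 else 2) + (if Hit G c K v u then 1 else 0) -
    if Hit G c K u v then 1 else 0

/-- Total weight at `v`. -/
noncomputable def charge (G : SimpleGraph V) (c : PCol V) (K : Finset V → Finset V) (v : V) : ℤ :=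
  ∑ u ∈ colNbr c v, share G c K v u

theorem Hit.mem_cover_right {K : Finset V → Finset V} {v u : V} (h : Hit G c K v u) :
    u ∈ cover G c K := by
  obtain ⟨y, x, z, w, w', a, b, -, -, -, -, -, h⟩ := h
  exact mem_cover.2 h

theorem Hit.mem_cover_left {K : Finset V → Finset V} {v u : V} (h : Hit G c K v u) :
    v ∈ cover G c K := by
  obtain ⟨y, x, z, w, w', a, b, hS, hK, hv, -⟩ := h
  refine mem_cover.2 ⟨_, Or.inl ⟨y, x, z, hS.pair, rfl⟩, ?_⟩
  rw [hK]
  rcases hv with rfl | rfl <;> simp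

theorem share_add_le {K : Finset V → Finset V} (u v : V) :
    (if v ∈ cover G c K then share G c K v u else 0) +
      (if u ∈ cover G c K then share G c K u v else 0) ≤ 4 := by
  classical
  have h1 : Hit G c K v u → u ∈ cover G c K := Hit.mem_cover_right
  have h2 : Hit G c K v u → v ∈ cover G c K := Hit.mem_cover_left
  have h3 : Hit G c K u v → v ∈ cover G c K := Hit.mem_cover_right
  have h4 : Hit G c K u v → u ∈ cover G c K := Hit.mem_cover_left
  unfold share
  split_ifs <;> first | omega | tauto

theorem sum_charge_le (hc : IsPCol G c) (K : Finset V → Finset V) :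
    ∑ v ∈ cover G c K, charge G c K v ≤ 2 * num c := by
  classical
  have h0 : ∑ v ∈ cover G c K, charge G c K v = ∑ v, ∑ u,
      if c v u ≠ none then (if v ∈ cover G c K then share G c K v u else 0) else 0 := by
    have : ∑ v ∈ cover G c K, charge G c K v =
        ∑ v, if v ∈ cover G c K then charge G c K v else 0 := by rw [sum_ite_mem, univ_inter]
    rw [this]
    refine sum_congr rfl fun v _ => ?_
    rw [← sum_filter]
    split_ifs
    · rfl
    · simp
  have h1 := sum_comm (s := univ) (t := univ) (f := fun v u =>
      if c v u ≠ none then (if v ∈ cover G c K then share G c K v u else 0) else 0)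
  have h2 : ∑ v, ∑ u, (if c v u ≠ none then (if v ∈ cover G c K then share G c K v u else 0) else 0)
      + ∑ v, ∑ u, (if c u v ≠ none then (if u ∈ cover G c K then share G c K u v else 0) else 0)
      ≤ ∑ v, ∑ u, if c v u ≠ none then 4 else 0 := by
    simp only [← sum_add_distrib]
    refine sum_le_sum fun v _ => sum_le_sum fun u _ => ?_
    rw [hc.symm u v]
    have := share_add_le (G := G) (c := c) (K := K) u v
    by_cases h : c v u = none <;> simp only [h, ne_eq, not_true_eq_false, not_false_eq_true,
      if_true, if_false] <;> omega
  have h3 : ∑ v, ∑ u, (if c v u ≠ none then (4 : ℤ) else 0) = 4 * num c := by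
    rw [num_eq_sum]
    push_cast
    rw [mul_sum]
    refine sum_congr rfl fun v _ => ?_
    rw [← sum_filter, sum_const, colNbr]
    simp [mul_comm]
  rw [h3] at h2
  rw [h0]
  rw [← h1] at h2
  linarith

end

section

variable {V : Type*} [Fintype V] [DecidableEq V] {G : SimpleGraph V} {c c' c₁ c₂ : PCol V}

open Classical in
theorem charge_eq (K : Finset V → Finset V) (v : V) : charge G c K v =
    2 * (colNbr c v).card + 2 * ((colNbr c v).filter fun u => u ∉ cover G c K).card +
      ((colNbr c v).filter fun u => Hit G c K v u).card -
      ((colNbr c v).filter fun u => Hit G c K u v).card := by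
  unfold charge share
  rw [sum_sub_distrib, sum_add_distrib, sum_add_distrib, sum_const, card_filter, card_filter,
    card_filter]
  push_cast
  rw [mul_sum]
  congr 3
  · simp [mul_comm]
  · exact sum_congr rfl fun u _ => by split_ifs <;> simp_all

theorem le_charge_of_no_hit {K : Finset V → Finset V} {v : V} (h : ∀ u, ¬ Hit G c K u v)
    {S : Finset V} (hS : ∀ u ∈ S, u ∈ colNbr c v ∧ (u ∈ cover G c K → Hit G c K v u)) :
    (2 * (colNbr c v).card + S.card : ℤ) ≤ charge G c K v := by
  classical
  rw [charge_eq]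
  have h1 : ((colNbr c v).filter fun u => Hit G c K u v) = ∅ := by simp [h]
  have h2 : S ⊆ ((colNbr c v).filter fun u => u ∉ cover G c K) ∪
      ((colNbr c v).filter fun u => Hit G c K v u) := by
    intro u hu
    have := hS u hu
    simp only [mem_union, mem_filter]
    tauto
  have h3 := (card_le_card h2).trans (card_union_le _ _)
  rw [h1]
  push_cast [card_empty]
  omega

theorem le_charge_of_exists {K : Finset V → Finset V} {v u : V} (h : ∀ u, ¬ Hit G c K u v)
    (hu : c v u ≠ none) (hu' : u ∉ cover G c K) :
    (2 * (colNbr c v).card + 2 : ℤ) ≤ charge G c K v := by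
  classical
  rw [charge_eq]
  have h1 : ((colNbr c v).filter fun u => Hit G c K u v) = ∅ := by simp [h]
  have h3 : 1 ≤ ((colNbr c v).filter fun u => u ∉ cover G c K).card :=
    card_pos.2 ⟨u, by simp [mem_colNbr, hu, hu']⟩
  rw [h1]
  push_cast [card_empty]
  omega

theorem card_hits_le (hc : IsPCol G c) {K : Finset V → Finset V} {v : V} {m : Finset (Fin 5)}
    [DecidablePred fun u => Hit G c K u v]
    (h : ∀ u, Hit G c K u v → ∃ γ, γ ∉ m ∧ c v u = some γ) :
    ((colNbr c v).filter fun u => Hit G c K u v).card + m.card ≤ 5 := by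
  have h1 : ((colNbr c v).filter fun u => Hit G c K u v).card ≤ mᶜ.card := by
    have : ((colNbr c v).filter fun u => Hit G c K u v).card =
        (((colNbr c v).filter fun u => Hit G c K u v).image fun u => c v u).card := by
      rw [card_image_of_injOn]
      intro u hu u' hu' he
      simp only [coe_filter, Set.mem_ofPred_eq] at hu hu'
      obtain ⟨γ, -, hγ⟩ := h u hu.2
      exact hc.inj v u u' γ hγ (Eq.trans he.symm hγ)
    rw [this, ← card_map Function.Embedding.some (s := mᶜ)]
    refine card_le_card fun o ho => ?_
    simp only [mem_image, mem_filter] at ho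
    obtain ⟨u, ⟨-, hu⟩, rfl⟩ := ho
    obtain ⟨γ, h1, h2⟩ := h u hu
    simp only [mem_map, mem_compl]
    exact ⟨γ, h1, h2.symm⟩
  rw [card_compl, Fintype.card_fin] at h1
  have := card_le_univ m
  rw [Fintype.card_fin] at this
  omega

theorem sum_two_mul_colNbr (hc : IsPCol G c) (S : Finset V) :
    ∑ v ∈ S, (2 * (colNbr c v).card : ℤ) =
      10 * S.card - 2 * ((∑ v ∈ S, (miss c v).card : ℕ) : ℤ) := by
  have : ∀ v ∈ S, (2 * (colNbr c v).card : ℤ) = 10 - 2 * ((miss c v).card : ℤ) := fun v _ => by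
    have := card_colNbr hc v
    omega
  rw [sum_congr rfl this, sum_sub_distrib, ← mul_sum, sum_const]
  simp [mul_comm]

theorem Source.le_charge (h : Opt G c) {K : Finset V → Finset V}
    {y x z w w' v : V} {a b : Fin 5} (hS : Source G c y x z w w' a b)
    (hKS : K {y, x, z} = {y, x, z, w, w'}) (hv : v = x ∨ v = w)
    (hno : ∀ u, ¬ Hit G c K u v) :
    (2 * (colNbr c v).card + (miss c y).card - 1 : ℤ) ≤ charge G c K v := by
  have hc := h.toIsPCol
  have hvm : Disjoint (miss c y) (miss c v) := by
    rcases hv with rfl | rfl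
    · rw [disjoint_left]; exact h.disjoint_miss hS.pair.left
    · rw [hS.miss_w]; exact disjoint_empty_right _
  have h1 := card_colors hc v _ hvm
  obtain ⟨p, hp⟩ : ∃ p, ∀ u ∈ ({y, x, z, w, w'} : Finset V), ∀ γ ∈ miss c y,
      c v u = some γ → u = p := by
    have hs := hc.symm
    rcases hv with rfl | rfl
    · refine ⟨w, fun u hu γ hγ huv => ?_⟩
      simp only [mem_insert, mem_singleton] at hu
      rcases hu with rfl | rfl | rfl | rfl | rfl
      · exact absurd (hs _ _ ▸ huv) (mem_miss.1 hγ _)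
      · rw [hc.irrefl] at huv; cases huv
      · exact absurd huv (hS.xz γ hγ)
      · rfl
      · exact absurd huv (hS.xw' γ hγ)
    · refine ⟨x, fun u hu γ hγ huv => ?_⟩
      simp only [mem_insert, mem_singleton] at hu
      rcases hu with rfl | rfl | rfl | rfl | rfl
      · exact absurd (hs _ _ ▸ huv) (mem_miss.1 hγ _)
      · rfl
      · exact absurd (hs _ _ ▸ huv) (hS.zw γ hγ)
      · rw [hc.irrefl] at huv; cases huv
      · exact absurd huv (hS.ww' γ hγ)
  have h2 := le_charge_of_no_hit (S := (univ.filter fun u => ∃ γ ∈ miss c y, c v u = some γ).erase p)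
    hno (fun u hu => by
      simp only [mem_erase, mem_filter, mem_univ, true_and] at hu
      obtain ⟨hup, γ, hγ, huv⟩ := hu
      refine ⟨mem_colNbr_of_eq huv, fun hC => ⟨y, x, z, w, w', a, b, hS, hKS, hv,
        fun hu => hup (hp u hu γ hγ huv), ⟨γ, hγ, huv⟩, mem_cover.1 hC⟩⟩)
  have h3 := pred_card_le_card_erase (s := univ.filter fun u => ∃ γ ∈ miss c y, c v u = some γ)
    (a := p)
  rw [h1] at h3
  omega

variable (hdeg : ∀ v, (G.neighborSet v).ncard ≤ 5)
include hdeg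

theorem Opt.sing_charge (h : Opt G c) {K : Finset V → Finset V} (hK : Clustering G c K)
    {Q : Finset V} (hQ : IsComp G c Q) (hS : SingCluster G c Q (K Q)) :
    23 ≤ ∑ v ∈ K Q, charge G c K v := by
  classical
  obtain ⟨x, y, hxy, -, hsub, m, hm, hcase⟩ := hS
  have hc := h.toIsPCol
  have hits := fun v (hv : v ∈ K Q) u (hu : Hit G c K u v) =>
    h.hit_of_singCluster hdeg hK hQ hv (hm v hv) hu
  have hsum := sum_two_mul_colNbr hc (K Q)
  rcases hcase with ⟨k1, k2⟩ | ⟨k1, k2, k3⟩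
  · have : ∀ v ∈ K Q, (2 * (colNbr c v).card : ℤ) - 5 + (m v).card ≤ charge G c K v := by
      intro v hv
      have h1 := card_hits_le hc (K := K) (v := v) (m := m v) fun u hu => (hits v hv u hu).1
      rw [charge_eq]
      omega
    have h2 := sum_le_sum this
    rw [sum_add_distrib, sum_sub_distrib, hsum, sum_const, k1] at h2
    have : (∑ v ∈ K Q, ((m v).card : ℤ)) = ((∑ v ∈ K Q, (m v).card : ℕ) : ℤ) := by push_cast; rfl
    rw [this] at h2
    simp only [nsmul_eq_mul] at h2
    omega
  · have : ∀ v ∈ K Q, (2 * (colNbr c v).card : ℤ) - 1 ≤ charge G c K v := by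
      intro v hv
      have h1 := card_hits_le hc (K := K) (v := v) (m := m v) fun u hu => (hits v hv u hu).1
      obtain ⟨m1, m2, m3⟩ := k3 v hv
      rw [charge_eq]
      by_cases he : ∃ u, Hit G c K u v
      · obtain ⟨u, hu⟩ := he
        obtain ⟨-, a, ha, hp⟩ := hits v hv u hu
        obtain ⟨p, hvp⟩ := not_mem_miss.1 (fun h' => ha (m2 h'))
        have hpC := hp p (fun h' => ha (m3 p h' a hvp)) hvp
        have h3 : 1 ≤ ((colNbr c v).filter fun u => u ∉ cover G c K).card :=
          card_pos.2 ⟨p, by simp [mem_colNbr, hvp, hpC]⟩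
        omega
      · push Not at he
        have h1 : ((colNbr c v).filter fun u => Hit G c K u v) = ∅ := by simp [he]
        rw [h1]
        push_cast [card_empty]
        omega
    have h2 := sum_le_sum this
    rw [sum_sub_distrib, hsum, sum_const, k1] at h2
    simp only [nsmul_eq_mul] at h2
    omega

theorem Opt.pair_charge (h : Opt G c) {K : Finset V → Finset V} (hK : Clustering G c K)
    {Q : Finset V} (hQ : IsComp G c Q) (hP : PairCluster G c Q (K Q)) :
    46 ≤ ∑ v ∈ K Q, charge G c K v := by
  have hc := h.toIsPCol
  have hno : ∀ v ∈ K Q, ∀ u, ¬ Hit G c K u v := fun v hv u =>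
    h.not_hit_of_pairCluster hdeg hK hQ hP hv
  have hbase : ∀ v ∈ K Q, (2 * (colNbr c v).card : ℤ) ≤ charge G c K v := fun v hv => by
    simpa using le_charge_of_no_hit (S := ∅) (hno v hv) (by simp)
  have hsum := sum_two_mul_colNbr hc (K Q)
  obtain ⟨y, x, z, hp, rfl, hsub, -, hcase⟩ := hP
  rcases hcase with ⟨k1, k2⟩ | ht | ⟨w, w', a, b, hS, hKS⟩
  · have h2 := sum_le_sum hbase
    rw [hsum, k1] at h2
    omega
  · obtain ⟨k1, k2, v₁, hv₁, v₂, hv₂, hne, q₁, q₂, hq₁, hq₂, n₁, n₂, hreach⟩ := ht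
    have out : q₁ ∉ cover G c K ∧ q₂ ∉ cover G c K := by
      refine ⟨fun hC => ?_, fun hC => ?_⟩ <;>
      · obtain ⟨Q', hQ', hq⟩ := mem_cover.1 hC
        have hne : ({y, x, z} : Finset V) ≠ Q' := by rintro rfl; exact absurd hq ‹_›
        have := hreach Q' (h.toMaxCol.comp_disjoint hdeg hQ hQ' hne)
          (fun p hp => hQ'.exists_unc hc hp)
        have hr := hK.reachS hQ' hq
        tauto
    have e₁ := le_charge_of_exists (hno v₁ hv₁) hq₁ out.1
    have e₂ := le_charge_of_exists (hno v₂ hv₂) hq₂ out.2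
    have hle : ∀ v ∈ K {y, x, z}, (2 * (colNbr c v).card : ℤ) + ((if v = v₁ then 2 else 0) +
        if v = v₂ then 2 else 0) ≤ charge G c K v := by
      intro v hv
      have := hbase v hv
      split_ifs with i1 i2 i2
      · exact absurd (i1.symm.trans i2) hne
      · subst i1; simpa using e₁
      · subst i2; simpa using e₂
      · simpa using this
    have h2 := sum_le_sum hle
    rw [sum_add_distrib, sum_add_distrib, hsum, k1, sum_ite_eq', sum_ite_eq', if_pos hv₁,
      if_pos hv₂] at h2
    omega
  · rw [hKS] at hno hsum hbase ⊢
    have hs' := hS.swap hc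
    have hset : ({y, z, x} : Finset V) = {y, x, z} := by grind
    have hset' : ({y, z, x, w', w} : Finset V) = {y, x, z, w, w'} := by grind
    have hKS' : K {y, z, x} = {y, z, x, w', w} := by rw [hset, hset', hKS]
    have e1 := Source.le_charge h hS hKS (Or.inl rfl) (hno x (by simp))
    have e2 := Source.le_charge h hS hKS (Or.inr rfl) (hno w (by simp))
    have e3 := Source.le_charge h hs' hKS' (Or.inl rfl) (hno z (by simp))
    have e4 := Source.le_charge h hs' hKS' (Or.inr rfl) (hno w' (by simp))
    have e5 := hbase y (by simp)
    have py := two_le_card_miss hdeg hc hp.left hp.right hp.ne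
    have c1 := card_colNbr hc x
    have c2 := card_colNbr hc w
    have c3 := card_colNbr hc z
    have c4 := card_colNbr hc w'
    have c5 := card_colNbr hc y
    rw [hS.miss_x, card_singleton] at c1
    rw [hS.miss_z, card_singleton] at c3
    rw [hS.miss_w, card_empty] at c2
    rw [hS.miss_w', card_empty] at c4
    have hyx := hp.left.ne
    have hyz := hp.right.ne
    have hxz := hp.ne
    have hyw : y ≠ w := (hc.adj _ _ _ hS.yw).ne
    have hyw' : y ≠ w' := (hc.adj _ _ _ hS.yw').ne
    have hxw : x ≠ w := by rintro rfl; have := hp.left.2; have := hS.yw; grind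
    have hxw' : x ≠ w' := by rintro rfl; have := hp.left.2; have := hS.yw'; grind
    have hzw : z ≠ w := by rintro rfl; have := hp.right.2; have := hS.yw; grind
    have hzw' : z ≠ w' := by rintro rfl; have := hp.right.2; have := hS.yw'; grind
    have hww' : w ≠ w' := by
      rintro rfl
      have : a = b := by have := hS.yw; have := hS.yw'; grind
      subst this
      exact h.toMaxCol.disjoint_miss_two hdeg hp.left hp.right hp.ne
        (show a ∈ miss c x by rw [hS.miss_x]; simp) (by rw [hS.miss_z]; simp)
    rw [sum_insert (by simp [hyx, hyz, hyw, hyw']), sum_insert (by simp [hxz, hxw, hxw']),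
      sum_insert (by simp [hzw, hzw']), sum_insert (by simp [hww']), sum_singleton]
    omega

end

section

variable {V : Type*} [Fintype V] [DecidableEq V] {G : SimpleGraph V} {c c' c₁ c₂ : PCol V}

open Classical in
/-- The neighbors of `v` along uncolored edges. -/
noncomputable def uncNbr (G : SimpleGraph V) (c : PCol V) (v : V) : Finset V :=
  univ.filter fun u => Unc G c v u

theorem mem_uncNbr {u v : V} : u ∈ uncNbr G c v ↔ Unc G c v u := by simp [uncNbr]

theorem card_uncNbr_add (hc : IsPCol G c) (v : V) :
    (uncNbr G c v).card + (colNbr c v).card = (G.neighborSet v).ncard := by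
  rw [← card_union_of_disjoint, ← Set.ncard_coe_finset]
  · congr 1
    ext u
    simp only [coe_union, Set.mem_union, mem_coe, mem_uncNbr, mem_colNbr, SimpleGraph.mem_neighborSet]
    constructor
    · rintro (h | h)
      · exact h.1
      · obtain ⟨α, h⟩ := Option.ne_none_iff_exists'.1 h
        exact hc.adj _ _ _ h
    · intro h
      by_cases h' : c v u = none
      exacts [Or.inl ⟨h, h'⟩, Or.inr h']
  · rw [disjoint_left]
    intro u hu hu'
    exact mem_colNbr.1 hu' (mem_uncNbr.1 hu).2

theorem IsSing.sum_uncNbr_le {x y : V} (h : IsSing G c x y) :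
    ∑ v ∈ {x, y}, (uncNbr G c v).card ≤ 2 := by
  have h1 : uncNbr G c x ⊆ {y} := fun u hu => mem_singleton.2 (h.left u (mem_uncNbr.1 hu))
  have h2 : uncNbr G c y ⊆ {x} := fun u hu => mem_singleton.2 (h.right u (mem_uncNbr.1 hu))
  have := card_le_card h1
  have := card_le_card h2
  rw [sum_pair h.unc.ne]
  simp only [card_singleton] at *
  omega

variable (hdeg : ∀ v, (G.neighborSet v).ncard ≤ 5)
include hdeg

theorem MaxCol.sum_uncNbr_le (h : MaxCol G c) {y x z : V} (hp : IsPair G c y x z) :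
    ∑ v ∈ {y, x, z}, (uncNbr G c v).card ≤ 4 := by
  have h1 : uncNbr G c y ⊆ {x, z} := fun u hu => by
    have := h.eq_or_eq_of_unc_center hdeg hp (mem_uncNbr.1 hu); simpa using this
  have h2 : uncNbr G c x ⊆ {y} := fun u hu =>
    mem_singleton.2 (h.eq_of_unc_leaf hdeg hp (mem_uncNbr.1 hu))
  have h3 : uncNbr G c z ⊆ {y} := fun u hu =>
    mem_singleton.2 (h.eq_of_unc_leaf hdeg hp.swap (mem_uncNbr.1 hu))
  have := card_le_card h1
  have := card_le_card h2
  have := card_le_card h3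
  have := card_le_two (a := x) (b := z)
  rw [sum_insert (by simp [hp.left.ne, hp.right.ne]), sum_pair hp.ne]
  simp only [card_singleton] at *
  omega

theorem Opt.comp_charge (h : Opt G c) {K : Finset V → Finset V} (hK : Clustering G c K)
    {Q : Finset V} (hQ : IsComp G c Q) :
    (23 * (∑ v ∈ Q, (uncNbr G c v).card : ℕ) : ℤ) ≤ 2 * ∑ v ∈ K Q, charge G c K v := by
  rcases hK Q hQ with hS | hP
  · have h1 := h.sing_charge hdeg hK hQ hS
    obtain ⟨x, y, hs, rfl, -⟩ := hS
    have := hs.sum_uncNbr_le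
    omega
  · have h1 := h.pair_charge hdeg hK hQ hP
    obtain ⟨y, x, z, hp, rfl, -⟩ := hP
    have := h.toMaxCol.sum_uncNbr_le hdeg hp
    omega

theorem Opt.sum_uncNbr_le (h : Opt G c) (hG : CliqueClosed G) :
    23 * ∑ v, (uncNbr G c v).card ≤ 4 * num c := by
  classical
  have hc := h.toIsPCol
  obtain ⟨K, hK⟩ := h.exists_clustering hdeg hG
  have hd := fun {Q Q'} (hQ : IsComp G c Q) (hQ' : IsComp G c Q') (hne : Q ≠ Q') =>
    h.toMaxCol.comp_disjoint hdeg hQ hQ' hne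
  have hd' := fun {Q Q'} (hQ : IsComp G c Q) (hQ' : IsComp G c Q') (hne : Q ≠ Q') =>
    h.clustering_disjoint hdeg hK hQ hQ' hne
  set F : Finset (Finset V) := univ.filter fun Q => IsComp G c Q with hF
  have memF : ∀ {Q}, Q ∈ F ↔ IsComp G c Q := by simp [hF]
  have h1 : ∑ v, (uncNbr G c v).card = ∑ Q ∈ F, ∑ v ∈ Q, (uncNbr G c v).card := by
    rw [← sum_biUnion fun Q hQ Q' hQ' hne => hd (memF.1 hQ) (memF.1 hQ') hne]
    symm
    refine sum_subset (subset_univ _) fun v _ hv => ?_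
    rw [card_eq_zero, eq_empty_iff_forall_notMem]
    intro u hu
    refine hv (mem_biUnion.2 ?_)
    rcases (mem_uncNbr.1 hu).isPair_or_isSing hc with ⟨y, x, z, hp, hm, -⟩ | hs
    · exact ⟨_, memF.2 (Or.inl ⟨y, x, z, hp, rfl⟩), hm⟩
    · exact ⟨_, memF.2 (Or.inr ⟨v, u, hs, rfl⟩), by simp⟩
  have h2 : ∑ v ∈ cover G c K, charge G c K v = ∑ Q ∈ F, ∑ v ∈ K Q, charge G c K v := by
    rw [← sum_biUnion fun Q hQ Q' hQ' hne => hd' (memF.1 hQ) (memF.1 hQ') hne]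
    congr 1
    ext v
    simp [mem_cover, memF]
  have h3 := sum_le_sum fun Q (hQ : Q ∈ F) => h.comp_charge hdeg hK (memF.1 hQ)
  rw [← mul_sum, ← mul_sum, ← h2, ← Nat.cast_sum, ← h1] at h3
  have h4 := sum_charge_le hc K
  omega

end

section

/-- The edge `ij` of the complete graph keeps its color `τ (i + j)`. -/
def keeps (τ φ : Fin 5 → Fin 5) (i j : Fin 5) : Bool :=
  !(decide (i = j)) && !(decide (τ (i + j) = φ i)) && !(decide (τ (i + j) = φ j))

/-- Permutations used to color the complete graph on five vertices. -/
def cliquePerms : List (Fin 5 × Fin 5 × Fin 5 × Fin 5 × Fin 5) :=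
  [(0, 2, 1, 3, 4), (0, 3, 1, 4, 2), (0, 4, 1, 2, 3), (2, 1, 0, 4, 3), (2, 3, 0, 1, 4),
    (0, 4, 2, 3, 1), (3, 0, 4, 1, 2), (1, 0, 3, 2, 4), (3, 2, 0, 4, 1), (0, 1, 3, 4, 2),
    (2, 0, 4, 1, 3), (0, 3, 1, 2, 4), (2, 1, 3, 4, 0), (2, 3, 1, 0, 4)]

/-- Half of the number of ordered pairs satisfying `keeps`. -/
def keepCount (t₀ t₁ t₂ t₃ t₄ p₀ p₁ p₂ p₃ p₄ : Fin 5) : ℕ :=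
  let k (x y z : Fin 5) : ℕ := bif Nat.beq x y || Nat.beq x z then 0 else 1
  k t₁ p₀ p₁ + k t₂ p₀ p₂ + k t₃ p₀ p₃ + k t₄ p₀ p₄ + k t₃ p₁ p₂ + k t₄ p₁ p₃ + k t₀ p₁ p₄ +
    k t₀ p₂ p₃ + k t₁ p₂ p₄ + k t₂ p₃ p₄

theorem sum_keeps (τ φ : Fin 5 → Fin 5) : (∑ i, ∑ j, if keeps τ φ i j then 1 else 0) =
    2 * keepCount (τ 0) (τ 1) (τ 2) (τ 3) (τ 4) (φ 0) (φ 1) (φ 2) (φ 3) (φ 4) := by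
  have hs : ∀ i j, keeps τ φ i j = keeps τ φ j i := fun i j => by
    simp only [keeps, add_comm i j, eq_comm (a := i) (b := j), Bool.and_right_comm]
  have hb : ∀ x y : Fin 5, Nat.beq x y = decide (x = y) := by decide
  have hk : ∀ i j, (if keeps τ φ i j then 1 else 0) = if i = j then 0 else
      bif Nat.beq (τ (i + j)) (φ i) || Nat.beq (τ (i + j)) (φ j) then 0 else 1 := fun i j => by
    by_cases h1 : i = j <;> by_cases h2 : τ (i + j) = φ i <;>
      by_cases h3 : τ (i + j) = φ j <;> simp [keeps, *]
  simp only [Fin.sum_univ_five, hs 1 0, hs 2 0, hs 3 0, hs 4 0, hs 2 1, hs 3 1, hs 4 1, hs 3 2,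
    hs 4 2, hs 4 3]
  simp only [hk, keepCount, Fin.reduceAdd, Fin.reduceEq, if_true, if_false]
  ring

theorem exists_keepCount : ∀ b ∈ [(0 : Fin 5), 1], ∀ d ∈ [(0 : Fin 5), 1, 2, 3, 4],
    ∀ e ∈ [(0 : Fin 5), 1, 2, 3, 4], ∀ f ∈ [(0 : Fin 5), 1, 2, 3, 4], (cliquePerms.any fun t =>
      Nat.ble 8 (keepCount t.1 t.2.1 t.2.2.1 t.2.2.2.1 t.2.2.2.2 0 b d e f)) = true := by
  decide +kernel

theorem injective_of_mem_cliquePerms : ∀ t ∈ cliquePerms,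
    ∀ i j, ![t.1, t.2.1, t.2.2.1, t.2.2.2.1, t.2.2.2.2] i =
      ![t.1, t.2.1, t.2.2.1, t.2.2.2.1, t.2.2.2.2] j → i = j := by
  decide +kernel

theorem exists_perm_normal (a b : Fin 5) :
    ∃ π : Equiv.Perm (Fin 5), π a = 0 ∧ (π b = 0 ∨ π b = 1) := by
  by_cases h : Equiv.swap a 0 b = 0
  · exact ⟨Equiv.swap a 0, by simp, Or.inl h⟩
  · refine ⟨(Equiv.swap a 0).trans (Equiv.swap (Equiv.swap a 0 b) 1), ?_, Or.inr (by simp)⟩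
    rw [Equiv.trans_apply, Equiv.swap_apply_left]
    exact Equiv.swap_apply_of_ne_of_ne (Ne.symm h) (by decide)

theorem exists_keeps (φ : Fin 5 → Fin 5) : ∃ τ : Fin 5 → Fin 5, Function.Injective τ ∧
    16 ≤ ∑ i, ∑ j, if keeps τ φ i j then 1 else 0 := by
  obtain ⟨π, h0, h1⟩ := exists_perm_normal (φ 0) (φ 1)
  have hm : ∀ x : Fin 5, x ∈ [(0 : Fin 5), 1, 2, 3, 4] := by decide
  obtain ⟨t, ht, h⟩ := List.any_eq_true.1 (exists_keepCount (π (φ 1)) (by simpa using h1)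
    (π (φ 2)) (hm _) (π (φ 3)) (hm _) (π (φ 4)) (hm _))
  have hinj := injective_of_mem_cliquePerms t ht
  rw [Nat.ble_eq] at h
  set τ := ![t.1, t.2.1, t.2.2.1, t.2.2.2.1, t.2.2.2.2] with hτ
  refine ⟨fun i => π.symm (τ i), fun i j hij => hinj i j (π.symm.injective hij), ?_⟩
  have hk : ∀ i j, keeps (fun i => π.symm (τ i)) φ i j = keeps τ (fun i => π (φ i)) i j :=
    fun i j => by simp [keeps, Equiv.symm_apply_eq]
  simp only [hk]
  rw [sum_keeps, h0]
  exact Nat.mul_le_mul_left 2 h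

/-- The complete graph on five vertices has a partial coloring with at least eight edges avoiding
a prescribed color at every vertex. -/
theorem exists_clique_coloring (φ : Fin 5 → Fin 5) :
    ∃ κ : PCol (Fin 5), IsPCol ⊤ κ ∧ (∀ i, φ i ∈ miss κ i) ∧ 16 ≤ num κ := by
  obtain ⟨τ, hτ, h⟩ := exists_keeps φ
  refine ⟨fun i j => if keeps τ φ i j then some (τ (i + j)) else none, ⟨?_, ?_, ?_⟩, ?_, ?_⟩
  · intro i j
    simp only [keeps, add_comm i j, eq_comm (a := i) (b := j), Bool.and_right_comm]
  · intro i j α hij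
    rw [SimpleGraph.top_adj]
    rintro rfl
    simp [keeps] at hij
  · intro i j k α hj hk
    have h1 := (Option.ite_none_right_eq_some.1 hj).2
    have h2 := (Option.ite_none_right_eq_some.1 hk).2
    exact add_left_cancel (hτ (Option.some.inj (h1.trans h2.symm)))
  · intro i
    rw [mem_miss]
    intro j hj
    obtain ⟨h1, h2⟩ := Option.ite_none_right_eq_some.1 hj
    simp only [keeps, Bool.and_eq_true, Bool.not_eq_true', decide_eq_false_iff_not] at h1
    exact h1.1.2 (Option.some.inj h2)
  · rw [num, Fintype.sum_prod_type]
    refine h.trans (le_of_eq (sum_congr rfl fun i _ => sum_congr rfl fun j _ => ?_))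
    by_cases hk : keeps τ φ i j = true <;> simp [hk]

end

section

variable {V : Type*} [Fintype V] [DecidableEq V] {G : SimpleGraph V} {c c' c₁ c₂ : PCol V}

open Classical in
/-- The ordered pairs of adjacent vertices. -/
noncomputable def arcs (G : SimpleGraph V) : Finset (V × V) := univ.filter fun p => G.Adj p.1 p.2

theorem mem_arcs {p : V × V} : p ∈ arcs G ↔ G.Adj p.1 p.2 := by simp [arcs]

/-- The ordered pairs joined by a colored edge. -/
def colArcs {W : Type*} [Fintype W] (c : PCol W) : Finset (W × W) :=
  univ.filter fun p => c p.1 p.2 ≠ none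

theorem mem_colArcs {W : Type*} [Fintype W] {c : PCol W} {p : W × W} :
    p ∈ colArcs c ↔ c p.1 p.2 ≠ none := by simp [colArcs]

theorem card_colArcs {W : Type*} [Fintype W] (c : PCol W) : (colArcs c).card = num c := by
  rw [colArcs, card_filter, num]
  exact sum_congr rfl fun p _ => by by_cases h : c p.1 p.2 = none <;> simp [h]

theorem card_arcs (G : SimpleGraph V) : (arcs G).card = ∑ v, (G.neighborSet v).ncard := by
  classical
  rw [arcs, card_filter, Fintype.sum_prod_type]
  refine sum_congr rfl fun v _ => ?_
  rw [← card_filter, ← Set.ncard_coe_finset]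
  congr 1
  ext u
  simp

/-- Delete all edges at the vertices of `S`. -/
def isolate (G : SimpleGraph V) (S : Finset V) : SimpleGraph V where
  Adj u v := G.Adj u v ∧ u ∉ S ∧ v ∉ S
  symm := ⟨fun _ _ h => ⟨h.1.symm, h.2.2, h.2.1⟩⟩
  loopless := ⟨fun _ h => G.irrefl h.1⟩

/-- Extend the coloring `c` by `κ` on a clique with vertices numbered by `e`, and by `φ` on the
edges from the clique to the vertices `o`. -/
def glue (e : V → Option (Fin 5)) (o : Fin 5 → V) (φ : Fin 5 → Fin 5) (κ : PCol (Fin 5))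
    (c : PCol V) : PCol V := fun u v =>
  match e u, e v with
  | some i, some j => κ i j
  | some i, none => if v = o i then some (φ i) else none
  | none, some j => if u = o j then some (φ j) else none
  | none, none => c u v

theorem isPCol_glue {e : V → Option (Fin 5)} {o : Fin 5 → V} {φ : Fin 5 → Fin 5}
    {κ : PCol (Fin 5)} (he : ∀ u v i, e u = some i → e v = some i → u = v)
    (hκ : IsPCol ⊤ κ) (hφ : ∀ i, φ i ∈ miss κ i) (hc : IsPCol G c)
    (hφc : ∀ i, φ i ∈ miss c (o i)) (hφo : ∀ i j, o i = o j → φ i = φ j → i = j)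
    (hadj : ∀ u v i j, e u = some i → e v = some j → u ≠ v → G.Adj u v)
    (hadj' : ∀ u i, e u = some i → G.Adj u (o i)) : IsPCol G (glue e o φ κ c) := by
  simp only [mem_miss] at hφ hφc
  refine ⟨fun u v => ?_, fun u v α => ?_, fun v u w α => ?_⟩
  · unfold glue
    cases hu : e u <;> cases hv : e v <;> simp only
    · exact hc.symm u v
    · exact hκ.symm _ _
  · unfold glue
    cases hu : e u with
    | none =>
      cases hv : e v with
      | none => exact hc.adj u v α
      | some j =>
        simp only
        split_ifs with h
        · subst h; exact fun _ => (hadj' v j hv).symm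
        · simp
    | some i =>
      cases hv : e v with
      | none =>
        simp only
        split_ifs with h
        · subst h; exact fun _ => hadj' u i hu
        · simp
      | some j =>
        simp only
        intro h
        refine hadj u v i j hu hv ?_
        rintro rfl
        rw [hu] at hv
        obtain rfl := Option.some.inj hv
        rw [hκ.irrefl] at h
        cases h
  · unfold glue
    cases hv : e v with
    | none =>
      cases hu : e u with
      | none =>
        cases hw : e w with
        | none => exact hc.inj v u w α
        | some k =>
          simp only
          intro h1 h2
          rw [Option.ite_none_right_eq_some] at h2
          obtain ⟨rfl, h2'⟩ := h2
          rw [← h2'] at h1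
          exact absurd h1 (hφc k u)
      | some j =>
        cases hw : e w with
        | none =>
          simp only
          intro h2 h1
          rw [Option.ite_none_right_eq_some] at h2
          obtain ⟨rfl, h2'⟩ := h2
          rw [← h2'] at h1
          exact absurd h1 (hφc j w)
        | some k =>
          simp only
          intro h1 h2
          rw [Option.ite_none_right_eq_some] at h1 h2
          obtain ⟨h1, h1'⟩ := h1
          obtain ⟨h2, h2'⟩ := h2
          obtain rfl := hφo j k (h1.symm.trans h2) (Option.some.inj (h1'.trans h2'.symm))
          exact he u w j hu hw
    | some i =>
      cases hu : e u with
      | none =>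
        cases hw : e w with
        | none =>
          simp only
          intro h1 h2
          rw [Option.ite_none_right_eq_some] at h1 h2
          exact h1.1.trans h2.1.symm
        | some k =>
          simp only
          intro h1 h2
          rw [Option.ite_none_right_eq_some] at h1
          obtain ⟨-, h1'⟩ := h1
          rw [← h1'] at h2
          exact absurd h2 (hφ i k)
      | some j =>
        cases hw : e w with
        | none =>
          simp only
          intro h2 h1
          rw [Option.ite_none_right_eq_some] at h1
          obtain ⟨-, h1'⟩ := h1
          rw [← h1'] at h2
          exact absurd h2 (hφ i j)
        | some k =>
          simp only
          intro h1 h2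
          obtain rfl := hκ.inj i j k α h1 h2
          exact he u w j hu hw

theorem num_glue {e : V → Option (Fin 5)} {s o : Fin 5 → V} {φ : Fin 5 → Fin 5}
    {κ : PCol (Fin 5)} (hs : ∀ i, e (s i) = some i) (ho : ∀ i, e (o i) = none)
    (hc : ∀ u v, c u v ≠ none → e u = none ∧ e v = none) :
    num c + num κ + 10 ≤ num (glue e o φ κ c) := by
  have hinj : Function.Injective s := fun i j h => by
    have := hs i
    rw [h, hs j] at this
    exact (Option.some.inj this).symm
  have h0 : ∀ A : Finset (V × V), (∀ p ∈ A, e p.1 = none ∧ e p.2 = none) →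
      ∀ B : Finset (V × V), (∀ p ∈ B, e p.1 ≠ none ∨ e p.2 ≠ none) → Disjoint A B := by
    intro A hA B hB
    rw [disjoint_left]
    intro p hp hp'
    have := hA p hp
    have := hB p hp'
    tauto
  set K := (colArcs κ).image fun p => (s p.1, s p.2) with hK
  set L := (univ : Finset (Fin 5)).image fun i => (s i, o i) with hL
  set R := (univ : Finset (Fin 5)).image fun i => (o i, s i) with hR
  have cK : K.card = num κ := by
    rw [hK, card_image_of_injective, card_colArcs]
    exact fun p q h => Prod.ext (hinj (Prod.ext_iff.1 h).1) (hinj (Prod.ext_iff.1 h).2)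
  have cL : L.card = 5 := by
    rw [hL, card_image_of_injective]
    · simp
    · exact fun i j h => hinj (Prod.ext_iff.1 h).1
  have cR : R.card = 5 := by
    rw [hR, card_image_of_injective]
    · simp
    · exact fun i j h => hinj (Prod.ext_iff.1 h).2
  have mK : ∀ p ∈ K, ∃ i j, κ i j ≠ none ∧ p = (s i, s j) := by
    simp only [hK, mem_image, mem_colArcs]
    rintro _ ⟨q, hq, rfl⟩
    exact ⟨_, _, hq, rfl⟩
  have mL : ∀ p ∈ L, ∃ i, p = (s i, o i) := by
    simp only [hL, mem_image, mem_univ, true_and]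
    rintro _ ⟨i, rfl⟩
    exact ⟨i, rfl⟩
  have mR : ∀ p ∈ R, ∃ i, p = (o i, s i) := by
    simp only [hR, mem_image, mem_univ, true_and]
    rintro _ ⟨i, rfl⟩
    exact ⟨i, rfl⟩
  have dC : Disjoint (colArcs c) (K ∪ (L ∪ R)) := by
    refine h0 _ (fun p hp => hc _ _ (mem_colArcs.1 hp)) _ fun p hp => ?_
    simp only [mem_union] at hp
    rcases hp with hp | hp | hp
    · obtain ⟨i, j, -, rfl⟩ := mK p hp; simp [hs]
    · obtain ⟨i, rfl⟩ := mL p hp; simp [hs]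
    · obtain ⟨i, rfl⟩ := mR p hp; simp [hs]
  have dK : Disjoint K (L ∪ R) := by
    rw [disjoint_left]
    intro p hp hp'
    obtain ⟨i, j, -, rfl⟩ := mK p hp
    rcases mem_union.1 hp' with hp' | hp'
    · obtain ⟨k, hk⟩ := mL _ hp'
      have := ho k
      have h' : s j = o k := (Prod.ext_iff.1 hk).2
      rw [← h', hs] at this
      cases this
    · obtain ⟨k, hk⟩ := mR _ hp'
      have := ho k
      have h' : s i = o k := (Prod.ext_iff.1 hk).1
      rw [← h', hs] at this
      cases this
  have dL : Disjoint L R := by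
    rw [disjoint_left]
    intro p hp hp'
    obtain ⟨i, rfl⟩ := mL p hp
    obtain ⟨k, hk⟩ := mR _ hp'
    have := ho k
    have h' : s i = o k := (Prod.ext_iff.1 hk).1
    rw [← h', hs] at this
    cases this
  have hsub : colArcs c ∪ (K ∪ (L ∪ R)) ⊆ colArcs (glue e o φ κ c) := by
    intro p hp
    simp only [mem_union] at hp
    rw [mem_colArcs]
    rcases hp with hp | hp | hp | hp
    · have h1 := mem_colArcs.1 hp
      obtain ⟨h2, h3⟩ := hc _ _ h1
      simp only [glue, h2, h3]
      exact h1
    · obtain ⟨i, j, h, rfl⟩ := mK p hp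
      simpa only [glue, hs] using h
    · obtain ⟨i, rfl⟩ := mL p hp
      simp [glue, hs, ho]
    · obtain ⟨i, rfl⟩ := mR p hp
      simp [glue, hs, ho]
  have := card_le_card hsub
  rw [card_union_of_disjoint dC, card_union_of_disjoint dK, card_union_of_disjoint dL, cK, cL, cR,
    card_colArcs, card_colArcs] at this
  omega

end

section

variable {V : Type*} [Fintype V] [DecidableEq V] {G : SimpleGraph V} {c c' c₁ c₂ : PCol V}

theorem card_arcs_isolate {S : Finset V} (hS : S.card = 5) {s o : Fin 5 → V}
    (hsS : ∀ v ∈ S, ∃ i, s i = v) (hdeg : ∀ v, (G.neighborSet v).ncard ≤ 5)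
    (hN : ∀ i v, G.Adj (s i) v → v ∈ S ∨ v = o i) :
    (arcs G).card ≤ (arcs (isolate G S)).card + 30 := by
  classical
  have hsub : arcs G ⊆ arcs (isolate G S) ∪
      ((S.biUnion fun u => (univ.filter fun v => G.Adj u v).image fun v => (u, v)) ∪
        (univ : Finset (Fin 5)).image fun i => (o i, s i)) := by
    rintro ⟨u, v⟩ h
    rw [mem_arcs] at h
    simp only [mem_union, mem_arcs, mem_biUnion, mem_image, mem_filter, mem_univ, true_and,
      isolate]
    by_cases hu : u ∈ S
    · exact .inr (.inl ⟨u, hu, v, h, rfl⟩)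
    by_cases hv : v ∈ S
    · obtain ⟨i, rfl⟩ := hsS v hv
      rcases hN i u h.symm with h' | rfl
      · exact absurd h' hu
      · exact .inr (.inr ⟨i, rfl⟩)
    · exact .inl ⟨h, hu, hv⟩
  have h1 : (S.biUnion fun u => (univ.filter fun v => G.Adj u v).image fun v => (u, v)).card
      ≤ S.card * 5 := by
    refine card_biUnion_le_card_mul _ _ _ fun u _ => card_image_le.trans ?_
    refine le_trans (le_of_eq ?_) (hdeg u)
    rw [← Set.ncard_coe_finset]
    congr 1
    ext v
    simp
  have h2 : ((univ : Finset (Fin 5)).image fun i => (o i, s i)).card ≤ 5 :=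
    card_image_le.trans (by simp)
  have h3 := (card_le_card hsub).trans
    ((card_union_le _ _).trans (Nat.add_le_add_left (card_union_le _ _) _))
  omega

theorem exists_fiberwise_injective {o : Fin 5 → V}
    (h : ∀ v, (univ.filter fun i => o i = v).card ≤ (miss c v).card) :
    ∃ φ : Fin 5 → Fin 5, (∀ i, φ i ∈ miss c (o i)) ∧ ∀ i j, o i = o j → φ i = φ j → i = j := by
  have h' : ∀ v, Nonempty ((univ.filter fun i => o i = v) ↪ miss c v) := fun v =>
    Function.Embedding.nonempty_of_card_le (by simpa only [Fintype.card_coe] using h v)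
  let f := fun v => (h' v).some
  have hm : ∀ i v, o i = v → i ∈ univ.filter fun i => o i = v := by simp
  refine ⟨fun i => f (o i) ⟨i, hm i _ rfl⟩, fun i => Subtype.prop _, fun i j hij hφ => ?_⟩
  have key : ∀ v w (hi : o i = v) (hj : o j = w), v = w →
      (f v ⟨i, hm i v hi⟩ : Fin 5) = f w ⟨j, hm j w hj⟩ → i = j := by
    rintro v _ hi hj rfl hv
    exact congrArg Subtype.val ((f v).injective (Subtype.ext hv))
  exact key _ _ rfl rfl hij hφ

/-- A five-clique each of whose vertices has one neighbor outside extends a coloring of the rest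
of the graph with at least thirteen more edges. -/
theorem exists_pcol_of_isolate {S : Finset V} (hdeg : ∀ v, (G.neighborSet v).ncard ≤ 5)
    {s o : Fin 5 → V} (hsi : Function.Injective s) (hsS : ∀ v, v ∈ S ↔ ∃ i, s i = v)
    (hcl : ∀ u ∈ S, ∀ v ∈ S, u ≠ v → G.Adj u v) (ho : ∀ i, G.Adj (s i) (o i))
    (hoS : ∀ i, o i ∉ S) (hc : IsPCol (isolate G S) c) :
    ∃ c', IsPCol G c' ∧ num c + 26 ≤ num c' := by
  classical
  have hc' : IsPCol G c := ⟨hc.symm, fun u v α h => (hc.adj u v α h).1, hc.inj⟩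
  have hcS : ∀ u v, c u v ≠ none → u ∉ S ∧ v ∉ S := fun u v h => by
    obtain ⟨α, hα⟩ := Option.ne_none_iff_exists'.1 h
    exact (hc.adj u v α hα).2
  have hfib : ∀ v, (univ.filter fun i => o i = v).card ≤ (miss c v).card := fun v => by
    have hd : Disjoint ((univ.filter fun i => o i = v).image s) (colNbr c v) := by
      rw [disjoint_left]
      intro u hu hu'
      obtain ⟨i, -, rfl⟩ := mem_image.1 hu
      exact (hcS _ _ (mem_colNbr.1 hu')).2 ((hsS _).2 ⟨i, rfl⟩)
    have hs : (((univ.filter fun i => o i = v).image s ∪ colNbr c v : Finset V) : Set V) ⊆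
        G.neighborSet v := by
      intro u hu
      rcases mem_union.1 (mem_coe.1 hu) with hu | hu
      · obtain ⟨i, hi, rfl⟩ := mem_image.1 hu
        rw [← (mem_filter.1 hi).2]
        exact (ho i).symm
      · obtain ⟨α, hα⟩ := Option.ne_none_iff_exists'.1 (mem_colNbr.1 hu)
        exact hc'.adj v u α hα
    have h1 := Set.ncard_le_ncard hs (Set.toFinite _)
    rw [Set.ncard_coe_finset, card_union_of_disjoint hd, card_image_of_injective _ hsi] at h1
    have h2 := hdeg v
    have h3 := card_colNbr hc' v
    omega
  obtain ⟨φ, hφc, hφo⟩ := exists_fiberwise_injective hfib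
  obtain ⟨κ, hκ, hφ, hn⟩ := exists_clique_coloring φ
  let e : V → Option (Fin 5) := fun v => if h : ∃ i, s i = v then some h.choose else none
  have he : ∀ v i, e v = some i ↔ s i = v := fun v i => by
    by_cases h : ∃ i, s i = v
    · simp only [e, h, dif_pos, Option.some.injEq]
      exact ⟨fun h' => h' ▸ h.choose_spec, fun h' => hsi (h.choose_spec.trans h'.symm)⟩
    · simp only [e, h, dif_neg, not_false_iff]
      exact ⟨fun h' => (Option.some_ne_none i h'.symm).elim,
        fun h' => absurd ⟨i, h'⟩ h⟩
  have he' : ∀ v, v ∉ S → e v = none := fun v hv =>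
    dif_neg fun h => hv ((hsS v).2 h)
  refine ⟨glue e o φ κ c, isPCol_glue (fun u v i hu hv => ?_) hκ hφ hc' hφc hφo
    (fun u v i j hu hv huv => ?_) fun u i hu => ?_, ?_⟩
  · exact ((he _ _).1 hu).symm.trans ((he _ _).1 hv)
  · exact hcl u ((hsS u).2 ⟨i, (he _ _).1 hu⟩) v ((hsS v).2 ⟨j, (he _ _).1 hv⟩) huv
  · rw [← (he _ _).1 hu]
    exact ho i
  · have := num_glue (c := c) (s := s) (o := o) (φ := φ) (κ := κ) (e := e)
      (fun i => (he _ _).2 rfl) (fun i => he' _ (hoS i))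
      fun u v h => ⟨he' _ (hcS u v h).1, he' _ (hcS u v h).2⟩
    omega

theorem exists_pcol (G : SimpleGraph V) (hdeg : ∀ v, (G.neighborSet v).ncard ≤ 5) :
    ∃ c, IsPCol G c ∧ 23 * (arcs G).card ≤ 27 * num c := by
  induction hn : (arcs G).card using Nat.strong_induction_on generalizing G with
  | _ n ih =>
  by_cases hG : CliqueClosed G
  · obtain ⟨c, hc⟩ := exists_opt G
    refine ⟨c, hc.toIsPCol, ?_⟩
    have h1 := hc.sum_uncNbr_le hdeg hG
    rw [← hn, card_arcs, ← sum_congr rfl fun v _ => card_uncNbr_add hc.toIsPCol v,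
      sum_add_distrib, ← num_eq_sum]
    omega
  unfold CliqueClosed at hG
  push Not at hG
  obtain ⟨S, hS, hcl, hout⟩ := hG
  let E := S.equivFinOfCardEq hS
  let s : Fin 5 → V := fun i => E.symm i
  have hsi : Function.Injective s := Subtype.val_injective.comp E.symm.injective
  have hsS : ∀ v, v ∈ S ↔ ∃ i, s i = v := fun v =>
    ⟨fun h => ⟨E ⟨v, h⟩, by simp [s]⟩, by rintro ⟨i, rfl⟩; exact (E.symm i).2⟩
  choose o ho hoS using fun i => hout (s i) ((hsS _).2 ⟨i, rfl⟩)
  have hN : ∀ i v, G.Adj (s i) v → v ∈ S ∨ v = o i := fun i v h => by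
    by_contra! hv
    have hi : s i ∈ S := (hsS _).2 ⟨i, rfl⟩
    have hsub : ((insert v (insert (o i) (S.erase (s i))) : Finset V) : Set V) ⊆
        G.neighborSet (s i) := by
      intro u hu
      simp only [mem_coe, mem_insert, mem_erase] at hu
      rcases hu with rfl | rfl | ⟨h1, h2⟩
      · exact h
      · exact ho i
      · exact hcl _ hi _ h2 h1.symm
    have h1 := Set.ncard_le_ncard hsub (Set.toFinite _)
    rw [Set.ncard_coe_finset, card_insert_of_notMem, card_insert_of_notMem,
      card_erase_of_mem hi, hS] at h1
    · have := hdeg (s i)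
      omega
    · simp [hoS]
    · simp [hv.1, hv.2]
  have hle := card_arcs_isolate hS (fun v => (hsS v).1) hdeg hN
  have hlt : (arcs (isolate G S)).card < n := by
    rw [← hn]
    refine card_lt_card ⟨fun p hp => mem_arcs.2 (mem_arcs.1 hp).1, fun h => ?_⟩
    exact (mem_arcs.1 (h (mem_arcs.2 (ho 0) : (s 0, o 0) ∈ arcs G))).2.1 ((hsS _).2 ⟨0, rfl⟩)
  obtain ⟨c, hc, hcn⟩ := ih _ hlt (isolate G S) (fun v =>
    (Set.ncard_le_ncard (fun u hu => hu.1) (Set.toFinite _)).trans (hdeg v)) rfl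
  obtain ⟨c', hc', hn'⟩ := exists_pcol_of_isolate hdeg hsi hsS hcl ho hoS hc
  exact ⟨c', hc', by omega⟩

theorem card_arcs_eq_two_mul (G : SimpleGraph V) : (arcs G).card = 2 * G.edgeSet.ncard := by
  classical
  rw [card_arcs, ← SimpleGraph.coe_edgeFinset, Set.ncard_coe_finset,
    ← G.sum_degrees_eq_twice_card_edges]
  refine sum_congr rfl fun v _ => ?_
  rw [← SimpleGraph.card_neighborFinset_eq_degree, ← Set.ncard_coe_finset,
    SimpleGraph.coe_neighborFinset]

/-- The graph of colored edges. -/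
def colGraph (hc : IsPCol G c) : SimpleGraph V where
  Adj u v := c u v ≠ none
  symm := ⟨fun u v h => by rwa [hc.symm v u]⟩
  loopless := ⟨fun v h => h (hc.irrefl v)⟩

/-- The coloring of the unordered pairs. -/
def symCol (hc : IsPCol G c) : Sym2 V → ℕ :=
  Sym2.lift ⟨fun u v => ((c u v).getD 0 : Fin 5), fun u v => by
    simp only [hc.symm u v]⟩

theorem isProperEdgeColoring_symCol (hc : IsPCol G c) :
    IsProperEdgeColoring (colGraph hc) 5 (symCol hc) := by
  refine ⟨fun e _ => ?_, ?_⟩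
  · induction e with
    | _ u v => exact Fin.is_lt _
  · rintro e₁ h₁ e₂ h₂ hne ⟨v, hv₁, hv₂⟩
    obtain ⟨u, rfl⟩ := hv₁
    obtain ⟨w, rfl⟩ := hv₂
    obtain ⟨α, hα⟩ := Option.ne_none_iff_exists'.1 (show c v u ≠ none from h₁)
    obtain ⟨β, hβ⟩ := Option.ne_none_iff_exists'.1 (show c v w ≠ none from h₂)
    simp only [symCol, Sym2.lift_mk, hα, hβ, Option.getD_some]
    intro h
    rw [← Fin.ext h] at hβ
    exact hne (by rw [hc.inj v u w α hα hβ])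

end

end EdgeFive

/-- Every simple graph of maximum degree 5 has a 5-edge-colorable subgraph with at least
`(23/27)·|E|` edges. -/
theorem stmt12 {V : Type*} [Fintype V] (G : SimpleGraph V)
    (hdeg : ∀ v : V, (G.neighborSet v).ncard ≤ 5) :
    ∃ H : SimpleGraph V, H ≤ G ∧ (∃ c, IsProperEdgeColoring H 5 c) ∧
      (23 : ℚ) / 27 * G.edgeSet.ncard ≤ H.edgeSet.ncard := by
  classical
  obtain ⟨c, hc, hn⟩ := EdgeFive.exists_pcol G hdeg
  refine ⟨EdgeFive.colGraph hc, fun u v h => ?_, ⟨_, EdgeFive.isProperEdgeColoring_symCol hc⟩, ?_⟩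
  · obtain ⟨α, hα⟩ := Option.ne_none_iff_exists'.1 h
    exact hc.adj u v α hα
  · have h : EdgeFive.arcs (EdgeFive.colGraph hc) = EdgeFive.colArcs c := by
      ext p
      rw [EdgeFive.mem_arcs, EdgeFive.mem_colArcs]
      rfl
    rw [← EdgeFive.card_colArcs, ← h, EdgeFive.card_arcs_eq_two_mul,
      EdgeFive.card_arcs_eq_two_mul] at hn
    have hn' : (23 : ℚ) * (2 * G.edgeSet.ncard) ≤ 27 * (2 * (EdgeFive.colGraph hc).edgeSet.ncard) :=
      mod_cast hn
    linarith
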